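/- Let F/K be a finite Galois extension of number fields with Galois group G, let d be the degree of K over ℚ, and let S be a finite G-stable set of places of F containing all archimedean places and large enough that the class group Cl_{F,S} of the ring of S-integers is trivial. Then the equality [Ãr_F] = d·[ℤ[G]] − σ([ℤ[S]] − [O×_{F,S}]) holds in G₀(ℤ[G]). -/

import Mathlib

/-- A bundled finitely generated module over a ring `R`. -/
structure FGMod (R : Type) [Ring R] : Type 1 where
  carrier : Type
  [isAddCommGroup : AddCommGroup carrier]
  [isModule : Module R carrier]
  [isFinite : Module.Finite R carrier]

attribute [instance] FGMod.isAddCommGroup FGMod.isModule FGMod.isFinite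

/-- The subgroup of relations defining the Grothendieck group `G₀(R)`:
one relation `[M] = [L] + [N]` for each short exact sequence `0 → L → M → N → 0`
of finitely generated `R`-modules. -/
def G0Rel (R : Type) [Ring R] : AddSubgroup (FreeAbelianGroup (FGMod R)) :=
  AddSubgroup.closure
    { x | ∃ (L M N : FGMod R) (f : L.carrier →ₗ[R] M.carrier)
            (g : M.carrier →ₗ[R] N.carrier),
        Function.Injective f ∧ Function.Surjective g ∧ Function.Exact f g ∧
        x = FreeAbelianGroup.of M - FreeAbelianGroup.of L - FreeAbelianGroup.of N }

/-- The Grothendieck group `G₀(R)` of the category of finitely generated `R`-modules. -/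
def G0 (R : Type) [Ring R] : Type 1 :=
  FreeAbelianGroup (FGMod R) ⧸ G0Rel R

instance (R : Type) [Ring R] : AddCommGroup (G0 R) :=
  QuotientAddGroup.Quotient.addCommGroup _

/-- The class `[M] ∈ G₀(R)` of a finitely generated `R`-module `M` (junk value `0` if `M` is
not finitely generated). -/
noncomputable def G0.cls (R : Type) [Ring R] (M : Type) [AddCommGroup M] [Module R M] :
    G0 R := by
  classical
  exact
    if h : Module.Finite R M then
      QuotientAddGroup.mk (FreeAbelianGroup.of (@FGMod.mk R _ M _ _ h))
    else 0

open NumberField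
open scoped nonZeroDivisors TensorProduct

noncomputable section

variable (F : Type) [Field F] [NumberField F]

/-- The étale ℝ-algebra F_ℝ = F ⊗_ℚ ℝ. -/
abbrev FReal := ℝ ⊗[ℚ] F

/-- The canonical (finite-dimensional real vector space) topology on F_ℝ. -/
instance : TopologicalSpace (FReal F) :=
  TopologicalSpace.induced (Module.finBasis ℝ (FReal F)).equivFun inferInstance

/-- The group of fractional ideals of F. -/
abbrev IdealGroup := (FractionalIdeal (𝓞 F)⁰ F)ˣ

/-- The group of fractional ideals carries the discrete topology. -/
instance : TopologicalSpace (IdealGroup F) := ⊥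

/-- The ideal norm, as a group homomorphism to ℝˣ. -/
def idealNormHom : IdealGroup F →* ℝˣ :=
  (Units.map (Rat.castHom ℝ).toMonoidHom).comp
    (Units.map (FractionalIdeal.absNorm (R := 𝓞 F) (K := F)).toMonoidHom)

/-- The absolute value of the algebra norm on F_ℝˣ, as a group homomorphism to ℝˣ. -/
def absNormFR : (FReal F)ˣ →* ℝˣ :=
  (Units.map (absHom (α := ℝ)).toMonoidHom).comp (Units.map (Algebra.norm ℝ (S := FReal F)))

/-- The fibre product Id_F ×_{ℝ>0} F_ℝˣ, i.e. the subgroup of pairs (I, b) with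
N(I) = |Nm(b)|, formalized as the kernel of the quotient of the two norm maps. -/
def picDom : Subgroup (IdealGroup F × (FReal F)ˣ) :=
  MonoidHom.ker (((idealNormHom F).comp (MonoidHom.fst _ _)) /
    ((absNormFR F).comp (MonoidHom.snd _ _)))

/-- The map F^× → Id_F ×_{ℝ>0} F_ℝˣ, α ↦ (αO_F, α ⊗ 1). -/
def principalHom : Fˣ →* IdealGroup F × (FReal F)ˣ :=
  (toPrincipalIdeal (𝓞 F) F).prod
    (Units.map (Algebra.TensorProduct.includeRight : F →ₐ[ℚ] FReal F).toMonoidHom)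

/-- The subgroup of the fibre product coming from principal oriented Arakelov divisors. -/
def principalSub : Subgroup (picDom F) :=
  Subgroup.comap (picDom F).subtype (MonoidHom.range (principalHom F))

/-- The oriented Arakelov class group of F: the cokernel of F^× → Id_F ×_{ℝ>0} F_ℝˣ. -/
def PicTilde := picDom F ⧸ principalSub F

instance : CommGroup (PicTilde F) := QuotientGroup.Quotient.commGroup _
instance : TopologicalSpace (PicTilde F) := instTopologicalSpaceQuotient

/-- The class of an oriented Arakelov divisor in the oriented Arakelov class group. -/
def PicTilde.mk : picDom F → PicTilde F := QuotientGroup.mk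

/-- The maximal compact subgroup comp(F_ℝˣ) of F_ℝˣ: the subgroup generated by all
compact subgroups. -/
def maxCompact : Subgroup (FReal F)ˣ :=
  sSup { H : Subgroup (FReal F)ˣ | IsCompact (H : Set (FReal F)ˣ) }

/-- The image of {1} × comp(F_ℝˣ) in the oriented Arakelov class group. -/
def compImage : Subgroup (PicTilde F) :=
  Subgroup.map (QuotientGroup.mk' (principalSub F))
    (Subgroup.comap (picDom F).subtype ((⊥ : Subgroup (IdealGroup F)).prod (maxCompact F)))

/-- The Arakelov class group of F: the quotient of the oriented Arakelov class group by
the image of {1} × comp(F_ℝˣ). -/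
def PicZero := PicTilde F ⧸ compImage F

instance : CommGroup (PicZero F) := QuotientGroup.Quotient.commGroup _
instance : TopologicalSpace (PicZero F) := instTopologicalSpaceQuotient

/-- The class of an oriented Arakelov divisor in the Arakelov class group. -/
def PicZero.mk : picDom F → PicZero F := fun x => QuotientGroup.mk (PicTilde.mk F x)

/-- ℝ/ℤ. -/
abbrev RmodZ := AddCircle (1 : ℝ)

/-- The Pontryagin dual Ãr_F of the oriented Arakelov class group: the group of
continuous homomorphisms to ℝ/ℤ. -/
def ArTilde := ContinuousAddMonoidHom (Additive (PicTilde F)) RmodZ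

instance : AddCommGroup (ArTilde F) := by unfold ArTilde; infer_instance
instance : FunLike (ArTilde F) (Additive (PicTilde F)) RmodZ := by unfold ArTilde; infer_instance

/-- The Pontryagin dual Ar_F of the Arakelov class group. -/
def ArF := ContinuousAddMonoidHom (Additive (PicZero F)) RmodZ

instance : AddCommGroup (ArF F) := by unfold ArF; infer_instance
instance : FunLike (ArF F) (Additive (PicZero F)) RmodZ := by unfold ArF; infer_instance

/-- ℚ/ℤ as a ℤ-module. -/
abbrev QmodZ := ℚ ⧸ (Submodule.span ℤ {(1 : ℚ)})

variable {F} in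
/-- The automorphism of F_ℝ = ℝ ⊗_ℚ F induced by an automorphism of F over a subfield K. -/
def galFReal (K : Type) [Field K] [CharZero K] [Algebra K F] (g : F ≃ₐ[K] F) : FReal F ≃ₐ[ℚ] FReal F :=
  Algebra.TensorProduct.congr AlgEquiv.refl (g.restrictScalars ℚ)

end


section GrothendieckGroup

variable {R : Type} [Ring R]

theorem G0.cls_of_finite {M : Type} [AddCommGroup M] [Module R M] (h : Module.Finite R M) :
    G0.cls R M = (QuotientAddGroup.mk (FreeAbelianGroup.of (@FGMod.mk R _ M _ _ h)) :
      FreeAbelianGroup (FGMod R) ⧸ G0Rel R) :=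
  dif_pos h

/-- The class map is additive on short exact sequences of finitely generated modules. -/
theorem G0.cls_eq_add_of_exact [IsNoetherianRing R] {L M N : Type} [AddCommGroup L] [Module R L]
    [AddCommGroup M] [Module R M] [AddCommGroup N] [Module R N] [Module.Finite R M]
    (f : L →ₗ[R] M) (g : M →ₗ[R] N) (hf : Function.Injective f) (hg : Function.Surjective g)
    (hfg : Function.Exact f g) : G0.cls R M = G0.cls R L + G0.cls R N := by
  have hL : Module.Finite R L := Module.Finite.of_injective f hf
  have hN : Module.Finite R N := Module.Finite.of_surjective g hg
  have hM : Module.Finite R M := inferInstance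
  have key : (QuotientAddGroup.mk (FreeAbelianGroup.of (@FGMod.mk R _ M _ _ hM) -
      FreeAbelianGroup.of (@FGMod.mk R _ L _ _ hL) -
      FreeAbelianGroup.of (@FGMod.mk R _ N _ _ hN)) : FreeAbelianGroup (FGMod R) ⧸ G0Rel R) = 0 :=
    (QuotientAddGroup.eq_zero_iff _).2
      (AddSubgroup.subset_closure ⟨⟨L⟩, ⟨M⟩, ⟨N⟩, f, g, hf, hg, hfg, rfl⟩)
  rw [QuotientAddGroup.mk_sub, QuotientAddGroup.mk_sub, sub_sub, sub_eq_zero] at key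
  rw [G0.cls_of_finite hL, G0.cls_of_finite hM, G0.cls_of_finite hN]
  exact key

theorem G0.cls_eq_zero_of_subsingleton [IsNoetherianRing R] (M : Type) [AddCommGroup M]
    [Module R M] [Subsingleton M] : G0.cls R M = 0 := by
  have h := G0.cls_eq_add_of_exact (LinearMap.id : M →ₗ[R] M) (LinearMap.id : M →ₗ[R] M)
    Function.injective_id Function.surjective_id
    (fun x => ⟨fun _ => ⟨x, rfl⟩, fun _ => Subsingleton.elim _ _⟩)
  simpa using h

theorem G0.cls_congr [IsNoetherianRing R] {M N : Type} [AddCommGroup M] [Module R M]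
    [AddCommGroup N] [Module R N] [Module.Finite R M] (e : M ≃ₗ[R] N) :
    G0.cls R M = G0.cls R N := by
  have h := G0.cls_eq_add_of_exact (0 : PUnit.{1} →ₗ[R] M) e.toLinearMap
    (Function.injective_of_subsingleton _) e.surjective
    (fun x => ⟨fun hx => ⟨0, by simpa using (e.map_eq_zero_iff.1 hx).symm⟩, by
      rintro ⟨_, rfl⟩; simp⟩)
  rw [h, G0.cls_eq_zero_of_subsingleton PUnit, zero_add]

theorem G0.cls_fin_fun [IsNoetherianRing R] (n : ℕ) : G0.cls R (Fin n → R) = n • G0.cls R R := by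
  induction n with
  | zero => rw [G0.cls_eq_zero_of_subsingleton, zero_smul]
  | succ n ih =>
    have h := G0.cls_eq_add_of_exact (LinearMap.inr R R (Fin n → R)) (LinearMap.fst R R (Fin n → R))
      LinearMap.inr_injective LinearMap.fst_surjective
      (LinearMap.exact_iff.2 (LinearMap.ker_fst R R _))
    rw [← G0.cls_congr (Fin.consLinearEquiv R (fun _ : Fin (n + 1) => R)), h, ih, succ_nsmul]

theorem G0.cls_fun [IsNoetherianRing R] (ι : Type) [Fintype ι] :
    G0.cls R (ι → R) = Fintype.card ι • G0.cls R R := by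
  rw [G0.cls_congr (LinearEquiv.funCongrLeft R R (Fintype.equivFin ι).symm), G0.cls_fin_fun]

end GrothendieckGroup

section GroupRing

variable {G : Type} [Group G]

/-- The `ℤ[G]`-module structure attached to an action of `G` by additive endomorphisms. -/
noncomputable abbrev moduleOfAction {A : Type} [AddCommGroup A] (ρ : G →* AddMonoid.End A) :
    Module (MonoidAlgebra ℤ G) A :=
  Module.compHom A (MonoidAlgebra.liftNCRingHom (Int.castRingHom (AddMonoid.End A)) ρ
    (fun n g => Int.cast_commute n (ρ g)))

theorem moduleOfAction_single_smul {A : Type} [AddCommGroup A] (ρ : G →* AddMonoid.End A)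
    (g : G) (a : A) :
    letI := moduleOfAction ρ
    (MonoidAlgebra.single g (1 : ℤ) : MonoidAlgebra ℤ G) • a = ρ g a := by
  change (MonoidAlgebra.liftNCRingHom (Int.castRingHom (AddMonoid.End A)) ρ
    (fun n g => Int.cast_commute n (ρ g)) (MonoidAlgebra.single g (1 : ℤ))) a = ρ g a
  simp

/-- A `G`-equivariant additive map is `ℤ[G]`-linear. -/
def AddMonoidHom.toGroupRingLinearMap {A B : Type} [AddCommGroup A] [AddCommGroup B]
    [Module (MonoidAlgebra ℤ G) A] [Module (MonoidAlgebra ℤ G) B] (f : A →+ B)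
    (h : ∀ (g : G) (a : A), f ((MonoidAlgebra.single g (1 : ℤ) : MonoidAlgebra ℤ G) • a) =
      (MonoidAlgebra.single g (1 : ℤ) : MonoidAlgebra ℤ G) • f a) :
    A →ₗ[MonoidAlgebra ℤ G] B where
  toFun := f
  map_add' := map_add f
  map_smul' r a := by
    simp only [RingHom.id_apply]
    induction r using MonoidAlgebra.induction_on with
    | of g => exact h g a
    | add x y hx hy => rw [add_smul, add_smul, map_add, hx, hy]
    | smul n x hx => rw [smul_assoc, smul_assoc, map_zsmul, hx]

@[simp] theorem AddMonoidHom.coe_toGroupRingLinearMap {A B : Type} [AddCommGroup A]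
    [AddCommGroup B] [Module (MonoidAlgebra ℤ G) A] [Module (MonoidAlgebra ℤ G) B] (f : A →+ B)
    (h : ∀ (g : G) (a : A), f ((MonoidAlgebra.single g (1 : ℤ) : MonoidAlgebra ℤ G) • a) =
      (MonoidAlgebra.single g (1 : ℤ) : MonoidAlgebra ℤ G) • f a) :
    ⇑(f.toGroupRingLinearMap h) = f := rfl

theorem isNoetherianRing_groupRing [Finite G] : IsNoetherianRing (MonoidAlgebra ℤ G) := by
  have : Module.Finite ℤ (MonoidAlgebra ℤ G) := inferInstance
  exact IsNoetherianRing.of_finite ℤ _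

/-- The bookkeeping in `G₀(ℤ[G])` behind the main theorem: a module `E` that is an extension of
`A` by `Sd` and also an extension of the kernel of `P → Td` by `Ld`. -/
theorem G0.cls_eq_of_two_extensions [Finite G] {A E P U T L Sd Ld Td : Type}
    [AddCommGroup A] [AddCommGroup E] [AddCommGroup P] [AddCommGroup U] [AddCommGroup T]
    [AddCommGroup L] [AddCommGroup Sd] [AddCommGroup Ld] [AddCommGroup Td]
    [Module (MonoidAlgebra ℤ G) A] [Module (MonoidAlgebra ℤ G) E] [Module (MonoidAlgebra ℤ G) P]
    [Module (MonoidAlgebra ℤ G) U] [Module (MonoidAlgebra ℤ G) T] [Module (MonoidAlgebra ℤ G) L]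
    [Module (MonoidAlgebra ℤ G) Sd] [Module (MonoidAlgebra ℤ G) Ld] [Module (MonoidAlgebra ℤ G) Td]
    (hP : Module.Finite ℤ P) (hLd : Module.Finite ℤ Ld) (hU : Module.Finite ℤ U)
    (j : Sd →ₗ[MonoidAlgebra ℤ G] E) (q : E →ₗ[MonoidAlgebra ℤ G] A)
    (hj : Function.Injective j) (hjq : Function.Exact j q) (hq : Function.Surjective q)
    (i : Ld →ₗ[MonoidAlgebra ℤ G] E) (p : E →ₗ[MonoidAlgebra ℤ G] P)
    (r : P →ₗ[MonoidAlgebra ℤ G] Td)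
    (hi : Function.Injective i) (hip : Function.Exact i p) (hpr : Function.Exact p r)
    (hr : Function.Surjective r)
    (ι : T →ₗ[MonoidAlgebra ℤ G] U) (π : U →ₗ[MonoidAlgebra ℤ G] L)
    (hι : Function.Injective ι) (hιπ : Function.Exact ι π) (hπ : Function.Surjective π) :
    G0.cls (MonoidAlgebra ℤ G) A = G0.cls (MonoidAlgebra ℤ G) P -
      (G0.cls (MonoidAlgebra ℤ G) Sd - G0.cls (MonoidAlgebra ℤ G) Ld +
        G0.cls (MonoidAlgebra ℤ G) Td) ∧
    G0.cls (MonoidAlgebra ℤ G) U = G0.cls (MonoidAlgebra ℤ G) T +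
      G0.cls (MonoidAlgebra ℤ G) L := by
  have := isNoetherianRing_groupRing (G := G)
  have : Module.Finite (MonoidAlgebra ℤ G) U := Module.Finite.of_restrictScalars_finite ℤ _ _
  have : Module.Finite (MonoidAlgebra ℤ G) P := Module.Finite.of_restrictScalars_finite ℤ _ _
  have : Module.Finite (MonoidAlgebra ℤ G) Ld := Module.Finite.of_restrictScalars_finite ℤ _ _
  have hker : Function.Exact i p.rangeRestrict := fun x => by
    rw [← hip x, ← LinearMap.mem_ker, LinearMap.ker_rangeRestrict, LinearMap.mem_ker]
  have : Module.Finite (MonoidAlgebra ℤ G) p.ker := by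
    rw [LinearMap.exact_iff.1 hip]
    infer_instance
  have : Module.Finite (MonoidAlgebra ℤ G) (E ⧸ p.ker) :=
    Module.Finite.of_injective _ (p.quotKerEquivRange).injective
  have : Module.Finite (MonoidAlgebra ℤ G) E :=
    Module.Finite.of_submodule_quotient p.ker
  have h1 := G0.cls_eq_add_of_exact j q hj hq hjq
  have h2 := G0.cls_eq_add_of_exact i p.rangeRestrict hi p.surjective_rangeRestrict hker
  have h3 := G0.cls_eq_add_of_exact p.range.subtype r p.range.injective_subtype hr
    (fun x => by rw [hpr x]; simp)
  refine ⟨?_, G0.cls_eq_add_of_exact ι π hι hπ hιπ⟩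
  rw [h1] at h2
  rw [h3, eq_sub_of_add_eq' h2]
  abel

end GroupRing

section Embeddings

variable {K F G : Type} [Field K] [Field F] [Algebra K F] [Group G]

/-- Precomposition of a complex embedding with the automorphism attached to `g`. -/
def embeddingComp (iso : G ≃* (F ≃ₐ[K] F)) (φ : F →+* ℂ) (g : G) : F →+* ℂ :=
  φ.comp (iso g : F →+* F)

@[simp] theorem embeddingComp_apply (iso : G ≃* (F ≃ₐ[K] F)) (φ : F →+* ℂ) (g : G) (x : F) :
    embeddingComp iso φ g x = φ (iso g x) := rfl

theorem embeddingComp_one (iso : G ≃* (F ≃ₐ[K] F)) (φ : F →+* ℂ) :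
    embeddingComp iso φ 1 = φ := by ext; simp

theorem embeddingComp_mul (iso : G ≃* (F ≃ₐ[K] F)) (φ : F →+* ℂ) (g h : G) :
    embeddingComp iso φ (g * h) = embeddingComp iso (embeddingComp iso φ g) h := by ext; simp

/-- The action of `G` on integer-valued functions on complex embeddings. -/
def embeddingAction (iso : G ≃* (F ≃ₐ[K] F)) : G →* AddMonoid.End ((F →+* ℂ) → ℤ) where
  toFun g :=
    { toFun := fun m φ => m (embeddingComp iso φ g)
      map_zero' := rfl
      map_add' := fun _ _ => rfl }
  map_one' := by ext m φ; exact congr_arg m (embeddingComp_one iso φ)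
  map_mul' g h := by ext m φ; exact congr_arg m (embeddingComp_mul iso φ g h)

@[simp] theorem embeddingAction_apply (iso : G ≃* (F ≃ₐ[K] F)) (g : G) (m : (F →+* ℂ) → ℤ)
    (φ : F →+* ℂ) : embeddingAction iso g m φ = m (embeddingComp iso φ g) := rfl

/-- The module of integer-valued functions on the complex embeddings of a Galois extension `F/K`
is free of rank `[K : ℚ]` over the group ring. -/
theorem cls_embeddings [NumberField K] [NumberField F] [IsGalois K F]
    (iso : G ≃* (F ≃ₐ[K] F)) :
    letI := moduleOfAction (embeddingAction iso)
    G0.cls (MonoidAlgebra ℤ G) ((F →+* ℂ) → ℤ) =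
      Module.finrank ℚ K • G0.cls (MonoidAlgebra ℤ G) (MonoidAlgebra ℤ G) := by
  classical
  let _ := moduleOfAction (embeddingAction iso)
  have : Finite G := Finite.of_equiv _ iso.symm.toEquiv
  have := Fintype.ofFinite G
  have := isNoetherianRing_groupRing (G := G)
  have hex : ∀ ψ : K →+* ℂ, ∃ φ : F →+* ℂ, φ.comp (algebraMap K F) = ψ := fun ψ => by
    let _ := ψ.toAlgebra
    exact ⟨(IsAlgClosed.lift : F →ₐ[K] ℂ).toRingHom, (IsAlgClosed.lift : F →ₐ[K] ℂ).comp_algebraMap⟩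
  choose lft hlft using hex
  have hex2 : ∀ φ : F →+* ℂ, ∃ k : G,
      embeddingComp iso (lft (φ.comp (algebraMap K F))) k = φ := fun φ => by
    obtain ⟨s, hs⟩ := ComplexEmbedding.exists_comp_symm_eq_of_comp_eq (k := K)
      (lft (φ.comp (algebraMap K F))) φ (hlft _)
    refine ⟨iso.symm s.symm, Eq.trans ?_ hs⟩
    ext x
    simp
  choose k hk using hex2
  have hres : ∀ (φ : F →+* ℂ) (g : G),
      (embeddingComp iso φ g).comp (algebraMap K F) = φ.comp (algebraMap K F) := fun φ g => by
    ext x; simp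
  have hinj : ∀ (φ : F →+* ℂ) (g h : G), embeddingComp iso φ g = embeddingComp iso φ h → g = h := by
    intro φ g h H
    apply iso.injective
    ext x
    exact φ.injective (RingHom.congr_fun H x)
  have hkg : ∀ φ g, k (embeddingComp iso φ g) = k φ * g := fun φ g => by
    apply hinj (lft (φ.comp (algebraMap K F)))
    have := hk (embeddingComp iso φ g)
    rw [hres] at this
    rw [this, embeddingComp_mul, hk]
  let Φ : ((K →+* ℂ) → MonoidAlgebra ℤ G) →+ ((F →+* ℂ) → ℤ) :=
    { toFun := fun r φ => (r (φ.comp (algebraMap K F))).coeff (k φ)⁻¹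
      map_zero' := by ext; simp
      map_add' := fun _ _ => by ext; simp }
  have hΦ : ∀ (g : G) (r : (K →+* ℂ) → MonoidAlgebra ℤ G),
      Φ ((MonoidAlgebra.single g (1 : ℤ) : MonoidAlgebra ℤ G) • r) =
        (MonoidAlgebra.single g (1 : ℤ) : MonoidAlgebra ℤ G) • Φ r := by
    intro g r
    rw [moduleOfAction_single_smul]
    ext φ
    simp only [Φ, AddMonoidHom.coe_mk, ZeroHom.coe_mk, embeddingAction_apply, hkg, hres,
      Pi.smul_apply, smul_eq_mul, MonoidAlgebra.coeff_single_mul_apply, one_mul, mul_inv_rev]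
  have hbij : Function.Bijective Φ := by
    constructor
    · rw [injective_iff_map_eq_zero]
      intro r hr
      ext ψ h
      have := congr_fun hr (embeddingComp iso (lft ψ) h⁻¹)
      simp only [Φ, AddMonoidHom.coe_mk, ZeroHom.coe_mk, hkg, hres, hlft, Pi.zero_apply] at this
      have h1 : k (lft ψ) = 1 := hinj (lft ψ) _ _ (by
        have := hk (lft ψ)
        rw [hlft] at this
        rw [this, embeddingComp_one])
      simpa [h1] using this
    · intro m
      refine ⟨fun ψ => MonoidAlgebra.ofCoeff (Finsupp.equivFunOnFinite.symm
        fun h => m (embeddingComp iso (lft ψ) h⁻¹)), ?_⟩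
      ext φ
      simp [Φ, hk]
  rw [← G0.cls_congr (LinearEquiv.ofBijective (Φ.toGroupRingLinearMap hΦ) hbij), G0.cls_fun,
    Embeddings.card]

end Embeddings

noncomputable section RealAlgebra

variable {F : Type} [Field F] [NumberField F]

/-- The ℝ-linear extension to `F_ℝ` of a complex embedding. -/
def FReal.ext (φ : F →+* ℂ) : FReal F →ₐ[ℝ] ℂ :=
  Algebra.TensorProduct.lift (Algebra.ofId ℝ ℂ) φ.toRatAlgHom fun _ _ => Commute.all _ _

@[simp] theorem FReal.ext_tmul (φ : F →+* ℂ) (r : ℝ) (x : F) :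
    FReal.ext φ (r ⊗ₜ[ℚ] x) = r * φ x := by
  simp [FReal.ext, Algebra.ofId_apply]

theorem FReal.ext_galFReal {K : Type} [Field K] [CharZero K] [Algebra K F] (s : F ≃ₐ[K] F)
    (φ : F →+* ℂ) (x : FReal F) :
    FReal.ext φ (galFReal K s x) = FReal.ext (φ.comp (s : F →+* F)) x := by
  induction x using TensorProduct.induction_on with
  | zero => simp
  | tmul r x => simp [galFReal]
  | add x y hx hy => simp only [map_add, hx, hy]

theorem FReal.ext_conj (φ : F →+* ℂ) (x : FReal F) :
    FReal.ext (ComplexEmbedding.conjugate φ) x = (starRingEnd ℂ) (FReal.ext φ x) := by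
  induction x using TensorProduct.induction_on with
  | zero => simp
  | tmul r x => simp
  | add x y hx hy => simp only [map_add, hx, hy]

variable (F) in
/-- The ring homomorphism from `F_ℝ` to the mixed space of `F`. -/
def FReal.toMixedHom : FReal F →ₐ[ℝ] mixedEmbedding.mixedSpace F :=
  Algebra.TensorProduct.lift (Algebra.ofId ℝ _) (mixedEmbedding F).toRatAlgHom
    fun _ _ => Commute.all _ _

theorem FReal.toMixedHom_tmul (r : ℝ) (x : F) :
    FReal.toMixedHom F (r ⊗ₜ[ℚ] x) = r • mixedEmbedding F x := by
  simp [FReal.toMixedHom, Algebra.ofId_apply, Algebra.smul_def]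

theorem FReal.toMixedHom_bijective : Function.Bijective (FReal.toMixedHom F) := by
  have h : (FReal.toMixedHom F).toLinearMap =
      (((integralBasis F).baseChange ℝ).equiv (mixedEmbedding.latticeBasis F)
        (Equiv.refl _)).toLinearMap := by
    refine ((integralBasis F).baseChange ℝ).ext fun i => ?_
    rw [LinearEquiv.coe_coe, Module.Basis.equiv_apply]
    rw [Equiv.refl_apply, mixedEmbedding.latticeBasis_apply, Module.Basis.baseChange_apply,
      AlgHom.toLinearMap_apply, FReal.toMixedHom_tmul, one_smul]
  have h' : ⇑(FReal.toMixedHom F) = ⇑(((integralBasis F).baseChange ℝ).equiv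
      (mixedEmbedding.latticeBasis F) (Equiv.refl _)) := congr_arg DFunLike.coe h
  rw [h']
  exact LinearEquiv.bijective _

variable (F) in
/-- `F_ℝ` is isomorphic to the mixed space of `F`. -/
def FReal.toMixed : FReal F ≃ₐ[ℝ] mixedEmbedding.mixedSpace F :=
  AlgEquiv.ofBijective (FReal.toMixedHom F) FReal.toMixedHom_bijective

theorem FReal.toMixed_tmul (r : ℝ) (x : F) :
    FReal.toMixed F (r ⊗ₜ[ℚ] x) = r • mixedEmbedding F x := FReal.toMixedHom_tmul r x

theorem FReal.toMixed_fst (x : FReal F) (w : {w : InfinitePlace F // w.IsReal}) :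
    (((FReal.toMixed F x).1 w : ℝ) : ℂ) = FReal.ext w.1.embedding x := by
  induction x using TensorProduct.induction_on with
  | zero => simp
  | tmul r x => simp [FReal.toMixed_tmul]
  | add x y hx hy => simp only [map_add, ← hx, ← hy, Prod.fst_add, Pi.add_apply, Complex.ofReal_add]

theorem FReal.toMixed_snd (x : FReal F) (w : {w : InfinitePlace F // w.IsComplex}) :
    (FReal.toMixed F x).2 w = FReal.ext w.1.embedding x := by
  induction x using TensorProduct.induction_on with
  | zero => simp
  | tmul r x => simp [FReal.toMixed_tmul]
  | add x y hx hy => simp only [map_add, ← hx, ← hy, Prod.snd_add, Pi.add_apply]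

theorem FReal.continuous_linearMap {E : Type*} [AddCommGroup E] [Module ℝ E] [TopologicalSpace E]
    [IsTopologicalAddGroup E] [ContinuousSMul ℝ E] (f : FReal F →ₗ[ℝ] E) : Continuous f := by
  have h : ⇑f = (f ∘ₗ (Module.finBasis ℝ (FReal F)).equivFun.symm.toLinearMap) ∘
      (Module.finBasis ℝ (FReal F)).equivFun := by
    ext x; simp
  rw [h]
  exact (LinearMap.continuous_on_pi _).comp continuous_induced_dom

theorem FReal.continuous_toMixed : Continuous (FReal.toMixed F) :=
  FReal.continuous_linearMap (FReal.toMixed F).toLinearMap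

theorem FReal.continuous_toMixed_symm : Continuous (FReal.toMixed F).symm :=
  continuous_induced_rng.2 (LinearMap.continuous_of_finiteDimensional
    ((Module.finBasis ℝ (FReal F)).equivFun.toLinearMap ∘ₗ (FReal.toMixed F).symm.toLinearMap))

theorem FReal.continuous_ext (φ : F →+* ℂ) : Continuous (FReal.ext φ) :=
  FReal.continuous_linearMap (FReal.ext φ).toLinearMap

instance : ContinuousMul (FReal F) where
  continuous_mul := by
    have h : (fun p : FReal F × FReal F => p.1 * p.2) =
        fun p => (FReal.toMixed F).symm (FReal.toMixed F p.1 * FReal.toMixed F p.2) := by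
      ext p; simp
    rw [h]
    exact FReal.continuous_toMixed_symm.comp
      ((FReal.continuous_toMixed.comp continuous_fst).mul
        (FReal.continuous_toMixed.comp continuous_snd))

theorem FReal.norm_ext_eq (x : FReal F) (w : InfinitePlace F) :
    ‖FReal.ext w.embedding x‖ = mixedEmbedding.normAtPlace w (FReal.toMixed F x) := by
  by_cases hw : w.IsReal
  · rw [mixedEmbedding.normAtPlace_apply_of_isReal hw, ← FReal.toMixed_fst x ⟨w, hw⟩,
      Complex.norm_real]
  · rw [InfinitePlace.not_isReal_iff_isComplex] at hw
    rw [mixedEmbedding.normAtPlace_apply_of_isComplex hw, ← FReal.toMixed_snd x ⟨w, hw⟩]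

theorem FReal.norm_ext_mk (x : FReal F) (φ : F →+* ℂ) :
    ‖FReal.ext (InfinitePlace.mk φ).embedding x‖ = ‖FReal.ext φ x‖ := by
  rcases InfinitePlace.embedding_mk_eq φ with h | h
  · rw [h]
  · rw [h, FReal.ext_conj, RCLike.norm_conj]

open scoped Classical in
theorem mixedEmbedding.algebraNorm_eq (y : mixedEmbedding.mixedSpace F) :
    |Algebra.norm ℝ y| = mixedEmbedding.norm y := by
  have h : Algebra.lmul ℝ (mixedEmbedding.mixedSpace F) y =
      LinearMap.prodMap
        (LinearMap.pi fun w => (Algebra.lmul ℝ ℝ (y.1 w)) ∘ₗ LinearMap.proj w)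
        (LinearMap.pi fun w => (Algebra.lmul ℝ ℂ (y.2 w)) ∘ₗ LinearMap.proj w) := by
    ext <;> simp
  rw [Algebra.norm_apply, h, LinearMap.det_prodMap, LinearMap.det_pi, LinearMap.det_pi,
    mixedEmbedding.norm_apply, abs_mul, Finset.abs_prod, Finset.abs_prod,
    InfinitePlace.prod_eq_prod_mul_prod]
  congr 1
  · refine Finset.prod_congr rfl fun w _ => ?_
    rw [mixedEmbedding.normAtPlace_apply_of_isReal w.2, InfinitePlace.mult_isReal, pow_one,
      ← Algebra.norm_apply, Algebra.norm_self, MonoidHom.id_apply, Real.norm_eq_abs]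
  · refine Finset.prod_congr rfl fun w _ => ?_
    rw [mixedEmbedding.normAtPlace_apply_of_isComplex w.2, InfinitePlace.mult_isComplex,
      ← Algebra.norm_apply, Algebra.norm_complex_apply, Complex.normSq_eq_norm_sq, abs_pow,
      abs_norm]

theorem FReal.abs_norm_eq (x : FReal F) :
    |Algebra.norm ℝ x| = ∏ w : InfinitePlace F, ‖FReal.ext w.embedding x‖ ^ w.mult := by
  rw [← Algebra.norm_eq_of_algEquiv (FReal.toMixed F), mixedEmbedding.algebraNorm_eq,
    mixedEmbedding.norm_apply]
  simp only [FReal.norm_ext_eq]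

end RealAlgebra

section Circle

/-- A continuous homomorphism from a real normed space to `ℝ/ℤ` lifts to a linear functional. -/
theorem AddCircle.exists_linear_lift {E : Type} [NormedAddCommGroup E] [NormedSpace ℝ E]
    (f : E →+ AddCircle (1 : ℝ)) (hf : Continuous f) :
    ∃ l : E →L[ℝ] ℝ, ∀ x, f x = (l x : AddCircle (1 : ℝ)) := by
  have cov := AddCircle.isCoveringMap_coe (𝕜 := ℝ) 1
  obtain ⟨Γ, ⟨h0, h1⟩, -⟩ := cov.existsUnique_continuousMap_lifts ⟨f, hf⟩ 0 0 (by simp)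
  have h1' : ∀ x, ((Γ x : ℝ) : AddCircle (1 : ℝ)) = f x := fun x => congr_fun h1 x
  obtain ⟨Δ, -, hu⟩ := cov.existsUnique_continuousMap_lifts
    (⟨fun p : E × E => f (p.1 + p.2), by fun_prop⟩ : C(E × E, AddCircle (1 : ℝ))) 0 0 (by simp)
  have hadd : ∀ x y, Γ (x + y) = Γ x + Γ y := fun x y => by
    have e1 := hu ⟨fun p => Γ (p.1 + p.2), by fun_prop⟩
      ⟨by simp [h0], by ext p; exact h1' _⟩
    have e2 := hu ⟨fun p => Γ p.1 + Γ p.2, by fun_prop⟩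
      ⟨by simp [h0], by
        ext p
        simp [h1']⟩
    exact DFunLike.congr_fun (e1.trans e2.symm) (x, y)
  refine ⟨AddMonoidHom.toRealLinearMap (AddMonoidHom.mk' Γ hadd) Γ.continuous, fun x => ?_⟩
  exact (h1' x).symm

/-- The normalized argument `arg z / 2π`, as a homomorphism to `ℝ/ℤ`. -/
noncomputable def argHom : Additive ℂˣ →+ AddCircle (1 : ℝ) :=
  (AddCircle.equivAddCircle (2 * Real.pi) 1 Real.two_pi_pos.ne' one_ne_zero).toAddMonoidHom.comp
    (AddMonoidHom.mk' (fun z => ((Complex.arg (z.toMul : ℂ) : Real.Angle)))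
      fun x y => by
        simp only [toMul_add, Units.val_mul]
        exact Complex.arg_mul_coe_angle x.toMul.ne_zero y.toMul.ne_zero)

theorem argHom_eq_zero_iff (z : ℂˣ) : argHom (Additive.ofMul z) = 0 ↔ Complex.arg z = 0 := by
  have h := (AddCircle.equivAddCircle (2 * Real.pi) 1 Real.two_pi_pos.ne' one_ne_zero).map_eq_zero_iff
    (x := (Complex.arg (z : ℂ) : Real.Angle))
  have h1 : (Complex.arg (z : ℂ) : Real.Angle) = (0 : Real.Angle) ↔ Complex.arg z = 0 := by
    refine ⟨fun h0 => ?_, fun h0 => by rw [h0, Real.Angle.coe_zero]⟩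
    have h2 := Complex.arg_coe_angle_toReal_eq_arg (z : ℂ)
    rw [h0, Real.Angle.toReal_zero] at h2
    exact h2.symm
  exact h.trans h1

theorem argHom_exp (z : ℂˣ) (t : ℝ) (h : (z : ℂ) = Complex.exp (2 * Real.pi * t * Complex.I)) :
    argHom (Additive.ofMul z) = (t : AddCircle (1 : ℝ)) := by
  have h1 : ((Complex.arg (z : ℂ) : ℝ) : Real.Angle) = ((2 * Real.pi * t : ℝ) : Real.Angle) := by
    have h3 := Complex.arg_cos_add_sin_mul_I_coe_angle ((2 * Real.pi * t : ℝ) : Real.Angle)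
    rw [Real.Angle.cos_coe, Real.Angle.sin_coe] at h3
    rw [← h3, h, Complex.exp_mul_I]
    push_cast
    rfl
  have h2 := congr_arg (AddCircle.equivAddCircle (2 * Real.pi) 1 Real.two_pi_pos.ne' one_ne_zero) h1
  refine h2.trans ?_
  refine (AddCircle.equivAddCircle_apply_mk _ _ Real.two_pi_pos.ne' one_ne_zero _).trans ?_
  congr 1
  field_simp

theorem argHom_of_real_pos (z : ℂˣ) (r : ℝ) (hr : 0 < r) (h : (z : ℂ) = r) :
    argHom (Additive.ofMul z) = 0 := by
  rw [argHom_eq_zero_iff, h, Complex.arg_ofReal_of_nonneg hr.le]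

theorem argHom_conj (z z' : ℂˣ) (h : (z' : ℂ) = (starRingEnd ℂ) z) :
    argHom (Additive.ofMul z') = -argHom (Additive.ofMul z) := by
  rw [eq_neg_iff_add_eq_zero, ← map_add, ← ofMul_mul]
  refine argHom_of_real_pos _ (Complex.normSq z) (Complex.normSq_pos.2 z.ne_zero) ?_
  rw [Units.val_mul, h, mul_comm, Complex.mul_conj]

end Circle

noncomputable section RealUnits

variable {F : Type} [Field F] [NumberField F]

theorem FReal.ext_ne_zero (φ : F →+* ℂ) (x : (FReal F)ˣ) : FReal.ext φ (x : FReal F) ≠ 0 :=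
  (x.isUnit.map (FReal.ext φ)).ne_zero

/-- The component of a unit of `F_ℝ` at a complex embedding. -/
def FReal.unitExt (φ : F →+* ℂ) : (FReal F)ˣ →* ℂˣ := Units.map (FReal.ext φ).toMonoidHom

@[simp] theorem FReal.coe_unitExt (φ : F →+* ℂ) (x : (FReal F)ˣ) :
    (FReal.unitExt φ x : ℂ) = FReal.ext φ (x : FReal F) := rfl

/-- The logarithm of the norm of a unit of `F_ℝ` at an infinite place. -/
def FReal.logHom (w : InfinitePlace F) : Additive (FReal F)ˣ →+ ℝ :=
  AddMonoidHom.mk' (fun x => Real.log ‖FReal.ext w.embedding (x.toMul : FReal F)‖) fun x y => by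
    rw [toMul_add, Units.val_mul, map_mul, norm_mul, Real.log_mul] <;>
      exact norm_ne_zero_iff.2 (FReal.ext_ne_zero _ _)

theorem FReal.logHom_apply (w : InfinitePlace F) (x : (FReal F)ˣ) :
    FReal.logHom w (Additive.ofMul x) = Real.log ‖FReal.ext w.embedding (x : FReal F)‖ := rfl

theorem FReal.continuous_logHom (w : InfinitePlace F) :
    Continuous fun x : (FReal F)ˣ => FReal.logHom w (Additive.ofMul x) := by
  simp only [FReal.logHom_apply]
  refine Continuous.log ?_ fun x => norm_ne_zero_iff.2 (FReal.ext_ne_zero _ _)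
  exact ((FReal.continuous_ext _).comp Units.continuous_val).norm

/-- The argument, normalized to `ℝ/ℤ`, of the component of a unit at a complex embedding. -/
def FReal.argAt (φ : F →+* ℂ) : Additive (FReal F)ˣ →+ AddCircle (1 : ℝ) :=
  argHom.comp (MonoidHom.toAdditive (FReal.unitExt φ))

theorem FReal.argAt_apply (φ : F →+* ℂ) (x : (FReal F)ˣ) :
    FReal.argAt φ (Additive.ofMul x) = argHom (Additive.ofMul (FReal.unitExt φ x)) := rfl

theorem FReal.argAt_conj (φ : F →+* ℂ) :
    FReal.argAt (ComplexEmbedding.conjugate φ) = -FReal.argAt φ := by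
  refine AddMonoidHom.ext fun x => ?_
  exact argHom_conj _ _ (FReal.ext_conj φ _)

theorem FReal.eq_of_ext_eq {x y : FReal F}
    (h : ∀ w : InfinitePlace F, FReal.ext w.embedding x = FReal.ext w.embedding y) : x = y := by
  apply (FReal.toMixed F).injective
  refine Prod.ext (funext fun w => ?_) (funext fun w => ?_)
  · exact Complex.ofReal_injective (by rw [FReal.toMixed_fst, FReal.toMixed_fst, h])
  · rw [FReal.toMixed_snd, FReal.toMixed_snd, h]

theorem FReal.ext_toMixed_symm_of_isReal (y : mixedEmbedding.mixedSpace F) {w : InfinitePlace F}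
    (hw : w.IsReal) : FReal.ext w.embedding ((FReal.toMixed F).symm y) = (y.1 ⟨w, hw⟩ : ℝ) := by
  rw [← FReal.toMixed_fst _ ⟨w, hw⟩, AlgEquiv.apply_symm_apply]

theorem FReal.ext_toMixed_symm_of_isComplex (y : mixedEmbedding.mixedSpace F)
    {w : InfinitePlace F} (hw : w.IsComplex) :
    FReal.ext w.embedding ((FReal.toMixed F).symm y) = y.2 ⟨w, hw⟩ := by
  rw [← FReal.toMixed_snd _ ⟨w, hw⟩, AlgEquiv.apply_symm_apply]

/-- The element of `F_ℝ` with prescribed real components. -/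
def FReal.ofReal : (InfinitePlace F → ℝ) →* FReal F where
  toFun y := (FReal.toMixed F).symm (fun w => y w.1, fun w => (y w.1 : ℂ))
  map_one' := by
    rw [← map_one (FReal.toMixed F).symm]
    congr 1
  map_mul' x y := by
    rw [← map_mul (FReal.toMixed F).symm]
    congr 1
    ext <;> simp

theorem FReal.continuous_ofReal : Continuous (FReal.ofReal (F := F)) :=
  FReal.continuous_toMixed_symm.comp (by fun_prop)

@[simp] theorem FReal.ext_ofReal (w : InfinitePlace F) (y : InfinitePlace F → ℝ) :
    FReal.ext w.embedding (FReal.ofReal y) = y w := by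
  by_cases hw : w.IsReal
  · exact FReal.ext_toMixed_symm_of_isReal _ hw
  · rw [InfinitePlace.not_isReal_iff_isComplex] at hw
    exact FReal.ext_toMixed_symm_of_isComplex _ hw

/-- The element of `F_ℝ` with prescribed components at complex places and trivial components
at real places. -/
def FReal.ofComplex : ({w : InfinitePlace F // w.IsComplex} → ℂ) →* FReal F where
  toFun y := (FReal.toMixed F).symm (1, y)
  map_one' := map_one (FReal.toMixed F).symm
  map_mul' x y := by
    rw [← map_mul (FReal.toMixed F).symm, Prod.mk_mul_mk, one_mul]

theorem FReal.continuous_ofComplex : Continuous (FReal.ofComplex (F := F)) :=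
  FReal.continuous_toMixed_symm.comp (by fun_prop)

theorem FReal.ext_ofComplex (w : InfinitePlace F) (hw : w.IsComplex)
    (y : {w : InfinitePlace F // w.IsComplex} → ℂ) :
    FReal.ext w.embedding (FReal.ofComplex y) = y ⟨w, hw⟩ :=
  FReal.ext_toMixed_symm_of_isComplex _ hw

theorem FReal.ext_ofComplex_of_isReal (w : InfinitePlace F) (hw : w.IsReal)
    (y : {w : InfinitePlace F // w.IsComplex} → ℂ) :
    FReal.ext w.embedding (FReal.ofComplex y) = 1 := by
  refine (FReal.ext_toMixed_symm_of_isReal _ hw).trans ?_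
  simp

/-- The unit of `F_ℝ` with prescribed positive components, given by their logarithms. -/
def FReal.radial : (InfinitePlace F → ℝ) →+ Additive (FReal F)ˣ :=
  AddMonoidHom.mk' (fun y => Additive.ofMul
    ⟨FReal.ofReal fun w => Real.exp (y w), FReal.ofReal fun w => Real.exp (-y w),
      by
        rw [← map_mul, ← map_one FReal.ofReal]
        congr 1; ext w; simp [← Real.exp_add],
      by
        rw [← map_mul, ← map_one FReal.ofReal]
        congr 1; ext w; simp [← Real.exp_add]⟩) fun x y => by
    refine Units.ext ?_
    change FReal.ofReal _ = FReal.ofReal _ * FReal.ofReal _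
    rw [← map_mul]
    congr 1; ext w; simp [Real.exp_add]

@[simp] theorem FReal.ext_radial (w : InfinitePlace F) (y : InfinitePlace F → ℝ) :
    FReal.ext w.embedding ((FReal.radial y).toMul : FReal F) = (Real.exp (y w) : ℝ) :=
  FReal.ext_ofReal w _

theorem FReal.continuous_radial :
    Continuous fun y : InfinitePlace F → ℝ => (FReal.radial y).toMul := by
  refine Units.continuous_iff.2 ⟨?_, ?_⟩
  · exact FReal.continuous_ofReal.comp (by fun_prop)
  · exact FReal.continuous_ofReal.comp (f := fun (y : InfinitePlace F → ℝ) w => Real.exp (-y w))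
      (by fun_prop)

/-- The unit of `F_ℝ` with component `exp (2πit)` at a complex place, and trivial components
elsewhere. -/
def FReal.angular (w : {w : InfinitePlace F // w.IsComplex}) : ℝ →+ Additive (FReal F)ˣ := by
  classical
  exact AddMonoidHom.mk' (fun t => Additive.ofMul
    ⟨FReal.ofComplex (Pi.mulSingle w (Complex.exp (2 * Real.pi * t * Complex.I))),
      FReal.ofComplex (Pi.mulSingle w (Complex.exp (-(2 * Real.pi * t * Complex.I)))),
      by
        rw [← map_mul, ← Pi.mulSingle_mul, ← Complex.exp_add, add_neg_cancel, Complex.exp_zero,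
          Pi.mulSingle_one, map_one],
      by
        rw [← map_mul, ← Pi.mulSingle_mul, ← Complex.exp_add, neg_add_cancel, Complex.exp_zero,
          Pi.mulSingle_one, map_one]⟩) fun x y => by
    refine Units.ext ?_
    change FReal.ofComplex _ = FReal.ofComplex _ * FReal.ofComplex _
    rw [← map_mul, ← Pi.mulSingle_mul, ← Complex.exp_add]
    congr 3
    push_cast
    ring

theorem FReal.continuous_angular (w : {w : InfinitePlace F // w.IsComplex}) :
    Continuous fun t : ℝ => (FReal.angular w t).toMul := by
  classical
  have hc : Continuous fun z : ℂ =>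
      (Pi.mulSingle w z : {w : InfinitePlace F // w.IsComplex} → ℂ) :=
    continuous_pi fun v => by
      simp only [Pi.mulSingle_apply]
      split_ifs <;> fun_prop
  refine Units.continuous_iff.2 ⟨?_, ?_⟩
  · exact FReal.continuous_ofComplex.comp (hc.comp
      (f := fun t : ℝ => Complex.exp (2 * Real.pi * t * Complex.I)) (by fun_prop))
  · exact FReal.continuous_ofComplex.comp (hc.comp
      (f := fun t : ℝ => Complex.exp (-(2 * Real.pi * t * Complex.I))) (by fun_prop))

open scoped Classical in
theorem FReal.ext_angular (w : {w : InfinitePlace F // w.IsComplex}) (t : ℝ)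
    (v : InfinitePlace F) : FReal.ext v.embedding ((FReal.angular w t).toMul : FReal F) =
      if v = w.1 then Complex.exp (2 * Real.pi * t * Complex.I) else 1 := by
  by_cases hv : v.IsReal
  · rw [if_neg fun h : v = w.1 => InfinitePlace.not_isReal_iff_isComplex.2 w.2 (h ▸ hv)]
    exact FReal.ext_ofComplex_of_isReal _ hv _
  · rw [InfinitePlace.not_isReal_iff_isComplex] at hv
    refine (FReal.ext_ofComplex _ hv _).trans ?_
    rw [Pi.mulSingle_apply]
    simp only [Subtype.ext_iff]

/-- The unit of `F_ℝ` with component `-1` at a given place and trivial components elsewhere. -/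
def FReal.sign (w : InfinitePlace F) : (FReal F)ˣ := by
  classical
  exact Units.map FReal.ofReal
    ⟨Pi.mulSingle w (-1), Pi.mulSingle w (-1), by simp [← Pi.mulSingle_mul],
      by simp [← Pi.mulSingle_mul]⟩

open scoped Classical in
theorem FReal.ext_sign (w v : InfinitePlace F) :
    FReal.ext v.embedding (FReal.sign w : FReal F) = if v = w then -1 else 1 := by
  refine (FReal.ext_ofReal v _).trans ?_
  rw [Units.val_mk, Pi.mulSingle_apply]
  split_ifs <;> simp

theorem FReal.sign_mul_self (w : InfinitePlace F) : FReal.sign w * FReal.sign w = 1 := by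
  classical
  refine Units.ext (FReal.eq_of_ext_eq fun v => ?_)
  rw [Units.val_mul, map_mul, FReal.ext_sign]
  split_ifs <;> simp

end RealUnits

noncomputable section RealCharacters

variable {F : Type} [Field F] [NumberField F]

theorem FReal.logHom_radial (w : InfinitePlace F) (y : InfinitePlace F → ℝ) :
    FReal.logHom w (FReal.radial y) = y w := by
  change Real.log ‖FReal.ext w.embedding ((FReal.radial y).toMul : FReal F)‖ = y w
  rw [FReal.ext_radial, Complex.norm_real, Real.norm_of_nonneg (Real.exp_pos _).le, Real.log_exp]

theorem FReal.logHom_angular (v : InfinitePlace F) (w : {w : InfinitePlace F // w.IsComplex})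
    (t : ℝ) : FReal.logHom v (FReal.angular w t) = 0 := by
  classical
  change Real.log ‖FReal.ext v.embedding ((FReal.angular w t).toMul : FReal F)‖ = 0
  rw [FReal.ext_angular]
  split_ifs
  · have := Complex.norm_exp_ofReal_mul_I (2 * Real.pi * t)
    push_cast at this
    rw [this, Real.log_one]
  · simp

theorem FReal.logHom_sign (v w : InfinitePlace F) :
    FReal.logHom v (Additive.ofMul (FReal.sign w)) = 0 := by
  classical
  rw [FReal.logHom_apply, FReal.ext_sign]
  split_ifs <;> simp

theorem FReal.angular_one (w : {w : InfinitePlace F // w.IsComplex}) :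
    FReal.angular w 1 = 0 := by
  classical
  refine Units.ext (FReal.eq_of_ext_eq fun v => ?_)
  refine (FReal.ext_angular w 1 v).trans ?_
  have h : FReal.ext v.embedding (((0 : Additive (FReal F)ˣ).toMul : (FReal F)ˣ) : FReal F) = 1 :=
    map_one _
  refine Eq.trans ?_ h.symm
  split_ifs
  · rw [Complex.ofReal_one, mul_one, Complex.exp_two_pi_mul_I]
  · rfl

/-- A homomorphism on the units of `F_ℝ` is determined by its values on radial and angular units
and on signs. -/
theorem FReal.unitHom_ext {A : Type*} [AddCommGroup A] {α β : Additive (FReal F)ˣ →+ A}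
    (hr : ∀ y, α (FReal.radial y) = β (FReal.radial y))
    (ha : ∀ w t, α (FReal.angular w t) = β (FReal.angular w t))
    (hs : ∀ w : InfinitePlace F, w.IsReal →
      α (Additive.ofMul (FReal.sign w)) = β (Additive.ofMul (FReal.sign w))) : α = β := by
  classical
  refine AddMonoidHom.ext fun x => ?_
  have hloc : ∀ w : InfinitePlace F, ∃ y : (FReal F)ˣ,
      α (Additive.ofMul y) = β (Additive.ofMul y) ∧
      ∀ v : InfinitePlace F, FReal.ext v.embedding (y : FReal F) =
        if v = w then FReal.ext v.embedding (x.toMul : FReal F) /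
          ‖FReal.ext v.embedding (x.toMul : FReal F)‖ else 1 := by
    intro w
    have hne := FReal.ext_ne_zero w.embedding x.toMul
    by_cases hw : w.IsReal
    · have hreal := FReal.toMixed_fst (x.toMul : FReal F) ⟨w, hw⟩
      set r := (FReal.toMixed F (x.toMul : FReal F)).1 ⟨w, hw⟩
      change (r : ℂ) = FReal.ext w.embedding (x.toMul : FReal F) at hreal
      rw [← hreal, Complex.ofReal_ne_zero] at hne
      rcases lt_or_gt_of_ne hne with h | h
      · refine ⟨FReal.sign w, hs w hw, fun v => ?_⟩
        rw [FReal.ext_sign]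
        split_ifs with hv
        · rw [hv, ← hreal, Complex.norm_real, Real.norm_of_nonpos h.le, Complex.ofReal_neg,
            div_neg, div_self (Complex.ofReal_ne_zero.2 hne)]
        · rfl
      · refine ⟨1, by rw [ofMul_one, map_zero, map_zero], fun v => ?_⟩
        rw [Units.val_one, map_one]
        split_ifs with hv
        · rw [hv, ← hreal, Complex.norm_real, Real.norm_of_nonneg h.le,
            div_self (Complex.ofReal_ne_zero.2 hne)]
        · rfl
    · rw [InfinitePlace.not_isReal_iff_isComplex] at hw
      refine ⟨(FReal.angular ⟨w, hw⟩ (Complex.arg (FReal.ext w.embedding (x.toMul : FReal F)) /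
        (2 * Real.pi))).toMul, ha _ _, fun v => ?_⟩
      rw [FReal.ext_angular]
      split_ifs with hv
      · rw [hv, eq_div_iff (Complex.ofReal_ne_zero.2 (norm_ne_zero_iff.2 hne))]
        conv_rhs => rw [← Complex.norm_mul_exp_arg_mul_I (FReal.ext w.embedding (x.toMul : FReal F))]
        rw [mul_comm]
        congr 2
        have : (Real.pi : ℂ) ≠ 0 := Complex.ofReal_ne_zero.2 Real.pi_ne_zero
        push_cast
        field_simp
      · rfl
  choose y hy1 hy2 using hloc
  have hx : x = FReal.radial (fun w => FReal.logHom w x) + ∑ w, Additive.ofMul (y w) := by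
    rw [← ofMul_prod]
    refine Units.ext (FReal.eq_of_ext_eq fun v => ?_)
    have hne := FReal.ext_ne_zero v.embedding x.toMul
    change _ = FReal.ext v.embedding (((FReal.radial fun w => FReal.logHom w x).toMul : FReal F) *
      ((∏ w, y w : (FReal F)ˣ) : FReal F))
    rw [map_mul, FReal.ext_radial, Units.coe_prod, map_prod]
    simp only [hy2]
    rw [Finset.prod_ite_eq, if_pos (Finset.mem_univ _)]
    change _ = ((Real.exp (Real.log ‖FReal.ext v.embedding (x.toMul : FReal F)‖) : ℝ) : ℂ) * _
    rw [Real.exp_log (norm_pos_iff.2 hne), mul_div_cancel₀]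
    · rfl
    · exact Complex.ofReal_ne_zero.2 (norm_ne_zero_iff.2 hne)
  rw [hx]
  simp only [map_add, map_sum, hr, hy1]

theorem FReal.argAt_eq_zero_of_mk {φ : F →+* ℂ} {x : Additive (FReal F)ˣ}
    (h : FReal.argAt (InfinitePlace.mk φ).embedding x = 0) : FReal.argAt φ x = 0 := by
  rcases InfinitePlace.embedding_mk_eq φ with h' | h'
  · rwa [h'] at h
  · rwa [h', FReal.argAt_conj, AddMonoidHom.neg_apply, neg_eq_zero] at h

theorem FReal.argAt_radial (φ : F →+* ℂ) (y : InfinitePlace F → ℝ) :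
    FReal.argAt φ (FReal.radial y) = 0 :=
  FReal.argAt_eq_zero_of_mk (argHom_of_real_pos _ _ (Real.exp_pos _) (FReal.ext_radial _ y))

theorem FReal.argAt_angular_self (w : {w : InfinitePlace F // w.IsComplex}) (t : ℝ) :
    FReal.argAt w.1.embedding (FReal.angular w t) = (t : AddCircle (1 : ℝ)) := by
  classical
  refine argHom_exp _ t ?_
  refine (FReal.ext_angular w t w.1).trans (if_pos rfl)

theorem FReal.argAt_angular_of_ne (w : {w : InfinitePlace F // w.IsComplex}) (t : ℝ) (φ : F →+* ℂ)
    (h : InfinitePlace.mk φ ≠ w.1) : FReal.argAt φ (FReal.angular w t) = 0 := by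
  classical
  refine FReal.argAt_eq_zero_of_mk (argHom_of_real_pos _ 1 one_pos ?_)
  refine (FReal.ext_angular w t _).trans ?_
  rw [if_neg h, Complex.ofReal_one]

theorem FReal.argAt_sign_self (w : InfinitePlace F) :
    FReal.argAt w.embedding (Additive.ofMul (FReal.sign w)) = ((1 / 2 : ℝ) : AddCircle (1 : ℝ)) := by
  classical
  refine argHom_exp _ _ ?_
  refine (FReal.ext_sign w w).trans ?_
  rw [if_pos rfl, ← Complex.exp_pi_mul_I]
  congr 1
  push_cast
  ring

theorem FReal.argAt_sign_of_ne (w : InfinitePlace F) (φ : F →+* ℂ)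
    (h : InfinitePlace.mk φ ≠ w) : FReal.argAt φ (Additive.ofMul (FReal.sign w)) = 0 := by
  classical
  refine FReal.argAt_eq_zero_of_mk (argHom_of_real_pos _ 1 one_pos ?_)
  refine (FReal.ext_sign w _).trans ?_
  rw [if_neg h, Complex.ofReal_one]

/-- The unitary character of the units of `F_ℝ` with given winding numbers. -/
def FReal.angularChar : ((F →+* ℂ) → ℤ) →+ Additive (FReal F)ˣ →+ AddCircle (1 : ℝ) :=
  AddMonoidHom.mk' (fun m => ∑ φ, m φ • FReal.argAt φ) fun m n => by
    rw [← Finset.sum_add_distrib]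
    refine Finset.sum_congr rfl fun φ _ => AddMonoidHom.ext fun x => ?_
    exact add_smul (m φ) (n φ) (FReal.argAt φ x)

theorem FReal.angularChar_apply (m : (F →+* ℂ) → ℤ) (x : Additive (FReal F)ˣ) :
    FReal.angularChar m x = ∑ φ, m φ • FReal.argAt φ x := by
  change (∑ φ, m φ • FReal.argAt φ) x = _
  rw [AddMonoidHom.finsetSum_apply]
  rfl

/-- The real character of the units of `F_ℝ` with given slopes. -/
def FReal.radialChar : (InfinitePlace F → ℝ) →+ Additive (FReal F)ˣ →+ ℝ :=
  AddMonoidHom.mk' (fun a => ∑ w, (AddMonoidHom.mulLeft (a w)).comp (FReal.logHom w)) fun m n => by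
    rw [← Finset.sum_add_distrib]
    refine Finset.sum_congr rfl fun w _ => AddMonoidHom.ext fun x => ?_
    exact add_mul _ _ _

theorem FReal.radialChar_apply (a : InfinitePlace F → ℝ) (x : Additive (FReal F)ˣ) :
    FReal.radialChar a x = ∑ w, a w * FReal.logHom w x := by
  change (∑ w, (AddMonoidHom.mulLeft (a w)).comp (FReal.logHom w)) x = _
  rw [AddMonoidHom.finsetSum_apply]
  rfl

theorem FReal.angularChar_radial (m : (F →+* ℂ) → ℤ) (y : InfinitePlace F → ℝ) :
    FReal.angularChar m (FReal.radial y) = 0 := by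
  rw [FReal.angularChar_apply]
  exact Finset.sum_eq_zero fun φ _ => by rw [FReal.argAt_radial, smul_zero]

theorem FReal.angularChar_angular (m : (F →+* ℂ) → ℤ)
    (w : {w : InfinitePlace F // w.IsComplex}) (t : ℝ) :
    FReal.angularChar m (FReal.angular w t) =
      (m w.1.embedding - m (ComplexEmbedding.conjugate w.1.embedding)) •
        (t : AddCircle (1 : ℝ)) := by
  have hne : w.1.embedding ≠ ComplexEmbedding.conjugate w.1.embedding := fun h =>
    InfinitePlace.not_isReal_iff_isComplex.2 w.2 (InfinitePlace.isReal_iff.2 h.symm)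
  rw [FReal.angularChar_apply, Finset.sum_eq_add w.1.embedding
    (ComplexEmbedding.conjugate w.1.embedding) hne _ (by simp) (by simp)]
  · rw [FReal.argAt_conj, AddMonoidHom.neg_apply, FReal.argAt_angular_self, sub_smul, smul_neg,
      sub_eq_add_neg]
  · intro φ _ hφ
    rw [FReal.argAt_angular_of_ne, smul_zero]
    rintro h
    rw [← h] at hφ
    rcases InfinitePlace.embedding_mk_eq φ with h' | h'
    · exact hφ.1 h'.symm
    · apply hφ.2
      rw [h']
      exact (star_star φ).symm

theorem FReal.angularChar_sign (m : (F →+* ℂ) → ℤ) {w : InfinitePlace F} (hw : w.IsReal) :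
    FReal.angularChar m (Additive.ofMul (FReal.sign w)) =
      m w.embedding • ((1 / 2 : ℝ) : AddCircle (1 : ℝ)) := by
  rw [FReal.angularChar_apply, Finset.sum_eq_single w.embedding _ (by simp),
    FReal.argAt_sign_self]
  intro φ _ hφ
  rw [FReal.argAt_sign_of_ne, smul_zero]
  rintro rfl
  rcases InfinitePlace.embedding_mk_eq φ with h' | h'
  · exact hφ h'.symm
  · apply hφ
    have := InfinitePlace.isReal_iff.1 hw
    rw [h'] at this ⊢
    rw [← ComplexEmbedding.isReal_iff.1 this]
    exact (star_star φ).symm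

theorem FReal.radialChar_radial (a y : InfinitePlace F → ℝ) :
    FReal.radialChar a (FReal.radial y) = ∑ w, a w * y w := by
  simp only [FReal.radialChar_apply, FReal.logHom_radial]

theorem FReal.radialChar_angular (a : InfinitePlace F → ℝ)
    (w : {w : InfinitePlace F // w.IsComplex}) (t : ℝ) :
    FReal.radialChar a (FReal.angular w t) = 0 := by
  simp only [FReal.radialChar_apply, FReal.logHom_angular, mul_zero, Finset.sum_const_zero]

theorem FReal.radialChar_sign (a : InfinitePlace F → ℝ) (w : InfinitePlace F) :
    FReal.radialChar a (Additive.ofMul (FReal.sign w)) = 0 := by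
  simp only [FReal.radialChar_apply, FReal.logHom_sign, mul_zero, Finset.sum_const_zero]

/-- Every continuous character of the units of `F_ℝ` is the sum of an angular and a radial one. -/
theorem FReal.exists_eq_angularChar_add_radialChar
    (α : Additive (FReal F)ˣ →+ AddCircle (1 : ℝ))
    (hα : Continuous fun x : (FReal F)ˣ => α (Additive.ofMul x)) :
    ∃ (m : (F →+* ℂ) → ℤ) (a : InfinitePlace F → ℝ), ∀ x,
      α x = FReal.angularChar m x + (FReal.radialChar a x : AddCircle (1 : ℝ)) := by
  classical
  obtain ⟨l, hl⟩ := AddCircle.exists_linear_lift (α.comp FReal.radial)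
    (hα.comp FReal.continuous_radial)
  have hang : ∀ w : {w : InfinitePlace F // w.IsComplex}, ∃ k : ℤ, ∀ t : ℝ,
      α (FReal.angular w t) = k • (t : AddCircle (1 : ℝ)) := fun w => by
    obtain ⟨c, hc⟩ := AddCircle.exists_linear_lift (α.comp (FReal.angular w))
      (hα.comp (FReal.continuous_angular w))
    have h1 := hc 1
    rw [AddMonoidHom.comp_apply, FReal.angular_one, map_zero] at h1
    obtain ⟨k, hk⟩ := (AddCircle.coe_eq_zero_iff 1).1 h1.symm
    refine ⟨k, fun t => ?_⟩
    have h2 : c t = k • t := by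
      have := c.map_smul t 1
      rw [smul_eq_mul, mul_one, smul_eq_mul, ← hk] at this
      rw [this]; simp [mul_comm]
    rw [← AddCircle.coe_zsmul, ← h2]
    exact hc t
  have hsgn : ∀ w : InfinitePlace F, ∃ k : ℤ,
      α (Additive.ofMul (FReal.sign w)) = k • ((1 / 2 : ℝ) : AddCircle (1 : ℝ)) := fun w => by
    have h1 : α (Additive.ofMul (FReal.sign w)) + α (Additive.ofMul (FReal.sign w)) = 0 := by
      rw [← map_add, ← ofMul_mul, FReal.sign_mul_self, ofMul_one, map_zero]
    obtain ⟨r, hr⟩ := QuotientAddGroup.mk_surjective (α (Additive.ofMul (FReal.sign w)))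
    change (r : AddCircle (1 : ℝ)) = _ at hr
    rw [← hr, ← AddCircle.coe_add] at h1
    obtain ⟨k, hk⟩ := (AddCircle.coe_eq_zero_iff 1).1 h1
    refine ⟨k, ?_⟩
    rw [← hr, ← AddCircle.coe_zsmul]
    congr 1
    simp only [zsmul_eq_mul, mul_one] at hk ⊢
    rw [hk]; ring
  choose k hk using hang
  choose s hs using hsgn
  have hemb : ∀ w : InfinitePlace F, (InfinitePlace.mk w.embedding) = w :=
    InfinitePlace.mk_embedding
  let m : (F →+* ℂ) → ℤ := fun φ => if φ = (InfinitePlace.mk φ).embedding then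
    (if h : (InfinitePlace.mk φ).IsComplex then k ⟨_, h⟩ else s (InfinitePlace.mk φ)) else 0
  have hm : ∀ w : InfinitePlace F,
      m w.embedding = if h : w.IsComplex then k ⟨w, h⟩ else s w := fun w => by
    simp only [m, hemb, if_true]
  have hm' : ∀ w : InfinitePlace F, w.IsComplex →
      m (ComplexEmbedding.conjugate w.embedding) = 0 := fun w hw => by
    simp only [m, InfinitePlace.mk_conjugate_eq, hemb]
    rw [if_neg]
    exact fun h => InfinitePlace.not_isReal_iff_isComplex.2 hw (InfinitePlace.isReal_iff.2 h)
  refine ⟨m, fun w => l (Pi.single w 1), fun x => ?_⟩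
  have key : α = FReal.angularChar m + (QuotientAddGroup.mk' _).comp
      (FReal.radialChar fun w => l (Pi.single w 1)) := by
    refine FReal.unitHom_ext (fun y => ?_) (fun w t => ?_) (fun w hw => ?_)
    · rw [AddMonoidHom.add_apply, AddMonoidHom.comp_apply, FReal.angularChar_radial, zero_add,
        FReal.radialChar_radial]
      refine (hl y).trans ?_
      change ((l y : ℝ) : AddCircle (1 : ℝ)) = ((∑ w, l (Pi.single w 1) * y w : ℝ) : AddCircle (1 : ℝ))
      congr 1
      conv_lhs => rw [← Finset.univ_sum_single y, map_sum]
      refine Finset.sum_congr rfl fun w _ => ?_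
      rw [mul_comm, ← smul_eq_mul, ← map_smul, ← Pi.single_smul, smul_eq_mul, mul_one]
    · rw [AddMonoidHom.add_apply, AddMonoidHom.comp_apply, FReal.angularChar_angular,
        FReal.radialChar_angular, map_zero, add_zero, hm, hm' _ w.2, sub_zero, dif_pos w.2, hk]
    · rw [AddMonoidHom.add_apply, AddMonoidHom.comp_apply, FReal.angularChar_sign _ hw,
        FReal.radialChar_sign, map_zero, add_zero, hm,
        dif_neg (InfinitePlace.not_isComplex_iff_isReal.2 hw), hs]
  exact DFunLike.congr_fun key x

end RealCharacters

section FractionalIdealCount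

open IsDedekindDomain FractionalIdeal

variable {R : Type*} [CommRing R] [IsDedekindDomain R] {K : Type*} [Field K] [Algebra R K]
  [IsFractionRing R K]

theorem FractionalIdeal.valuation_eq_exp_neg_count (v : HeightOneSpectrum R) {x : K} (hx : x ≠ 0) :
    v.valuation K x = WithZero.exp (-count K v (spanSingleton R⁰ x)) := by
  have key : ∀ r : R, r ≠ 0 → v.valuation K (algebraMap R K r) =
      WithZero.exp (-count K v (spanSingleton R⁰ (algebraMap R K r))) := fun r hr => by
    rw [HeightOneSpectrum.valuation_of_algebraMap, v.intValuation_if_neg hr,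
      ← coeIdeal_span_singleton, count_coe K v (by simpa using hr)]
  obtain ⟨r, s, hs, rfl⟩ := IsFractionRing.div_surjective (A := R) x
  have hs0 : s ≠ 0 := nonZeroDivisors.ne_zero hs
  have hsK : algebraMap R K s ≠ 0 := by simpa using hs0
  have hr0 : r ≠ 0 := by rintro rfl; simp at hx
  have h1 := key r hr0
  rw [← div_mul_cancel₀ (algebraMap R K r) hsK, map_mul, key s hs0,
    ← spanSingleton_mul_spanSingleton, count_mul K v (spanSingleton_ne_zero_iff.2 hx)
      (spanSingleton_ne_zero_iff.2 hsK), neg_add, WithZero.exp_add] at h1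
  exact mul_right_cancel₀ WithZero.exp_ne_zero h1

theorem FractionalIdeal.valuation_le_exp_neg_count (v : HeightOneSpectrum R)
    {I : FractionalIdeal R⁰ K} {x : K} (hx : x ∈ I) :
    v.valuation K x ≤ WithZero.exp (-count K v I) := by
  rcases eq_or_ne x 0 with rfl | h0
  · simp
  rw [valuation_eq_exp_neg_count v h0, WithZero.exp_le_exp, neg_le_neg_iff]
  exact count_mono K v (spanSingleton_ne_zero_iff.2 h0) (spanSingleton_le_iff_mem.2 hx)

theorem FractionalIdeal.exists_valuation_eq_exp_neg_count (v : HeightOneSpectrum R)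
    {I : FractionalIdeal R⁰ K} (hI : I ≠ 0) :
    ∃ x ∈ I, v.valuation K x = WithZero.exp (-count K v I) := by
  have hv : (v.asIdeal : FractionalIdeal R⁰ K) ≠ 0 := coeIdeal_ne_zero.2 v.ne_bot
  have hnot : ¬ I ≤ I * v.asIdeal := fun h => by
    have := count_mono K v hI h
    rw [count_mul K v hI hv, count_self] at this
    omega
  obtain ⟨x, hx, hx'⟩ := SetLike.not_le_iff_exists.1 hnot
  have h0 : x ≠ 0 := by rintro rfl; exact hx' (FractionalIdeal.zero_mem _)
  have hs : spanSingleton R⁰ x ≠ 0 := spanSingleton_ne_zero_iff.2 h0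
  refine ⟨x, hx, ?_⟩
  have hC : spanSingleton R⁰ x * I⁻¹ ≤ 1 := by
    rw [← mul_inv_cancel₀ hI]
    exact mul_le_mul_left (spanSingleton_le_iff_mem.2 hx) _
  obtain ⟨c, hc⟩ := le_one_iff_exists_coeIdeal.1 hC
  have hc0 : c ≠ 0 := by
    refine (coeIdeal_ne_zero (K := K)).1 ?_
    rw [hc]
    exact mul_ne_zero hs (inv_ne_zero hI)
  have hcount : count K v c = 0 := by
    rw [count_coe K v hc0, Nat.cast_eq_zero]
    by_contra hne
    have hdvd := (Associates.count_ne_zero_iff_dvd hc0 v.irreducible).1 hne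
    apply hx'
    have h2 : spanSingleton R⁰ x = I * c := by
      rw [hc, mul_comm I, inv_mul_cancel_right₀ hI]
    rw [← spanSingleton_le_iff_mem, h2]
    exact mul_le_mul_right ((coeIdeal_le_coeIdeal K).2 (Ideal.le_of_dvd hdvd)) I
  rw [valuation_eq_exp_neg_count v h0]
  rw [hc, count_mul K v hs (inv_ne_zero hI), count_inv] at hcount
  congr 2
  omega

theorem FractionalIdeal.eq_of_count_eq {I J : FractionalIdeal R⁰ K} (hI : I ≠ 0) (hJ : J ≠ 0)
    (h : ∀ v, count K v I = count K v J) : I = J := by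
  rw [← finprod_heightOneSpectrum_factorization' K hI,
    ← finprod_heightOneSpectrum_factorization' K hJ]
  simp only [h]

end FractionalIdealCount

section ConjugatePrime

open IsDedekindDomain FractionalIdeal

variable {F : Type} [Field F]

/-- The image of a prime under a field automorphism. -/
noncomputable def conjPrime (s : F ≃+* F) (v : HeightOneSpectrum (𝓞 F)) :
    HeightOneSpectrum (𝓞 F) :=
  HeightOneSpectrum.equivOfRingEquiv (RingOfIntegers.mapRingEquiv s) v

theorem mem_conjPrime (s : F ≃+* F) (v : HeightOneSpectrum (𝓞 F)) (r : 𝓞 F) :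
    RingOfIntegers.mapRingEquiv s r ∈ (conjPrime s v).asIdeal ↔ r ∈ v.asIdeal := by
  change (RingOfIntegers.mapRingEquiv s).symm (RingOfIntegers.mapRingEquiv s r) ∈ v.asIdeal ↔ _
  rw [RingEquiv.symm_apply_apply]

theorem conjPrime_eq_iff (s : F ≃+* F) (v v' : HeightOneSpectrum (𝓞 F)) :
    v' = conjPrime s v ↔ algebraMap (𝓞 F) F '' (v'.asIdeal : Set (𝓞 F)) =
      s '' (algebraMap (𝓞 F) F '' (v.asIdeal : Set (𝓞 F))) := by
  have himg : algebraMap (𝓞 F) F '' ((conjPrime s v).asIdeal : Set (𝓞 F)) =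
      s '' (algebraMap (𝓞 F) F '' (v.asIdeal : Set (𝓞 F))) := by
    ext x
    constructor
    · rintro ⟨r, hr, rfl⟩
      refine ⟨_, ⟨(RingOfIntegers.mapRingEquiv s).symm r, hr, rfl⟩, ?_⟩
      exact s.apply_symm_apply _
    · rintro ⟨_, ⟨r, hr, rfl⟩, rfl⟩
      exact ⟨RingOfIntegers.mapRingEquiv s r, (mem_conjPrime s v r).2 hr, rfl⟩
  rw [← himg, (Set.image_injective.2 RingOfIntegers.coe_injective).eq_iff, SetLike.coe_set_eq,
    HeightOneSpectrum.ext_iff]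

variable [NumberField F]

theorem valuation_conjPrime (s : F ≃+* F) (v : HeightOneSpectrum (𝓞 F)) (x : F) :
    (conjPrime s v).valuation F (s x) = v.valuation F x := by
  have hmap : (conjPrime s v).asIdeal = v.asIdeal.map (RingOfIntegers.mapRingEquiv s) := by
    rw [← Ideal.comap_symm]
    rfl
  have h_integral : ∀ r : 𝓞 F, (conjPrime s v).intValuation (RingOfIntegers.mapRingEquiv s r) =
      v.intValuation r := fun r => by
    rcases eq_or_ne r 0 with rfl | hr
    · simp
    have hr' : RingOfIntegers.mapRingEquiv s r ≠ 0 := by simpa using hr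
    rw [HeightOneSpectrum.intValuation_eq_exp_neg_multiplicity _ hr',
      HeightOneSpectrum.intValuation_eq_exp_neg_multiplicity _ hr]
    congr 3
    apply multiplicity_eq_of_emultiplicity_eq
    rw [emultiplicity_eq_emultiplicity_iff]
    intro n
    rw [Ideal.dvd_span_singleton, Ideal.dvd_span_singleton, hmap, ← Ideal.map_pow,
      ← Ideal.comap_symm, Ideal.mem_comap]
    simp
  obtain ⟨a, b, hb, rfl⟩ := IsFractionRing.div_surjective (A := 𝓞 F) x
  have hval : ∀ r : 𝓞 F, (conjPrime s v).valuation F (s (algebraMap (𝓞 F) F r)) =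
      v.valuation F (algebraMap (𝓞 F) F r) := fun r => by
    rw [HeightOneSpectrum.valuation_of_algebraMap, ← h_integral,
      ← HeightOneSpectrum.valuation_of_algebraMap (K := F)]
    rfl
  rw [map_div₀, map_div₀, map_div₀, hval, hval]

theorem count_conjPrime (s : F ≃+* F) (v : HeightOneSpectrum (𝓞 F))
    {I J : FractionalIdeal (𝓞 F)⁰ F} (hI : I ≠ 0) (hJ : J ≠ 0)
    (h : ((J : Submodule (𝓞 F) F) : Set F) = s '' ((I : Submodule (𝓞 F) F) : Set F)) :
    count F (conjPrime s v) J = count F v I := by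
  apply le_antisymm
  · obtain ⟨x, hx, hvx⟩ := exists_valuation_eq_exp_neg_count v hI
    have hy : s x ∈ J := by
      change s x ∈ ((J : Submodule (𝓞 F) F) : Set F)
      rw [h]
      exact ⟨x, hx, rfl⟩
    have := valuation_le_exp_neg_count (conjPrime s v) hy
    rwa [valuation_conjPrime, hvx, WithZero.exp_le_exp, neg_le_neg_iff] at this
  · obtain ⟨y, hy, hvy⟩ := exists_valuation_eq_exp_neg_count (conjPrime s v) hJ
    have hy' : y ∈ ((J : Submodule (𝓞 F) F) : Set F) := hy
    rw [h] at hy'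
    obtain ⟨x, hx, rfl⟩ := hy'
    have hx' : x ∈ I := hx
    have := valuation_le_exp_neg_count v hx'
    rwa [← valuation_conjPrime s, hvy, WithZero.exp_le_exp, neg_le_neg_iff] at this

end ConjugatePrime

noncomputable section SupportedDivisors

open IsDedekindDomain FractionalIdeal

variable {F : Type} [Field F] [NumberField F]

theorem FReal.log_abs_norm (x : (FReal F)ˣ) :
    Real.log |Algebra.norm ℝ (x : FReal F)| =
      FReal.radialChar (fun w => (w.mult : ℝ)) (Additive.ofMul x) := by
  rw [FReal.abs_norm_eq, Real.log_prod, FReal.radialChar_apply]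
  · simp only [Real.log_pow, FReal.logHom_apply]
  · exact fun w _ => pow_ne_zero _ (norm_ne_zero_iff.2 (FReal.ext_ne_zero _ _))

theorem IdealGroup.absNorm_pos (I : IdealGroup F) :
    (0 : ℝ) < (absNorm (I : FractionalIdeal (𝓞 F)⁰ F) : ℚ) := by
  rw [Rat.cast_pos]
  exact lt_of_le_of_ne (absNorm_nonneg _) fun h => I.ne_zero (absNorm_eq_zero_iff.1 h.symm)

theorem mem_picDom_iff_abs (z : IdealGroup F × (FReal F)ˣ) :
    z ∈ picDom F ↔ ((absNorm (z.1 : FractionalIdeal (𝓞 F)⁰ F) : ℚ) : ℝ) =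
      |Algebra.norm ℝ (z.2 : FReal F)| := by
  rw [picDom, MonoidHom.mem_ker, MonoidHom.div_apply, div_eq_one, Units.ext_iff]
  rfl

theorem mem_picDom_iff (z : IdealGroup F × (FReal F)ˣ) :
    z ∈ picDom F ↔ Real.log (absNorm (z.1 : FractionalIdeal (𝓞 F)⁰ F) : ℚ) =
      FReal.radialChar (fun w => (w.mult : ℝ)) (Additive.ofMul z.2) := by
  rw [mem_picDom_iff_abs, ← FReal.log_abs_norm]
  constructor
  · exact fun h => congrArg _ h
  · refine fun h => Real.log_injOn_pos (IdealGroup.absNorm_pos z.1) ?_ h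
    rw [Set.mem_Ioi, abs_pos]
    exact (z.2.isUnit.map (Algebra.norm ℝ)).ne_zero

theorem coe_principalHom_snd (u : Fˣ) :
    ((principalHom F u).2 : FReal F) = (1 : ℝ) ⊗ₜ[ℚ] (u : F) := rfl

theorem ext_principalHom (φ : F →+* ℂ) (u : Fˣ) :
    FReal.ext φ ((principalHom F u).2 : FReal F) = φ u := by
  rw [coe_principalHom_snd, FReal.ext_tmul, Complex.ofReal_one, one_mul]

theorem coe_principalHom_fst (u : Fˣ) :
    ((principalHom F u).1 : FractionalIdeal (𝓞 F)⁰ F) = spanSingleton (𝓞 F)⁰ (u : F) :=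
  coe_toPrincipalIdeal u

theorem principalHom_mem (u : Fˣ) : principalHom F u ∈ picDom F := by
  rw [mem_picDom_iff_abs, coe_principalHom_fst, absNorm_span_singleton, FReal.abs_norm_eq]
  simp only [ext_principalHom, InfinitePlace.norm_embedding_eq, InfinitePlace.prod_eq_abs_norm]

/-- The multiplicity of a prime in a fractional ideal. -/
def countHom (v : HeightOneSpectrum (𝓞 F)) : Additive (picDom F) →+ ℤ :=
  AddMonoidHom.mk' (fun z => count F v (z.toMul.1.1 : FractionalIdeal (𝓞 F)⁰ F)) fun y z =>
    count_mul F v y.toMul.1.1.ne_zero z.toMul.1.1.ne_zero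

variable (F) in
/-- The archimedean component of an oriented Arakelov divisor. -/
def archHom : Additive (picDom F) →+ Additive (FReal F)ˣ :=
  AddMonoidHom.mk' (fun z => Additive.ofMul z.toMul.1.2) fun _ _ => rfl

variable (Sf : Set (HeightOneSpectrum (𝓞 F)))

/-- The oriented Arakelov divisors supported at a set of primes and at the infinite places. -/
def supportedDom : AddSubgroup (Additive (picDom F)) :=
  ⨅ v : {v // v ∉ Sf}, (countHom v.1).ker

variable {Sf} in
theorem mem_supportedDom_iff {z : Additive (picDom F)} :
    z ∈ supportedDom Sf ↔ ∀ v ∉ Sf, countHom v z = 0 := by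
  simp [supportedDom, AddSubgroup.mem_iInf, AddMonoidHom.mem_ker]

/-- The vector of multiplicities of a supported divisor. -/
def supportVec : supportedDom Sf →+ (Sf → ℤ) :=
  AddMonoidHom.mk' (fun z p => countHom p.1 z.1) fun y z => funext fun p =>
    map_add (countHom p.1) y.1 z.1

/-- The archimedean component of a supported divisor. -/
def supportArch : supportedDom Sf →+ Additive (FReal F)ˣ :=
  (archHom F).comp (supportedDom Sf).subtype

/-- The class of a supported divisor. -/
def supportClass : supportedDom Sf →+ Additive (PicTilde F) :=
  (QuotientGroup.mk' (principalSub F)).toAdditive.comp (supportedDom Sf).subtype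

theorem countHom_principal (v : HeightOneSpectrum (𝓞 F)) (u : Fˣ) :
    v.valuation F u =
      WithZero.exp (-countHom v (Additive.ofMul ⟨principalHom F u, principalHom_mem u⟩)) := by
  rw [valuation_eq_exp_neg_count v u.ne_zero, ← coe_principalHom_fst]
  rfl

theorem countHom_principal_eq_zero_iff (v : HeightOneSpectrum (𝓞 F)) (u : Fˣ) :
    countHom v (Additive.ofMul ⟨principalHom F u, principalHom_mem u⟩) = 0 ↔
      v.valuation F u = 1 := by
  rw [countHom_principal, ← WithZero.exp_zero, WithZero.exp_inj, neg_eq_zero]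

/-- The principal divisor of an `S`-unit. -/
def unitDivisor : Additive (Sf.unit F) →+ supportedDom Sf :=
  AddMonoidHom.mk' (fun u => ⟨Additive.ofMul ⟨principalHom F u.toMul.1, principalHom_mem _⟩,
    mem_supportedDom_iff.2 fun v hv => (countHom_principal_eq_zero_iff v _).2
      (u.toMul.2 v hv)⟩) fun u v => Subtype.ext (congrArg Additive.ofMul (Subtype.ext
        (map_mul (principalHom F) u.toMul.1 v.toMul.1)))

variable {Sf}

theorem ext_supportArch_unitDivisor (φ : F →+* ℂ) (u : Additive (Sf.unit F)) :
    FReal.ext φ ((supportArch Sf (unitDivisor Sf u)).toMul : FReal F) = φ (u.toMul : Fˣ) :=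
  ext_principalHom φ _

theorem valuation_eq_supportVec (p : Sf) (u : Additive (Sf.unit F)) :
    p.1.valuation F ((u.toMul : Fˣ) : F) = WithZero.exp (-supportVec Sf (unitDivisor Sf u) p) :=
  countHom_principal _ _

theorem supportClass_eq_zero_iff (z : supportedDom Sf) :
    supportClass Sf z = 0 ↔ ∃ u, unitDivisor Sf u = z := by
  have h : supportClass Sf z = 0 ↔ z.1.toMul ∈ principalSub F :=
    (QuotientGroup.eq_one_iff (N := principalSub F) z.1.toMul)
  rw [h]
  constructor
  · rintro ⟨u, hu⟩
    have hz : (⟨principalHom F u, principalHom_mem u⟩ : picDom F) = z.1.toMul := Subtype.ext hu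
    refine ⟨Additive.ofMul ⟨u, fun v hv => ?_⟩, Subtype.ext (congrArg Additive.ofMul hz)⟩
    rw [← countHom_principal_eq_zero_iff, hz]
    exact mem_supportedDom_iff.1 z.2 v hv
  · rintro ⟨u, rfl⟩
    exact ⟨u.toMul.1, rfl⟩

theorem ideal_eq_one_of_supportVec_eq_zero {z : supportedDom Sf} (h : supportVec Sf z = 0) :
    z.1.toMul.1.1 = 1 := by
  apply Units.ext
  refine eq_of_count_eq (Units.ne_zero _) one_ne_zero fun v => Eq.trans ?_ (count_one F v).symm
  by_cases hv : v ∈ Sf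
  · exact congrFun h ⟨v, hv⟩
  · exact mem_supportedDom_iff.1 z.2 v hv

theorem radialChar_mult_of_supportVec_eq_zero {z : supportedDom Sf} (h : supportVec Sf z = 0) :
    FReal.radialChar (fun w => (w.mult : ℝ)) (supportArch Sf z) = 0 := by
  have := (mem_picDom_iff _).1 z.1.toMul.2
  rw [ideal_eq_one_of_supportVec_eq_zero h, Units.val_one, map_one, Rat.cast_one,
    Real.log_one] at this
  exact this.symm

theorem exists_supportArch_eq (Sf : Set (HeightOneSpectrum (𝓞 F))) {x : Additive (FReal F)ˣ}
    (hx : FReal.radialChar (fun w => (w.mult : ℝ)) x = 0) :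
    ∃ z : supportedDom Sf, supportVec Sf z = 0 ∧ z.1.toMul.1.1 = 1 ∧ supportArch Sf z = x := by
  have h1 : ((1 : IdealGroup F), x.toMul) ∈ picDom F := by
    rw [mem_picDom_iff, Units.val_one, map_one, Rat.cast_one, Real.log_one]
    exact hx.symm
  refine ⟨⟨Additive.ofMul ⟨_, h1⟩, mem_supportedDom_iff.2 fun v _ => count_one F v⟩,
    funext fun v => count_one F v.1, rfl, rfl⟩

theorem sum_mult_pos : (0 : ℝ) < ∑ w : InfinitePlace F, (w.mult : ℝ) :=
  Finset.sum_pos (fun _ _ => Nat.cast_pos.2 InfinitePlace.mult_pos) Finset.univ_nonempty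

theorem exists_picDom_of_ideal (I : IdealGroup F) : ∃ z : picDom F, z.1.1 = I := by
  set t : ℝ := Real.log (absNorm (I : FractionalIdeal (𝓞 F)⁰ F) : ℚ) /
    ∑ w : InfinitePlace F, (w.mult : ℝ)
  refine ⟨⟨(I, (FReal.radial fun _ => t).toMul), ?_⟩, rfl⟩
  rw [mem_picDom_iff, ofMul_toMul, FReal.radialChar_radial, ← Finset.sum_mul,
    mul_div_cancel₀ _ sum_mult_pos.ne']

theorem supportVec_surjective [Finite Sf] : Function.Surjective (supportVec Sf) := by
  classical
  have : Fintype Sf := Fintype.ofFinite Sf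
  have hone : ∀ p : Sf, ∃ z, supportVec Sf z = Pi.single p 1 := fun p => by
    have hp : ((p.1.asIdeal : Ideal (𝓞 F)) : FractionalIdeal (𝓞 F)⁰ F) ≠ 0 :=
      coeIdeal_ne_zero.2 p.1.ne_bot
    obtain ⟨z, hz⟩ := exists_picDom_of_ideal (Units.mk0 _ hp)
    have hc : ∀ v : HeightOneSpectrum (𝓞 F),
        countHom v (Additive.ofMul z) = if p.1 = v then 1 else 0 := fun v => by
      change count F v (z.1.1 : FractionalIdeal (𝓞 F)⁰ F) = _
      rw [hz, Units.val_mk0, count_maximal]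
    refine ⟨⟨Additive.ofMul z, mem_supportedDom_iff.2 fun v hv => ?_⟩, funext fun v => ?_⟩
    · rw [hc, if_neg]
      rintro rfl
      exact hv p.2
    · refine (hc v.1).trans ?_
      rw [Pi.single_apply]
      simp only [Subtype.ext_iff, eq_comm]
  choose e he using hone
  intro n
  refine ⟨∑ p, n p • e p, ?_⟩
  simp only [map_sum, map_zsmul, he]
  funext p
  simp [Pi.single_apply]

end SupportedDivisors

noncomputable section SupportedClasses

open IsDedekindDomain FractionalIdeal

variable {F : Type} [Field F] [NumberField F] {Sf : Set (HeightOneSpectrum (𝓞 F))}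

theorem exists_valuation_eq_count_of_subsingleton [IsDedekindDomain (Sf.integer F)]
    (htriv : Subsingleton (ClassGroup (Sf.integer F))) (I : IdealGroup F) :
    ∃ α : Fˣ, ∀ v ∉ Sf, v.valuation F (α : F) =
      WithZero.exp (-count F v (I : FractionalIdeal (𝓞 F)⁰ F)) := by
  obtain ⟨a, J, ha, hI⟩ := exists_eq_spanSingleton_mul (I : FractionalIdeal (𝓞 F)⁰ F)
  have ha' : algebraMap (𝓞 F) F a ≠ 0 := by simpa using ha
  have hJ : J ≠ 0 := by
    rintro rfl
    rw [Submodule.zero_eq_bot, coeIdeal_bot, mul_zero] at hI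
    exact I.ne_zero hI
  have hinj : Function.Injective (algebraMap (𝓞 F) (Sf.integer F)) := fun x y h =>
    RingOfIntegers.coe_injective (congrArg (fun t : Sf.integer F => (t : F)) h)
  have hJ' : J.map (algebraMap (𝓞 F) (Sf.integer F)) ≠ 0 := by
    rw [Ne, Submodule.zero_eq_bot, Ideal.map_eq_bot_iff_of_injective hinj]
    exact hJ
  have hprin : (J.map (algebraMap (𝓞 F) (Sf.integer F))).IsPrincipal :=
    (ClassGroup.mk0_eq_one_iff (mem_nonZeroDivisors_iff_ne_zero.2 hJ')).1 (Subsingleton.elim _ _)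
  obtain ⟨β, hβ⟩ := hprin.principal
  have hβ0 : (β : F) ≠ 0 := fun h => hJ' (by
    rw [hβ, Submodule.zero_eq_bot, Submodule.span_singleton_eq_bot]
    exact Subtype.ext h)
  have hval : ∀ v ∉ Sf, v.valuation F (β : F) =
      WithZero.exp (-count F v (J : FractionalIdeal (𝓞 F)⁰ F)) := fun v hv => by
    apply le_antisymm
    · have hmem : β ∈ J.map (algebraMap (𝓞 F) (Sf.integer F)) := by
        rw [hβ]; exact Submodule.mem_span_singleton_self β
      refine Submodule.span_induction (p := fun (y : Sf.integer F) _ => v.valuation F (y : F) ≤ _)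
        ?_ ?_ ?_ ?_ hmem
      · rintro _ ⟨r, hr, rfl⟩
        exact valuation_le_exp_neg_count v (mem_coeIdeal_of_mem _ hr)
      · simp
      · exact fun x y _ _ hx hy => (Valuation.map_add _ _ _).trans (max_le hx hy)
      · intro s x _ hx
        rw [smul_eq_mul, Subalgebra.coe_mul, map_mul]
        exact (mul_le_mul' (s.2 v hv) hx).trans (one_mul _).le
    · obtain ⟨x, hx, hvx⟩ := exists_valuation_eq_exp_neg_count v (coeIdeal_ne_zero.2 hJ :
        (J : FractionalIdeal (𝓞 F)⁰ F) ≠ 0)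
      obtain ⟨r, hr, rfl⟩ := (mem_coeIdeal _).1 hx
      have hmem := Ideal.mem_map_of_mem (algebraMap (𝓞 F) (Sf.integer F)) hr
      rw [hβ] at hmem
      obtain ⟨s, hs⟩ := Submodule.mem_span_singleton.1 hmem
      have hs' : (s : F) * β = algebraMap (𝓞 F) F r := congrArg (fun t : Sf.integer F => (t : F)) hs
      rw [← hvx, ← hs', map_mul]
      exact (mul_le_mul_left (s.2 v hv) _).trans (one_mul _).le
  refine ⟨Units.mk0 ((β : F) / algebraMap (𝓞 F) F a) (div_ne_zero hβ0 ha'), fun v hv => ?_⟩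
  rw [hI, count_mul F v (spanSingleton_ne_zero_iff.2 (inv_ne_zero ha')) (coeIdeal_ne_zero.2 hJ),
    neg_add, WithZero.exp_add, ← hval v hv, ← valuation_eq_exp_neg_count v (inv_ne_zero ha'),
    ← map_mul, Units.val_mk0, div_eq_inv_mul]

theorem supportClass_surjective [IsDedekindDomain (Sf.integer F)]
    (htriv : Subsingleton (ClassGroup (Sf.integer F))) :
    Function.Surjective (supportClass Sf) := fun c => by
  obtain ⟨z, hz⟩ := QuotientGroup.mk'_surjective (principalSub F) c.toMul
  obtain ⟨α, hα⟩ := exists_valuation_eq_count_of_subsingleton htriv z.1.1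
  refine ⟨⟨Additive.ofMul z - Additive.ofMul ⟨principalHom F α, principalHom_mem α⟩,
    mem_supportedDom_iff.2 fun v hv => ?_⟩, ?_⟩
  · have h := hα v hv
    rw [countHom_principal, WithZero.exp_inj, neg_inj] at h
    rw [map_sub, h]
    exact sub_self _
  · have h1 : (QuotientGroup.mk' (principalSub F)) ⟨principalHom F α, principalHom_mem α⟩ = 1 :=
      (QuotientGroup.eq_one_iff _).2 ⟨α, rfl⟩
    change Additive.ofMul ((QuotientGroup.mk' (principalSub F))
      (z / ⟨principalHom F α, principalHom_mem α⟩)) = c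
    rw [map_div, h1, _root_.div_one, hz]
    rfl

variable {K : Type} [Field K] [CharZero K] [Algebra K F]

/-- `y` is the image of the divisor `z` under a field automorphism. -/
def IsConjDivisor (s : F ≃ₐ[K] F) (z y : Additive (picDom F)) : Prop :=
  ((((y.toMul.1.1 : FractionalIdeal (𝓞 F)⁰ F) : Submodule (𝓞 F) F) : Set F) =
    s '' (((z.toMul.1.1 : FractionalIdeal (𝓞 F)⁰ F) : Submodule (𝓞 F) F) : Set F)) ∧
  ((y.toMul.1.2 : FReal F) = galFReal K s (z.toMul.1.2 : FReal F))

theorem IsConjDivisor.count {s : F ≃ₐ[K] F} {z y : Additive (picDom F)}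
    (h : IsConjDivisor s z y) (v : HeightOneSpectrum (𝓞 F)) :
    countHom (conjPrime s.toRingEquiv v) y = countHom v z :=
  count_conjPrime s.toRingEquiv v (Units.ne_zero _) (Units.ne_zero _) h.1

theorem IsConjDivisor.ext_arch {s : F ≃ₐ[K] F} {z y : Additive (picDom F)}
    (h : IsConjDivisor s z y) (φ : F →+* ℂ) :
    FReal.ext φ (((archHom F y).toMul : (FReal F)ˣ) : FReal F) =
      FReal.ext (φ.comp (s : F →+* F)) (((archHom F z).toMul : (FReal F)ˣ) : FReal F) := by
  refine (congrArg (FReal.ext φ) h.2).trans ?_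
  exact FReal.ext_galFReal s φ _

end SupportedClasses

/-- A homomorphism into a divisible group factors through any homomorphism with smaller kernel. -/
theorem AddMonoidHom.exists_comp_eq_of_ker_le {A B D : Type*} [AddCommGroup A] [AddCommGroup B]
    [AddCommGroup D] [DivisibleBy D ℤ] (f : A →+ B) (g : A →+ D) (h : f.ker ≤ g.ker) :
    ∃ l : B →+ D, ∀ a, l (f a) = g a := by
  obtain ⟨l, hl⟩ := (Module.Baer.of_divisible D).extension_property_addMonoidHom
    (QuotientAddGroup.kerLift f) (QuotientAddGroup.kerLift_injective f)
    (QuotientAddGroup.lift f.ker g h)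
  exact ⟨l, fun a => DFunLike.congr_fun hl (a : A ⧸ f.ker)⟩

/-- A homomorphism factors through any surjective homomorphism with smaller kernel. -/
theorem AddMonoidHom.exists_comp_eq_of_surjective {A B D : Type*} [AddCommGroup A] [AddCommGroup B]
    [AddCommGroup D] (f : A →+ B) (hf : Function.Surjective f) (g : A →+ D)
    (h : ∀ a, f a = 0 → g a = 0) : ∃ l : B →+ D, ∀ a, l (f a) = g a := by
  refine ⟨f.liftOfRightInverse _ (Function.rightInverse_surjInv hf) ⟨g, h⟩, fun a => ?_⟩
  exact AddMonoidHom.liftOfRightInverse_comp_apply _ _ _ _ a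

/-- An additive functional on a finite power of `ℤ` is a linear combination of coordinates. -/
theorem AddMonoidHom.apply_eq_sum_zsmul {ι A : Type*} [Fintype ι] [DecidableEq ι] [AddCommGroup A]
    (l : (ι → ℤ) →+ A) (n : ι → ℤ) : l n = ∑ i, n i • l (Pi.single i 1) := by
  conv_lhs => rw [← Finset.univ_sum_single n, map_sum]
  refine Finset.sum_congr rfl fun i _ => ?_
  rw [← map_zsmul, ← Pi.single_smul, smul_eq_mul, mul_one]

section UnitLattice

open NumberField.Units NumberField.Units.dirichletUnitTheorem

variable {F : Type} [Field F] [NumberField F]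

theorem exists_eq_sum_mul_log (k : Additive (𝓞 F)ˣ →+ ℝ) :
    ∃ a : InfinitePlace F → ℝ, ∀ ε : (𝓞 F)ˣ,
      k (Additive.ofMul ε) = ∑ w, a w * Real.log (w ((ε : 𝓞 F) : F)) := by
  classical
  obtain ⟨l, hl⟩ := (logEmbedding F).exists_comp_eq_of_ker_le k (by
    rw [logEmbedding_ker]
    intro x hx
    obtain ⟨n, hn, hx⟩ := (isOfFinOrder_iff_pow_eq_one (x := x.toMul)).1 hx
    have h1 : n • k x = 0 := by
      rw [← map_nsmul]
      exact (congrArg k (congrArg Additive.ofMul hx)).trans (map_zero k)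
    exact (smul_eq_zero.1 h1).resolve_left hn.ne')
  let e : Module.Basis _ ℝ (logSpace F) :=
    (basisUnitLattice F).ofZLatticeBasis ℝ (unitLattice F)
  let L : logSpace F →ₗ[ℝ] ℝ := e.constr ℝ fun i => l (basisUnitLattice F i)
  have hL : ∀ x : unitLattice F, L x = l x := by
    have : (L.restrictScalars ℤ).comp (unitLattice F).subtype =
        l.toIntLinearMap.comp (unitLattice F).subtype := by
      refine (basisUnitLattice F).ext fun i => ?_
      change L (basisUnitLattice F i : logSpace F) = l (basisUnitLattice F i)
      rw [← (basisUnitLattice F).ofZLatticeBasis_apply ℝ (unitLattice F) i]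
      exact (e.constr_basis ℝ _ i).trans
        (congrArg l ((basisUnitLattice F).ofZLatticeBasis_apply ℝ (unitLattice F) i).symm)
    exact fun x => LinearMap.congr_fun this x
  refine ⟨fun w => if h : w ≠ w₀ then w.mult * L (Pi.single ⟨w, h⟩ 1) else 0, fun ε => ?_⟩
  have hmem : logEmbedding F (Additive.ofMul ε) ∈ unitLattice F := ⟨Additive.ofMul ε, trivial, rfl⟩
  rw [← hl, ← hL ⟨_, hmem⟩, LinearMap.pi_apply_eq_sum_univ,
    Fintype.sum_eq_add_sum_subtype_ne _ w₀]
  beta_reduce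
  rw [dif_neg (by simp), zero_mul, zero_add]
  refine Finset.sum_congr rfl fun w _ => ?_
  rw [dif_pos w.2]
  change logEmbedding F (Additive.ofMul ε) w • L _ = _
  rw [logEmbedding_component, smul_eq_mul, mul_right_comm]
  congr 3
  funext v
  simp [Pi.single_apply, eq_comm]

theorem sum_mul_eq_zero_of_forall_unit {a : InfinitePlace F → ℝ}
    (ha : ∀ ε : (𝓞 F)ˣ, ∑ w, a w * Real.log (w ((ε : 𝓞 F) : F)) = 0)
    {y : InfinitePlace F → ℝ} (hy : ∑ w : InfinitePlace F, (w.mult : ℝ) * y w = 0) :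
    ∑ w, a w * y w = 0 := by
  classical
  have hm : ∀ w : InfinitePlace F, (w.mult : ℝ) ≠ 0 := fun w => Nat.cast_ne_zero.2 w.mult_pos.ne'
  let c : InfinitePlace F → ℝ := fun w => a w / w.mult - a w₀ / (w₀ : InfinitePlace F).mult
  have hc : ∀ y : InfinitePlace F → ℝ, ∑ w : InfinitePlace F, (w.mult : ℝ) * y w = 0 →
      ∑ w, a w * y w = ∑ w : {w : InfinitePlace F // w ≠ w₀}, c w * (w.1.mult * y w) := by
    intro y hy
    have h1 : ∑ w, c w * (w.mult * y w) = ∑ w, a w * y w := by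
      have : ∀ w, c w * (w.mult * y w) =
          a w * y w - a w₀ / (w₀ : InfinitePlace F).mult * (w.mult * y w) := fun w => by
        simp only [c]
        have := hm w
        field_simp
      simp only [this, Finset.sum_sub_distrib, ← Finset.mul_sum, hy, mul_zero, sub_zero]
    rw [← h1, Fintype.sum_eq_add_sum_subtype_ne _ w₀]
    simp [c]
  let C : logSpace F →ₗ[ℝ] ℝ := ∑ w, (c w.1) • LinearMap.proj w
  have hC : ∀ v, C v = ∑ w, c w.1 * v w := fun v => by simp [C]
  have hC0 : C = 0 := by
    have : (⊤ : Submodule ℝ (logSpace F)) ≤ LinearMap.ker C := by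
      rw [← unitLattice_span_eq_top, Submodule.span_le]
      rintro _ ⟨ε, -, rfl⟩
      change C (logEmbedding F ε) = 0
      rw [hC, ← ha ε.toMul, hc _ (sum_mult_mul_log _)]
      rfl
    exact LinearMap.ext fun v => this trivial
  rw [hc y hy]
  exact (hC fun w => w.1.mult * y w).symm.trans (by rw [hC0]; rfl)

end UnitLattice

noncomputable section SUnits

open IsDedekindDomain FractionalIdeal

variable {F : Type} [Field F] [NumberField F] {Sf : Set (HeightOneSpectrum (𝓞 F))}

theorem radialChar_unitDivisor (a : InfinitePlace F → ℝ) (u : Additive (Sf.unit F)) :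
    FReal.radialChar a (supportArch Sf (unitDivisor Sf u)) =
      ∑ w, a w * Real.log (w ((u.toMul : Fˣ) : F)) := by
  rw [FReal.radialChar_apply]
  refine Finset.sum_congr rfl fun w _ => ?_
  rw [← InfinitePlace.norm_embedding_eq, ← ext_supportArch_unitDivisor]
  rfl

variable (Sf) in
/-- Units of the ring of integers as `S`-units. -/
def integralUnit : Additive (𝓞 F)ˣ →+ Additive (Sf.unit F) :=
  AddMonoidHom.mk' (fun ε => Additive.ofMul ⟨Units.map (algebraMap (𝓞 F) F) ε.toMul, fun v _ => by
    refine le_antisymm (v.valuation_le_one _) ?_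
    rw [← (v.valuation F).map_one, ← map_one (algebraMap (𝓞 F) F), ← ε.toMul.mul_inv, map_mul,
      map_mul]
    exact (mul_le_mul_right (v.valuation_le_one _) _).trans (mul_one _).le⟩) fun ε δ =>
      congrArg Additive.ofMul (Subtype.ext (map_mul (Units.map _) ε.toMul δ.toMul))

theorem supportVec_unitDivisor_eq_zero_iff (u : Additive (Sf.unit F)) :
    supportVec Sf (unitDivisor Sf u) = 0 ↔ ∃ ε, integralUnit Sf ε = u := by
  have key : supportVec Sf (unitDivisor Sf u) = 0 ↔ ∀ v : HeightOneSpectrum (𝓞 F),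
      v.valuation F ((u.toMul : Fˣ) : F) = 1 := by
    constructor
    · intro h v
      by_cases hv : v ∈ Sf
      · rw [valuation_eq_supportVec ⟨v, hv⟩, h]
        rfl
      · exact u.toMul.2 v hv
    · intro h
      funext p
      have := h p.1
      rw [valuation_eq_supportVec p, ← WithZero.exp_zero, WithZero.exp_inj, neg_eq_zero] at this
      exact this
  rw [key]
  constructor
  · intro h
    obtain ⟨x, hx⟩ := HeightOneSpectrum.mem_integers_of_valuation_le_one F
      ((u.toMul : Fˣ) : F) fun v => (h v).le
    obtain ⟨y, hy⟩ := HeightOneSpectrum.mem_integers_of_valuation_le_one F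
      ((u.toMul : Fˣ) : F)⁻¹ fun v => by rw [map_inv₀, h v, inv_one]
    have hxy : x * y = 1 := RingOfIntegers.coe_injective (by
      rw [map_mul, map_one, hx, hy, mul_inv_cancel₀ (Units.ne_zero _)])
    exact ⟨Additive.ofMul ⟨x, y, hxy, (mul_comm _ _).trans hxy⟩,
      congrArg Additive.ofMul (Subtype.ext (Units.ext hx))⟩
  · rintro ⟨ε, rfl⟩ v
    refine le_antisymm (v.valuation_le_one _) ?_
    rw [← (v.valuation F).map_one, ← map_one (algebraMap (𝓞 F) F), ← ε.toMul.mul_inv, map_mul,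
      map_mul]
    exact (mul_le_mul_right (v.valuation_le_one _) _).trans (mul_one _).le

theorem exists_nsmul_supportVec_eq : ∃ n : ℕ, n ≠ 0 ∧ ∀ z : supportedDom Sf,
    ∃ u, supportVec Sf (unitDivisor Sf u) = n • supportVec Sf z := by
  refine ⟨Fintype.card (ClassGroup (𝓞 F)), Fintype.card_ne_zero, fun z => ?_⟩
  obtain ⟨α, hα⟩ := (isPrincipal_iff _).1 ((ClassGroup.mk_eq_one_iff (K := F)
    (I := z.1.toMul.1.1 ^ Fintype.card (ClassGroup (𝓞 F)))).1 (by
      rw [map_pow, pow_card_eq_one]))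
  have hα0 : α ≠ 0 := by
    rintro rfl
    rw [spanSingleton_zero] at hα
    exact Units.ne_zero _ hα
  have hcount : ∀ v : HeightOneSpectrum (𝓞 F), v.valuation F α =
      WithZero.exp (-(Fintype.card (ClassGroup (𝓞 F)) • countHom v z.1)) := fun v => by
    rw [valuation_eq_exp_neg_count v hα0, ← hα, Units.val_pow_eq_pow_val, count_pow, nsmul_eq_mul]
    rfl
  refine ⟨Additive.ofMul ⟨Units.mk0 α hα0, fun v hv => ?_⟩, funext fun p => ?_⟩
  · refine (hcount v).trans ?_
    rw [mem_supportedDom_iff.1 z.2 v hv, smul_zero, neg_zero, WithZero.exp_zero]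
  · exact neg_injective (WithZero.exp_injective ((valuation_eq_supportVec p _).symm.trans
      (hcount p.1)))

instance finite_sUnit [Finite Sf] : Module.Finite ℤ (Additive (Sf.unit F)) := by
  let f : Additive (Sf.unit F) →ₗ[ℤ] (Sf → ℤ) :=
    ((supportVec Sf).comp (unitDivisor Sf)).toIntLinearMap
  refine ⟨Submodule.fg_of_fg_map_of_fg_inf_ker f (IsNoetherian.noetherian _) ?_⟩
  have : (⊤ : Submodule ℤ (Additive (Sf.unit F))) ⊓ LinearMap.ker f =
      LinearMap.range (integralUnit Sf).toIntLinearMap := by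
    ext u
    rw [top_inf_eq]
    exact supportVec_unitDivisor_eq_zero_iff u
  rw [this, LinearMap.range_eq_map]
  exact Module.Finite.fg_top.map _

variable [Fintype Sf]

/-- The real character of supported divisors with given coefficients at the places in `S`. -/
def realChar (a : InfinitePlace F → ℝ) (b : Sf → ℝ) : supportedDom Sf →+ ℝ :=
  (FReal.radialChar a).comp (supportArch Sf) +
    ∑ p, (AddMonoidHom.mulLeft (b p)).comp ((Int.castAddHom ℝ).comp
      ((Pi.evalAddMonoidHom (fun _ => ℤ) p).comp (supportVec Sf)))

theorem realChar_apply (a : InfinitePlace F → ℝ) (b : Sf → ℝ) (z : supportedDom Sf) :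
    realChar a b z = FReal.radialChar a (supportArch Sf z) +
      ∑ p, b p * (supportVec Sf z p : ℝ) := by
  simp [realChar]

theorem realChar_of_supportVec_eq_zero (a : InfinitePlace F → ℝ) (b : Sf → ℝ)
    {z : supportedDom Sf} (hz : supportVec Sf z = 0) :
    realChar a b z = FReal.radialChar a (supportArch Sf z) := by
  simp [realChar_apply, hz]

theorem realChar_eq_zero_of_forall_unit {a : InfinitePlace F → ℝ} {b : Sf → ℝ}
    (h : ∀ u, realChar a b (unitDivisor Sf u) = 0) (z : supportedDom Sf) :
    realChar a b z = 0 := by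
  have h0 : ∀ z : supportedDom Sf, supportVec Sf z = 0 → realChar a b z = 0 := fun z hz => by
    rw [realChar_of_supportVec_eq_zero a b hz, FReal.radialChar_apply]
    refine sum_mul_eq_zero_of_forall_unit (fun ε => ?_) ?_
    · rw [← h (integralUnit Sf (Additive.ofMul ε)), realChar_of_supportVec_eq_zero a b
        ((supportVec_unitDivisor_eq_zero_iff _).2 ⟨_, rfl⟩), radialChar_unitDivisor]
      rfl
    · rw [← FReal.radialChar_apply (fun w => (w.mult : ℝ))]
      exact radialChar_mult_of_supportVec_eq_zero hz
  obtain ⟨n, hn, hu⟩ := exists_nsmul_supportVec_eq (Sf := Sf)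
  obtain ⟨u, hu⟩ := hu z
  have := h0 (n • z - unitDivisor Sf u) (by rw [map_sub, map_nsmul, hu, sub_self])
  rw [map_sub, map_nsmul, h u, sub_zero] at this
  exact (smul_eq_zero.1 this).resolve_left hn

theorem exists_realChar_unitDivisor_eq (h : Additive (Sf.unit F) →+ ℝ) :
    ∃ (a : InfinitePlace F → ℝ) (b : Sf → ℝ), ∀ u, realChar a b (unitDivisor Sf u) = h u := by
  classical
  obtain ⟨a, ha⟩ := exists_eq_sum_mul_log (h.comp (integralUnit Sf))
  obtain ⟨l, hl⟩ := ((supportVec Sf).comp (unitDivisor Sf)).exists_comp_eq_of_ker_le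
    (h - (FReal.radialChar a).comp ((supportArch Sf).comp (unitDivisor Sf))) (by
      intro u hu
      obtain ⟨ε, rfl⟩ := (supportVec_unitDivisor_eq_zero_iff u).1 hu
      refine sub_eq_zero.2 ((ha ε.toMul).trans ?_)
      exact (radialChar_unitDivisor a (integralUnit Sf ε)).symm)
  refine ⟨a, fun p => l (Pi.single p 1), fun u => ?_⟩
  have h2 : l (supportVec Sf (unitDivisor Sf u)) =
      h u - FReal.radialChar a (supportArch Sf (unitDivisor Sf u)) := hl u
  rw [l.apply_eq_sum_zsmul] at h2
  rw [realChar_apply, ← sub_add_cancel (h u) (FReal.radialChar a _), ← h2, add_comm]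
  congr 1
  exact Finset.sum_congr rfl fun p _ => by rw [zsmul_eq_mul, mul_comm]

end SUnits

noncomputable section FullCharacters

open IsDedekindDomain FractionalIdeal

theorem continuous_argHom : Continuous fun z : ℂˣ => argHom (Additive.ofMul z) := by
  have h1 : Continuous fun z : ℂˣ => ((Complex.arg (z : ℂ) : ℝ) : Real.Angle) :=
    continuous_iff_continuousAt.2 fun z =>
      (Complex.continuousAt_arg_coe_angle z.ne_zero).comp Units.continuous_val.continuousAt
  exact (AddCircle.homeomorphAddCircle (2 * Real.pi) 1 Real.two_pi_pos.ne' one_ne_zero).continuous.comp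
    h1

theorem AddCircle.zsmul_coe_eq_zero {k : ℤ} (h : ∀ t : ℝ, k • (t : AddCircle (1 : ℝ)) = 0) :
    k = 0 := by
  by_contra hk
  have hk' : (k : ℝ) ≠ 0 := Int.cast_ne_zero.2 hk
  have := h (1 / 2 / k)
  rw [← AddCircle.coe_zsmul, zsmul_eq_mul, mul_div_cancel₀ _ hk', AddCircle.coe_eq_zero_iff] at this
  obtain ⟨n, hn⟩ := this
  have h2 : ((2 * n : ℤ) : ℝ) = (1 : ℤ) := by
    rw [zsmul_eq_mul] at hn
    push_cast
    linarith
  have := Int.cast_injective h2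
  omega

theorem AddCircle.zsmul_half_eq_zero_iff {k : ℤ} :
    k • ((1 / 2 : ℝ) : AddCircle (1 : ℝ)) = 0 ↔ ∃ n, k = n * 2 := by
  rw [← AddCircle.coe_zsmul, AddCircle.coe_eq_zero_iff]
  refine exists_congr fun n => ?_
  rw [zsmul_eq_mul, zsmul_eq_mul, mul_one, mul_one_div, eq_div_iff two_ne_zero]
  exact ⟨fun h => by exact_mod_cast h.symm, fun h => by exact_mod_cast h.symm⟩

theorem eq_zero_of_forall_mul_mem_zmultiples {c : ℝ} (h : ∀ t : ℝ, ((t * c : ℝ) : AddCircle (1 : ℝ)) = 0) :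
    c = 0 := by
  by_contra hc
  have := h (1 / 2 / c)
  rw [div_mul_cancel₀ _ hc, ← one_zsmul ((1 / 2 : ℝ) : AddCircle (1 : ℝ)),
    AddCircle.zsmul_half_eq_zero_iff] at this
  omega

variable {F : Type} [Field F]

open scoped Classical in
/-- The winding numbers of the trivial unitary character attached to integers at the infinite
places. -/
def trivialWinding (f : InfinitePlace F → ℤ) (φ : F →+* ℂ) : ℤ :=
  f (InfinitePlace.mk φ) * if ComplexEmbedding.IsReal φ then 2 else 1

theorem trivialWinding_injective : Function.Injective (trivialWinding (F := F)) := fun f g h => by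
  funext w
  have := congrFun h w.embedding
  simp only [trivialWinding, InfinitePlace.mk_embedding] at this
  refine mul_right_cancel₀ ?_ this
  split_ifs <;> norm_num

variable [NumberField F]

theorem FReal.continuous_argAt (φ : F →+* ℂ) :
    Continuous fun x : (FReal F)ˣ => FReal.argAt φ (Additive.ofMul x) :=
  continuous_argHom.comp (Continuous.units_map _ (FReal.continuous_ext φ))

theorem FReal.continuous_angularChar (m : (F →+* ℂ) → ℤ) :
    Continuous fun x : (FReal F)ˣ => FReal.angularChar m (Additive.ofMul x) := by
  simp only [FReal.angularChar_apply]
  exact continuous_finsetSum _ fun φ _ => (FReal.continuous_argAt φ).zsmul _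

theorem FReal.continuous_radialChar (a : InfinitePlace F → ℝ) :
    Continuous fun x : (FReal F)ˣ => FReal.radialChar a (Additive.ofMul x) := by
  simp only [FReal.radialChar_apply]
  exact continuous_finsetSum _ fun w _ => continuous_const.mul (FReal.continuous_logHom w)

theorem FReal.angularChar_eq_zero_iff (m : (F →+* ℂ) → ℤ) :
    FReal.angularChar m = 0 ↔ ∃ f, trivialWinding f = m := by
  constructor
  · intro h
    have hc : ∀ w : {w : InfinitePlace F // w.IsComplex},
        m w.1.embedding = m (ComplexEmbedding.conjugate w.1.embedding) := fun w =>
      sub_eq_zero.1 (AddCircle.zsmul_coe_eq_zero fun t => by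
        rw [← FReal.angularChar_angular, h]; rfl)
    have hr : ∀ w : InfinitePlace F, ∃ n : ℤ, w.IsReal → m w.embedding = n * 2 := fun w => by
      by_cases hw : w.IsReal
      · obtain ⟨n, hn⟩ := AddCircle.zsmul_half_eq_zero_iff.1
          ((FReal.angularChar_sign m hw).symm.trans (by rw [h]; rfl))
        exact ⟨n, fun _ => hn⟩
      · exact ⟨0, fun hw' => absurd hw' hw⟩
    choose n hn using hr
    classical
    refine ⟨fun w => if w.IsReal then n w else m w.embedding, funext fun φ => ?_⟩
    simp only [trivialWinding]
    by_cases hφ : ComplexEmbedding.IsReal φ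
    · have hw : (InfinitePlace.mk φ).IsReal := ⟨φ, hφ, rfl⟩
      rw [if_pos hw, if_pos hφ, ← hn _ hw, InfinitePlace.embedding_mk_eq_of_isReal hφ]
    · have hw : ¬ (InfinitePlace.mk φ).IsReal := fun hw => hφ (InfinitePlace.isReal_mk_iff.1 hw)
      rw [if_neg hw, if_neg hφ, mul_one]
      rcases InfinitePlace.embedding_mk_eq φ with h' | h'
      · rw [h']
      · have := hc ⟨_, InfinitePlace.not_isReal_iff_isComplex.1 hw⟩
        rw [this, h']
        exact congrArg m (star_star φ)
  · rintro ⟨f, rfl⟩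
    refine FReal.unitHom_ext (fun y => FReal.angularChar_radial _ y) (fun w t => ?_)
      fun w hw => ?_
    · rw [FReal.angularChar_angular, trivialWinding, trivialWinding, InfinitePlace.mk_conjugate_eq,
        ComplexEmbedding.isReal_conjugate_iff, sub_self, zero_smul]
      rfl
    · rw [FReal.angularChar_sign _ hw, AddMonoidHom.zero_apply, AddCircle.zsmul_half_eq_zero_iff]
      exact ⟨f w, by rw [trivialWinding, InfinitePlace.mk_embedding,
        if_pos (InfinitePlace.isReal_iff.1 hw)]⟩

variable {Sf : Set (HeightOneSpectrum (𝓞 F))} [Fintype Sf]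

/-- The character of supported divisors with given winding numbers and real coefficients. -/
def fullChar (m : (F →+* ℂ) → ℤ) (a : InfinitePlace F → ℝ) (b : Sf → ℝ) :
    supportedDom Sf →+ AddCircle (1 : ℝ) :=
  (FReal.angularChar m).comp (supportArch Sf) +
    (QuotientAddGroup.mk' (AddSubgroup.zmultiples (1 : ℝ))).comp (realChar a b)

theorem fullChar_apply (m : (F →+* ℂ) → ℤ) (a : InfinitePlace F → ℝ) (b : Sf → ℝ)
    (z : supportedDom Sf) : fullChar m a b z =
      FReal.angularChar m (supportArch Sf z) + (realChar a b z : AddCircle (1 : ℝ)) := rfl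

theorem eq_zero_of_fullChar_eq_zero {m : (F →+* ℂ) → ℤ} {a : InfinitePlace F → ℝ} {b : Sf → ℝ}
    (h : ∀ z, fullChar m a b z = 0) : ∃ (f : InfinitePlace F → ℤ) (n : Sf → ℤ),
      trivialWinding f = m ∧ ∀ z, realChar a b z = ∑ p, (n p : ℝ) * supportVec Sf z p := by
  classical
  have h1 : ∀ x, FReal.radialChar (fun w => (w.mult : ℝ)) x = 0 →
      FReal.angularChar m x + (FReal.radialChar a x : AddCircle (1 : ℝ)) = 0 := fun x hx => by
    obtain ⟨z, hz, -, rfl⟩ := exists_supportArch_eq Sf hx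
    rw [← h z, fullChar_apply, realChar_of_supportVec_eq_zero a b hz]
  have hm : FReal.angularChar m = 0 := by
    refine FReal.unitHom_ext (fun y => FReal.angularChar_radial _ y) (fun w t => ?_)
      fun w hw => ?_
    · have := h1 (FReal.angular w t) (FReal.radialChar_angular _ _ _)
      rwa [FReal.radialChar_angular, AddCircle.coe_zero, add_zero] at this
    · have := h1 (Additive.ofMul (FReal.sign w)) (FReal.radialChar_sign _ _)
      rwa [FReal.radialChar_sign, AddCircle.coe_zero, add_zero] at this
  obtain ⟨f, hf⟩ := (FReal.angularChar_eq_zero_iff m).1 hm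
  have h2 : ∀ z, (realChar a b z : AddCircle (1 : ℝ)) = 0 := fun z => by
    rw [← h z, fullChar_apply, hm, AddMonoidHom.zero_apply, zero_add]
  have h3 : ∀ z : supportedDom Sf, supportVec Sf z = 0 → realChar a b z = 0 := fun z hz => by
    refine eq_zero_of_forall_mul_mem_zmultiples fun t => ?_
    have hz' := radialChar_mult_of_supportVec_eq_zero hz
    have := h1 (FReal.radial fun w => t * FReal.logHom w (supportArch Sf z)) (by
      rw [FReal.radialChar_radial]
      simp only [mul_left_comm _ t, ← Finset.mul_sum]
      rw [← FReal.radialChar_apply (fun w => (w.mult : ℝ)), hz', mul_zero])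
    rw [hm, AddMonoidHom.zero_apply, zero_add, FReal.radialChar_radial] at this
    simp only [mul_left_comm _ t, ← Finset.mul_sum] at this
    rwa [← FReal.radialChar_apply a, ← realChar_of_supportVec_eq_zero a b hz] at this
  obtain ⟨l, hl⟩ := (supportVec Sf).exists_comp_eq_of_surjective supportVec_surjective _ h3
  have h4 : ∀ p, ∃ n : ℤ, (n : ℝ) = l (Pi.single p 1) := fun p => by
    obtain ⟨z, hz⟩ := supportVec_surjective (Sf := Sf) (Pi.single p 1)
    obtain ⟨n, hn⟩ := (AddCircle.coe_eq_zero_iff 1).1 (h2 z)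
    exact ⟨n, by rw [← hz, hl, ← hn, zsmul_eq_mul, mul_one]⟩
  choose n hn using h4
  refine ⟨f, n, hf, fun z => ?_⟩
  rw [← hl, l.apply_eq_sum_zsmul]
  exact Finset.sum_congr rfl fun p _ => by rw [zsmul_eq_mul, mul_comm, hn]

theorem fullChar_trivial (f : InfinitePlace F → ℤ) (n : Sf → ℤ) (z : supportedDom Sf) :
    fullChar (trivialWinding f) 0 (fun p => (n p : ℝ)) z = 0 := by
  rw [fullChar_apply, (FReal.angularChar_eq_zero_iff _).2 ⟨f, rfl⟩, AddMonoidHom.zero_apply,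
    zero_add, AddCircle.coe_eq_zero_iff]
  refine ⟨∑ p, n p * supportVec Sf z p, ?_⟩
  rw [realChar_apply, map_zero, AddMonoidHom.zero_apply, zero_add, zsmul_eq_mul, mul_one]
  push_cast
  rfl

/-- A character of the class group that is given by a full character on supported divisors is
continuous. -/
theorem continuous_of_fullChar (χ : Additive (PicTilde F) →+ AddCircle (1 : ℝ))
    {m : (F →+* ℂ) → ℤ} {a : InfinitePlace F → ℝ} {b : Sf → ℝ}
    (h : ∀ z, χ (supportClass Sf z) = fullChar m a b z) : Continuous χ := by
  have h0 : ∀ z : picDom F, z.1.1 = 1 → χ (Additive.ofMul (PicTilde.mk F z)) =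
      FReal.angularChar m (Additive.ofMul z.1.2) +
        (FReal.radialChar a (Additive.ofMul z.1.2) : AddCircle (1 : ℝ)) := fun z hz => by
    have hc : ∀ v, countHom v (Additive.ofMul z) = 0 := fun v => by
      refine Eq.trans ?_ (count_one F v)
      change count F v (z.1.1 : FractionalIdeal (𝓞 F)⁰ F) = _
      rw [hz, Units.val_one]
    let z' : supportedDom Sf := ⟨Additive.ofMul z, mem_supportedDom_iff.2 fun v _ => hc v⟩
    have hz' : supportVec Sf z' = 0 := funext fun p => hc p.1
    exact (h z').trans (by
      rw [fullChar_apply, realChar_of_supportVec_eq_zero a b hz']; rfl)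
  have hcont : Continuous fun z : picDom F => χ (Additive.ofMul (PicTilde.mk F z)) := by
    rw [continuous_iff_continuousAt]
    intro z₀
    have hopen : IsOpen {z : picDom F | z.1.1 = z₀.1.1} := by
      have : DiscreteTopology (IdealGroup F) := ⟨rfl⟩
      exact (isOpen_discrete {z₀.1.1}).preimage (continuous_fst.comp continuous_subtype_val)
    let α : (FReal F)ˣ → AddCircle (1 : ℝ) := fun x => FReal.angularChar m (Additive.ofMul x) +
      (FReal.radialChar a (Additive.ofMul x) : AddCircle (1 : ℝ))
    have hα : Continuous α := (FReal.continuous_angularChar m).add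
      ((AddCircle.continuous_mk' 1).comp (FReal.continuous_radialChar a))
    have hα' : Continuous fun z : picDom F =>
        χ (Additive.ofMul (PicTilde.mk F z₀)) + (α z.1.2 - α z₀.1.2) :=
      continuous_const.add ((hα.comp (continuous_snd.comp continuous_subtype_val)).sub
        continuous_const)
    refine hα'.continuousAt.congr (Filter.eventually_of_mem (hopen.mem_nhds rfl) fun z hz => ?_)
    have hdiv := h0 (z / z₀) (div_eq_one.2 hz)
    have hmk : Additive.ofMul (PicTilde.mk F (z / z₀)) =
        Additive.ofMul (PicTilde.mk F z) - Additive.ofMul (PicTilde.mk F z₀) := rfl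
    have hsnd : Additive.ofMul (z / z₀).1.2 = Additive.ofMul z.1.2 - Additive.ofMul z₀.1.2 := rfl
    rw [hmk, hsnd, map_sub, map_sub, map_sub, AddCircle.coe_sub, sub_eq_iff_eq_add'] at hdiv
    beta_reduce
    rw [hdiv]
    simp only [α]
    abel
  exact (isQuotientMap_quotient_mk' (s := QuotientGroup.leftRel (principalSub F))).continuous_iff.2
    hcont

end FullCharacters

noncomputable section CharacterPairs

open IsDedekindDomain FractionalIdeal

variable {F : Type} [Field F] [NumberField F]

variable (F) in
/-- The divisor with trivial ideal and given archimedean component, rescaled to norm one. -/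
def unitNormDivisor : Additive (FReal F)ˣ →+ Additive (picDom F) :=
  let r : Additive (FReal F)ˣ →+ Additive (FReal F)ˣ :=
    AddMonoidHom.id _ - FReal.radial.comp (AddMonoidHom.mk'
      (fun x => fun _ => FReal.radialChar (fun w => (w.mult : ℝ)) x /
        ∑ w : InfinitePlace F, (w.mult : ℝ)) fun x y => by
          funext w; simp only [map_add, add_div, Pi.add_apply])
  AddMonoidHom.mk' (fun x => Additive.ofMul ⟨(1, (r x).toMul), by
    rw [mem_picDom_iff, Units.val_one, map_one, Rat.cast_one, Real.log_one, ofMul_toMul]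
    simp only [r, AddMonoidHom.sub_apply, AddMonoidHom.id_apply, AddMonoidHom.comp_apply, map_sub,
      AddMonoidHom.mk'_apply, FReal.radialChar_radial]
    rw [← Finset.sum_mul, mul_div_cancel₀ _ sum_mult_pos.ne', sub_self]⟩) fun x y =>
      congrArg Additive.ofMul (Subtype.ext (Prod.ext (one_mul 1).symm
        (congrArg Additive.toMul (map_add r x y))))

theorem unitNormDivisor_snd (x : Additive (FReal F)ˣ) :
    Additive.ofMul (unitNormDivisor F x).toMul.1.2 = x - FReal.radial fun _ =>
      FReal.radialChar (fun w => (w.mult : ℝ)) x / ∑ w : InfinitePlace F, (w.mult : ℝ) := rfl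

theorem continuous_unitNormDivisor :
    Continuous fun x : (FReal F)ˣ => (unitNormDivisor F (Additive.ofMul x)).toMul := by
  refine Continuous.subtype_mk (continuous_const.prodMk ?_) _
  change Continuous fun x : (FReal F)ˣ => x / (FReal.radial fun _ =>
      FReal.radialChar (fun w => (w.mult : ℝ)) (Additive.ofMul x) /
        ∑ w : InfinitePlace F, (w.mult : ℝ)).toMul
  exact continuous_id.div' (FReal.continuous_radial.comp (continuous_pi fun _ =>
    (FReal.continuous_radialChar _).div_const _))

variable {Sf : Set (HeightOneSpectrum (𝓞 F))} [Fintype Sf]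

theorem exists_fullChar_eq (χ : Additive (PicTilde F) →+ AddCircle (1 : ℝ)) (hχ : Continuous χ) :
    ∃ (m : (F →+* ℂ) → ℤ) (a : InfinitePlace F → ℝ) (b : Sf → ℝ),
      ∀ z, χ (supportClass Sf z) = fullChar m a b z := by
  classical
  let π : Additive (picDom F) →+ Additive (PicTilde F) :=
    (QuotientGroup.mk' (principalSub F)).toAdditive
  have hπ : Continuous fun z : picDom F => PicTilde.mk F z :=
    (isQuotientMap_quotient_mk' (s := QuotientGroup.leftRel (principalSub F))).continuous
  obtain ⟨m, a, h⟩ := FReal.exists_eq_angularChar_add_radialChar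
    (χ.comp (π.comp (unitNormDivisor F))) (hχ.comp (hπ.comp continuous_unitNormDivisor))
  have h0 : ∀ z : supportedDom Sf, supportVec Sf z = 0 →
      χ (supportClass Sf z) = fullChar m a 0 z := fun z hz => by
    have hn : unitNormDivisor F (supportArch Sf z) = z.1 := by
      refine congrArg Additive.ofMul (Subtype.ext (Prod.ext
        (ideal_eq_one_of_supportVec_eq_zero hz).symm ?_))
      have := unitNormDivisor_snd (supportArch Sf z)
      rw [radialChar_mult_of_supportVec_eq_zero hz, zero_div] at this
      exact congrArg Additive.toMul (this.trans
        ((congrArg (supportArch Sf z - ·) (map_zero FReal.radial)).trans (sub_zero _)))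
    rw [fullChar_apply, realChar_of_supportVec_eq_zero _ _ hz, ← h]
    exact congrArg χ (congrArg π hn.symm)
  obtain ⟨l, hl⟩ := (supportVec Sf).exists_comp_eq_of_surjective supportVec_surjective
    (χ.comp (supportClass Sf) - fullChar m a 0) fun z hz => sub_eq_zero.2 (h0 z hz)
  have hb : ∀ p, ∃ t : ℝ, (t : AddCircle (1 : ℝ)) = l (Pi.single p 1) := fun p =>
    QuotientAddGroup.mk_surjective _
  choose b hb using hb
  refine ⟨m, a, b, fun z => ?_⟩
  have hz : l (supportVec Sf z) = χ (supportClass Sf z) - fullChar m a 0 z := hl z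
  rw [l.apply_eq_sum_zsmul] at hz
  rw [← sub_add_cancel (χ (supportClass Sf z)) (fullChar m a 0 z), ← hz, fullChar_apply,
    fullChar_apply, realChar_apply, realChar_apply]
  simp only [Pi.zero_apply, zero_mul, Finset.sum_const_zero, add_zero]
  rw [AddCircle.coe_add, add_comm, add_assoc]
  congr 2
  refine Eq.trans ?_ (map_sum (QuotientAddGroup.mk' (AddSubgroup.zmultiples (1 : ℝ))) _ _).symm
  refine Finset.sum_congr rfl fun p _ => ?_
  rw [← hb, ← AddCircle.coe_zsmul, zsmul_eq_mul, mul_comm]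
  rfl

variable (Sf) in
omit [Fintype Sf] in
/-- Pairs of winding numbers and real functionals on the `S`-units whose associated character
is trivial on the `S`-units. -/
def charPairs : AddSubgroup (((F →+* ℂ) → ℤ) × (Additive (Sf.unit F) →+ ℝ)) where
  carrier := {e | ∀ u, FReal.angularChar e.1 (supportArch Sf (unitDivisor Sf u)) +
    (e.2 u : AddCircle (1 : ℝ)) = 0}
  zero_mem' u := by
    refine (congrArg (· + _) (DFunLike.congr_fun (map_zero FReal.angularChar) _)).trans ?_
    exact zero_add _
  add_mem' {e e'} h h' u := by
    rw [Prod.fst_add, Prod.snd_add, map_add, AddMonoidHom.add_apply, AddMonoidHom.add_apply,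
      AddCircle.coe_add, add_add_add_comm, h u, h' u, add_zero]
  neg_mem' {e} h u := by
    rw [Prod.fst_neg, Prod.snd_neg, map_neg, AddMonoidHom.neg_apply, AddMonoidHom.neg_apply,
      AddCircle.coe_neg, ← neg_add, h u, neg_zero]

theorem exists_arTilde (hsurj : Function.Surjective (supportClass Sf)) (e : charPairs Sf) :
    ∃ χ : ArTilde F, ∀ a b, (∀ u, realChar a b (unitDivisor Sf u) = e.1.2 u) →
      ∀ z, χ (supportClass Sf z) = fullChar e.1.1 a b z := by
  obtain ⟨a, b, hab⟩ := exists_realChar_unitDivisor_eq e.1.2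
  have hker : ∀ z, supportClass Sf z = 0 → fullChar e.1.1 a b z = 0 := fun z hz => by
    obtain ⟨u, rfl⟩ := (supportClass_eq_zero_iff z).1 hz
    rw [fullChar_apply, hab]
    exact e.2 u
  obtain ⟨χ, hχ⟩ := (supportClass Sf).exists_comp_eq_of_surjective hsurj _ hker
  refine ⟨(⟨χ, continuous_of_fullChar χ hχ⟩ : ContinuousAddMonoidHom _ _), fun a' b' hab' z => ?_⟩
  refine (hχ z).trans ?_
  rw [fullChar_apply, fullChar_apply]
  have h1 : ∀ z, realChar (a - a') (b - b') z = realChar a b z - realChar a' b' z := fun z => by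
    simp only [realChar_apply, map_sub, AddMonoidHom.sub_apply, Pi.sub_apply, sub_mul,
      Finset.sum_sub_distrib]
    ring
  have := realChar_eq_zero_of_forall_unit (a := a - a') (b := b - b') (fun u => by
    rw [h1, hab, hab', sub_self]) z
  rw [h1, sub_eq_zero] at this
  rw [this]

end CharacterPairs

noncomputable section PairMaps

open IsDedekindDomain FractionalIdeal

variable {F : Type} [Field F] [NumberField F] {Sf : Set (HeightOneSpectrum (𝓞 F))}

theorem ArTilde.ext_supportClass (hsurj : Function.Surjective (supportClass Sf)) {χ χ' : ArTilde F}
    (h : ∀ z, χ (supportClass Sf z) = χ' (supportClass Sf z)) : χ = χ' := by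
  refine ContinuousAddMonoidHom.ext fun c => ?_
  obtain ⟨z, rfl⟩ := hsurj c
  exact h z

variable [Fintype Sf]

/-- The character of the oriented Arakelov class group attached to a compatible pair. -/
def pairChar (hsurj : Function.Surjective (supportClass Sf)) : charPairs Sf →+ ArTilde F :=
  AddMonoidHom.mk' (fun e => (exists_arTilde hsurj e).choose) fun e e' => by
    obtain ⟨a, b, h⟩ := exists_realChar_unitDivisor_eq e.1.2
    obtain ⟨a', b', h'⟩ := exists_realChar_unitDivisor_eq e'.1.2
    have hadd : ∀ z, realChar (a + a') (b + b') z = realChar a b z + realChar a' b' z := fun z => by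
      simp only [realChar_apply, map_add, AddMonoidHom.add_apply, Pi.add_apply, add_mul,
        Finset.sum_add_distrib]
      ring
    refine ArTilde.ext_supportClass hsurj fun z => ?_
    refine ((exists_arTilde hsurj (e + e')).choose_spec (a + a') (b + b')
      (fun u => by rw [hadd, h, h']; rfl) z).trans ?_
    refine Eq.trans ?_ (congrArg₂ (· + ·) ((exists_arTilde hsurj e).choose_spec a b h z)
      ((exists_arTilde hsurj e').choose_spec a' b' h' z)).symm
    simp only [fullChar_apply]
    rw [hadd, AddCircle.coe_add, add_add_add_comm]
    congr 1
    exact DFunLike.congr_fun (map_add FReal.angularChar e.1.1 e'.1.1) _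

variable (hsurj : Function.Surjective (supportClass Sf))

theorem pairChar_apply (e : charPairs Sf) {a : InfinitePlace F → ℝ} {b : Sf → ℝ}
    (h : ∀ u, realChar a b (unitDivisor Sf u) = e.1.2 u) (z : supportedDom Sf) :
    pairChar hsurj e (supportClass Sf z) = fullChar e.1.1 a b z :=
  (exists_arTilde hsurj e).choose_spec a b h z

theorem pairChar_surjective : Function.Surjective (pairChar hsurj) := fun χ => by
  let χ' : ContinuousAddMonoidHom (Additive (PicTilde F)) RmodZ := χ
  obtain ⟨m, a, b, h⟩ := exists_fullChar_eq (Sf := Sf) χ'.toAddMonoidHom χ'.continuous_toFun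
  refine ⟨⟨(m, (realChar a b).comp (unitDivisor Sf)), fun u => ?_⟩,
    ArTilde.ext_supportClass hsurj fun z => ?_⟩
  · refine (h (unitDivisor Sf u)).symm.trans ?_
    rw [(supportClass_eq_zero_iff _).2 ⟨u, rfl⟩, map_zero]
  · exact (pairChar_apply hsurj _ (fun _ => rfl) z).trans (h z).symm

theorem pairChar_eq_zero_iff (e : charPairs Sf) {a : InfinitePlace F → ℝ} {b : Sf → ℝ}
    (h : ∀ u, realChar a b (unitDivisor Sf u) = e.1.2 u) :
    pairChar hsurj e = 0 ↔ ∀ z, fullChar e.1.1 a b z = 0 := by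
  constructor
  · intro h0 z
    rw [← pairChar_apply hsurj e h, h0]
    rfl
  · intro h0
    refine ArTilde.ext_supportClass hsurj fun z => ?_
    rw [pairChar_apply hsurj e h, h0]
    rfl

/-- The compatible pair attached to an integral function on the places in `S`. -/
def placePair : (InfinitePlace F ⊕ Sf → ℤ) →+ charPairs Sf :=
  AddMonoidHom.mk' (fun f => ⟨(trivialWinding fun w => f (Sum.inl w),
    (realChar 0 fun p => (f (Sum.inr p) : ℝ)).comp (unitDivisor Sf)),
      fun u => fullChar_trivial (fun w => f (Sum.inl w)) (fun p => f (Sum.inr p)) _⟩) fun f g => by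
    refine Subtype.ext (Prod.ext (funext fun φ => add_mul _ _ _) (AddMonoidHom.ext fun u => ?_))
    change realChar _ _ _ = realChar _ _ _ + realChar _ _ _
    simp only [realChar_apply, Pi.add_apply, Int.cast_add, add_mul, Finset.sum_add_distrib,
      map_zero, AddMonoidHom.zero_apply, zero_add]

theorem coe_placePair_fst (f : InfinitePlace F ⊕ Sf → ℤ) :
    (placePair f).1.1 = trivialWinding fun w => f (Sum.inl w) := rfl

theorem placePair_snd_apply (f : InfinitePlace F ⊕ Sf → ℤ) (u : Additive (Sf.unit F)) :
    (placePair f).1.2 u = ∑ p, (f (Sum.inr p) : ℝ) * supportVec Sf (unitDivisor Sf u) p := by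
  change realChar _ _ _ = _
  rw [realChar_apply, map_zero, AddMonoidHom.zero_apply, zero_add]

theorem placePair_injective : Function.Injective (placePair (F := F) (Sf := Sf)) := by
  classical
  rw [injective_iff_map_eq_zero]
  intro f hf
  have h1 : (fun w => f (Sum.inl w)) = 0 := trivialWinding_injective <| by
    rw [← coe_placePair_fst, hf]
    exact funext fun φ => (zero_mul _).symm
  have h2 := realChar_eq_zero_of_forall_unit (a := 0) (b := fun p => (f (Sum.inr p) : ℝ)) (fun u => by
    refine Eq.trans (b := (placePair f).1.2 u) rfl ?_
    rw [hf]
    rfl)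
  funext s
  rcases s with w | p
  · exact congrFun h1 w
  · obtain ⟨z, hz⟩ := supportVec_surjective (Sf := Sf) (Pi.single p 1)
    have := h2 z
    rw [realChar_apply, map_zero, AddMonoidHom.zero_apply, zero_add, hz,
      Finset.sum_eq_single p (fun q _ hq => by rw [Pi.single_eq_of_ne hq, Int.cast_zero, mul_zero])
        (fun h => absurd (Finset.mem_univ p) h), Pi.single_eq_same, Int.cast_one, mul_one] at this
    exact Int.cast_eq_zero.1 this

theorem exact_placePair_pairChar : Function.Exact placePair (pairChar hsurj) := fun e => by
  constructor
  · intro he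
    obtain ⟨a, b, h⟩ := exists_realChar_unitDivisor_eq e.1.2
    obtain ⟨f, n, hf, hn⟩ := eq_zero_of_fullChar_eq_zero ((pairChar_eq_zero_iff hsurj e h).1 he)
    refine ⟨Sum.elim f n, Subtype.ext (Prod.ext hf (AddMonoidHom.ext fun u => ?_))⟩
    rw [placePair_snd_apply, ← h, hn]
    rfl
  · rintro ⟨f, rfl⟩
    refine (pairChar_eq_zero_iff hsurj (placePair f) (a := 0) (b := fun p => (f (Sum.inr p) : ℝ))
      fun u => rfl).2 fun z => ?_
    exact fullChar_trivial (fun w => f (Sum.inl w)) (fun p => f (Sum.inr p)) z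

end PairMaps

noncomputable section TorsionCharacters

/-- The inclusion of `ℚ/ℤ` in `ℝ/ℤ`. -/
def QmodZ.toCircle : QmodZ →+ AddCircle (1 : ℝ) :=
  QuotientAddGroup.map (Submodule.span ℤ {(1 : ℚ)}).toAddSubgroup
    (AddSubgroup.zmultiples (1 : ℝ)) (Rat.castHom ℝ).toAddMonoidHom (by
      intro x hx
      obtain ⟨n, rfl⟩ := Submodule.mem_span_singleton.1 hx
      exact ⟨n, by simp⟩)

theorem QmodZ.toCircle_mk (q : ℚ) :
    QmodZ.toCircle (Submodule.Quotient.mk q) = ((q : ℝ) : AddCircle (1 : ℝ)) := rfl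

theorem QmodZ.toCircle_injective : Function.Injective QmodZ.toCircle := by
  rw [injective_iff_map_eq_zero]
  intro x
  obtain ⟨q, rfl⟩ := Submodule.Quotient.mk_surjective _ x
  intro h
  rw [QmodZ.toCircle_mk, AddCircle.coe_eq_zero_iff] at h
  obtain ⟨n, hn⟩ := h
  rw [Submodule.Quotient.mk_eq_zero, Submodule.mem_span_singleton]
  refine ⟨n, Rat.cast_injective (α := ℝ) ?_⟩
  rw [← hn]
  simp

theorem AddCircle.exists_zsmul_one_div_of_nsmul_eq_zero {n : ℕ} (hn : n ≠ 0)
    {x : AddCircle (1 : ℝ)} (hx : n • x = 0) : ∃ k : ℤ, x = k • ((1 / n : ℝ) : AddCircle (1 : ℝ)) := by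
  obtain ⟨t, rfl⟩ := QuotientAddGroup.mk_surjective x
  have hn' : (n : ℝ) ≠ 0 := Nat.cast_ne_zero.2 hn
  obtain ⟨k, hk⟩ := (AddCircle.coe_eq_zero_iff 1).1 ((AddCircle.coe_nsmul 1).trans hx)
  refine ⟨k, ?_⟩
  rw [← AddCircle.coe_zsmul]
  congr 1
  rw [zsmul_eq_mul, nsmul_eq_mul] at *
  rw [mul_one_div, eq_div_iff hn', mul_comm, ← hk, mul_one]

theorem QmodZ.mem_range_toCircle {n : ℕ} (hn : n ≠ 0) {x : AddCircle (1 : ℝ)} (hx : n • x = 0) :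
    ∃ y, QmodZ.toCircle y = x := by
  obtain ⟨k, rfl⟩ := AddCircle.exists_zsmul_one_div_of_nsmul_eq_zero hn hx
  refine ⟨k • Submodule.Quotient.mk (1 / n : ℚ), ?_⟩
  rw [map_zsmul, QmodZ.toCircle_mk]
  push_cast
  rfl

/-- In `ℝ/ℤ` the `n`-torsion is generated by any element of order `n`. -/
theorem AddCircle.exists_zsmul_eq {x y : AddCircle (1 : ℝ)} (hx : addOrderOf x ≠ 0)
    (hy : addOrderOf x • y = 0) : ∃ k : ℤ, y = k • x := by
  obtain ⟨k, hk⟩ := AddCircle.exists_zsmul_one_div_of_nsmul_eq_zero hx hy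
  obtain ⟨m, -, hm, hmx⟩ := (AddCircle.addOrderOf_eq_pos_iff (p := (1 : ℝ))
    (Nat.pos_of_ne_zero hx)).1 (rfl : addOrderOf x = _)
  obtain ⟨a, b, hab⟩ := Nat.isCoprime_iff_coprime.2 hm
  have hn' : ((addOrderOf x : ℕ) : ℝ) ≠ 0 := Nat.cast_ne_zero.2 hx
  have hone : ((1 / addOrderOf x : ℝ) : AddCircle (1 : ℝ)) = a • x := by
    rw [← hmx, ← AddCircle.coe_zsmul, ← sub_eq_zero, ← AddCircle.coe_sub, AddCircle.coe_eq_zero_iff]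
    refine ⟨b, ?_⟩
    have : (a : ℝ) * m + b * (addOrderOf x : ℕ) = 1 := by exact_mod_cast hab
    rw [zsmul_eq_mul, zsmul_eq_mul, hmx]
    field_simp
    linarith
  exact ⟨k * a, by rw [hk, hone, mul_smul]⟩

variable {T : Type} [AddCommGroup T] [Finite T]

theorem QmodZ.comp_toCircle_bijective : Function.Bijective
    (AddMonoidHom.mk' (fun f : T →ₗ[ℤ] QmodZ => QmodZ.toCircle.comp f.toAddMonoidHom)
      fun f g => AddMonoidHom.ext fun t => map_add QmodZ.toCircle (f t) (g t)) := by
  constructor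
  · intro f g h
    exact LinearMap.ext fun t => QmodZ.toCircle_injective (DFunLike.congr_fun h t)
  · intro g
    have : ∀ t, ∃ y, QmodZ.toCircle y = g t := fun t =>
      QmodZ.mem_range_toCircle (addOrderOf_pos t).ne' (by
        rw [← map_nsmul, addOrderOf_nsmul_eq_zero, map_zero])
    choose y hy using this
    refine ⟨(AddMonoidHom.mk' y fun s t => QmodZ.toCircle_injective ?_).toIntLinearMap,
      AddMonoidHom.ext hy⟩
    rw [map_add, hy, hy, hy, map_add]

/-- Characters of a finite group with values in `ℚ/ℤ` and in `ℝ/ℤ` agree. -/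
def QmodZ.dualEquiv : (T →ₗ[ℤ] QmodZ) ≃+ (T →+ AddCircle (1 : ℝ)) :=
  AddEquiv.ofBijective _ QmodZ.comp_toCircle_bijective

theorem QmodZ.toCircle_dualEquiv_symm (g : T →+ AddCircle (1 : ℝ)) (t : T) :
    QmodZ.toCircle (QmodZ.dualEquiv.symm g t) = g t :=
  DFunLike.congr_fun (QmodZ.dualEquiv.apply_symm_apply g) t

/-- Every character of a finite cyclic group is a multiple of a faithful one. -/
theorem exists_zsmul_eq_of_injective [IsAddCyclic T] {χ : T →+ AddCircle (1 : ℝ)}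
    (hχ : Function.Injective χ) (g : T →+ AddCircle (1 : ℝ)) : ∃ k : ℤ, g = k • χ := by
  obtain ⟨t, ht⟩ := IsAddCyclic.exists_generator (α := T)
  have ho : addOrderOf (χ t) = addOrderOf t := addOrderOf_injective χ hχ t
  obtain ⟨k, hk⟩ := AddCircle.exists_zsmul_eq (x := χ t) (y := g t)
    (by rw [ho]; exact (addOrderOf_pos t).ne') (by
      rw [ho, ← map_nsmul, addOrderOf_nsmul_eq_zero, map_zero])
  refine ⟨k, AddMonoidHom.ext fun s => ?_⟩
  obtain ⟨n, rfl⟩ := AddSubgroup.mem_zmultiples_iff.1 (ht s)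
  rw [map_zsmul, hk, AddMonoidHom.zsmul_apply, map_zsmul, smul_comm]

end TorsionCharacters

noncomputable section WindingMaps

open IsDedekindDomain FractionalIdeal

variable {F : Type} [Field F] [NumberField F] {Sf : Set (HeightOneSpectrum (𝓞 F))}

/-- The unitary character of the `S`-units with given winding numbers. -/
def unitAngularChar (Sf : Set (HeightOneSpectrum (𝓞 F))) :
    ((F →+* ℂ) → ℤ) →+ Additive (Sf.unit F) →+ AddCircle (1 : ℝ) :=
  AddMonoidHom.mk' (fun m => (FReal.angularChar m).comp ((supportArch Sf).comp (unitDivisor Sf)))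
    fun m n => AddMonoidHom.ext fun _ => DFunLike.congr_fun (map_add FReal.angularChar m n) _

theorem mem_charPairs_iff {e : ((F →+* ℂ) → ℤ) × (Additive (Sf.unit F) →+ ℝ)} :
    e ∈ charPairs Sf ↔ ∀ u, unitAngularChar Sf e.1 u + (e.2 u : AddCircle (1 : ℝ)) = 0 := Iff.rfl

/-- The winding numbers of a compatible pair. -/
def pairWinding (Sf : Set (HeightOneSpectrum (𝓞 F))) : charPairs Sf →+ ((F →+* ℂ) → ℤ) :=
  (AddMonoidHom.fst _ _).comp (charPairs Sf).subtype

section Lattice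

variable {L : Type} [AddCommGroup L] (π : Additive (Sf.unit F) →+ L)

/-- The compatible pair without winding attached to an integral functional. -/
def latticePair : (L →ₗ[ℤ] ℤ) →+ charPairs Sf :=
  AddMonoidHom.mk' (fun k => ⟨(0, (Int.castAddHom ℝ).comp (k.toAddMonoidHom.comp π)), fun u => by
    refine (congrArg (· + _) (DFunLike.congr_fun (map_zero FReal.angularChar) _)).trans ?_
    rw [AddMonoidHom.zero_apply, zero_add, AddCircle.coe_eq_zero_iff]
    exact ⟨k (π u), by simp⟩⟩) fun k k' =>
      Subtype.ext (Prod.ext (zero_add 0).symm (AddMonoidHom.ext fun u => Int.cast_add _ _))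

theorem latticePair_snd_apply (k : L →ₗ[ℤ] ℤ) (u : Additive (Sf.unit F)) :
    (latticePair π k).1.2 u = (k (π u) : ℝ) := rfl

variable {π} (hπ : Function.Surjective π)

include hπ

theorem latticePair_injective : Function.Injective (latticePair π) := fun k k' h => by
  refine LinearMap.ext fun x => ?_
  obtain ⟨u, rfl⟩ := hπ x
  have := DFunLike.congr_fun (congrArg (fun e : charPairs Sf => e.1.2) h) u
  exact Int.cast_injective this

variable {T : Type} [AddCommGroup T] [Finite T] {ι : T →+ Additive (Sf.unit F)}
  (hιπ : Function.Exact ι π)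

include hιπ

theorem exact_latticePair_pairWinding : Function.Exact (latticePair π) (pairWinding Sf) := fun e => by
  constructor
  · intro he
    have h1 : ∀ u, ∃ n : ℤ, (n : ℝ) = e.1.2 u := fun u => by
      have h2 := mem_charPairs_iff.1 e.2 u
      rw [show e.1.1 = 0 from he, map_zero, AddMonoidHom.zero_apply, zero_add,
        AddCircle.coe_eq_zero_iff] at h2
      obtain ⟨n, hn⟩ := h2
      exact ⟨n, by rw [← hn, zsmul_eq_mul, mul_one]⟩
    choose n hn using h1
    let n' : Additive (Sf.unit F) →+ ℤ := AddMonoidHom.mk' n fun u v => Int.cast_injective (α := ℝ) (by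
      rw [Int.cast_add, hn, hn, hn, map_add])
    obtain ⟨l, hl⟩ := π.exists_comp_eq_of_surjective hπ n' fun u hu => by
      obtain ⟨t, rfl⟩ := (hιπ u).1 hu
      have : Nat.card T • n' (ι t) = 0 := by
        rw [← map_nsmul, ← map_nsmul, card_nsmul_eq_zero', map_zero, map_zero]
      exact (smul_eq_zero.1 this).resolve_left Nat.card_pos.ne'
    refine ⟨l.toIntLinearMap, Subtype.ext (Prod.ext (Eq.symm he) (AddMonoidHom.ext fun u => ?_))⟩
    rw [latticePair_snd_apply, ← hn]
    exact congrArg _ (hl u)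
  · rintro ⟨k, rfl⟩
    rfl

end Lattice

section Torsion

variable {T : Type} [AddCommGroup T] [Finite T] (ι : T →+ Additive (Sf.unit F))

/-- The restriction of the unitary character with given winding numbers to torsion units. -/
def torsionRestrict : ((F →+* ℂ) → ℤ) →+ (T →ₗ[ℤ] QmodZ) :=
  QmodZ.dualEquiv.symm.toAddMonoidHom.comp (AddMonoidHom.mk' (fun m => (unitAngularChar Sf m).comp ι)
    fun m n => AddMonoidHom.ext fun _ => DFunLike.congr_fun (map_add (unitAngularChar Sf) m n) _)

theorem toCircle_torsionRestrict (m : (F →+* ℂ) → ℤ) (t : T) :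
    QmodZ.toCircle (torsionRestrict ι m t) = unitAngularChar Sf m (ι t) :=
  QmodZ.toCircle_dualEquiv_symm _ _

theorem torsionRestrict_eq_iff (m : (F →+* ℂ) → ℤ) (f : T →ₗ[ℤ] QmodZ) :
    torsionRestrict ι m = f ↔ ∀ t, unitAngularChar Sf m (ι t) = QmodZ.toCircle (f t) := by
  simp_rw [← toCircle_torsionRestrict, QmodZ.toCircle_injective.eq_iff, LinearMap.ext_iff]

theorem exact_pairWinding_torsionRestrict {L : Type} [AddCommGroup L] [Module.Projective ℤ L]
    {π : Additive (Sf.unit F) →+ L} (hπ : Function.Surjective π) (hιπ : Function.Exact ι π) :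
    Function.Exact (pairWinding Sf) (torsionRestrict ι) := fun m => by
  rw [torsionRestrict_eq_iff]
  simp only [LinearMap.zero_apply, map_zero]
  constructor
  · intro h
    obtain ⟨l, hl⟩ := π.exists_comp_eq_of_surjective hπ (unitAngularChar Sf m) fun u hu => by
      obtain ⟨t, rfl⟩ := (hιπ u).1 hu
      exact h t
    obtain ⟨k, hk⟩ := Module.projective_lifting_property
      (QuotientAddGroup.mk' (AddSubgroup.zmultiples (1 : ℝ))).toIntLinearMap l.toIntLinearMap
      QuotientAddGroup.mk_surjective
    refine ⟨⟨(m, -(k.toAddMonoidHom.comp π)), mem_charPairs_iff.2 fun u => ?_⟩, rfl⟩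
    have h1 : ((k (π u) : ℝ) : AddCircle (1 : ℝ)) = l (π u) := LinearMap.congr_fun hk (π u)
    change unitAngularChar Sf m u + ((-(k (π u)) : ℝ) : AddCircle (1 : ℝ)) = 0
    rw [AddCircle.coe_neg, h1, hl, add_neg_cancel]
  · rintro ⟨e, rfl⟩ t
    have h1 := mem_charPairs_iff.1 e.2 (ι t)
    have h2 : Nat.card T • e.1.2 (ι t) = 0 := by
      rw [← map_nsmul, ← map_nsmul, card_nsmul_eq_zero', map_zero, map_zero]
    rwa [(smul_eq_zero.1 h2).resolve_left Nat.card_pos.ne', AddCircle.coe_zero, add_zero] at h1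

variable {ι} in
theorem torsionRestrict_surjective (hι : Function.Injective ι) :
    Function.Surjective (torsionRestrict ι) := fun f => by
  classical
  let j : Multiplicative T →* F := (Units.coeHom F).comp ((Sf.unit F).subtype.comp
    (AddMonoidHom.toMultiplicativeLeft ι))
  have hj : Function.Injective j := fun s t h => Multiplicative.toAdd.injective
    (hι (Additive.toMul.injective (Subtype.ext (Units.ext h))))
  have : IsCyclic (Multiplicative T) := isCyclic_of_injective_ringHom j hj
  have : IsAddCyclic T := isCyclic_multiplicative_iff.1 this
  obtain ⟨φ⟩ : Nonempty (F →+* ℂ) := inferInstance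
  have hχ : Function.Injective ((unitAngularChar Sf (Pi.single φ 1)).comp ι) := by
    rw [injective_iff_map_eq_zero]
    intro t ht
    set u : Fˣ := ((ι t).toMul : Fˣ) with hu
    have h1 : FReal.argAt φ (supportArch Sf (unitDivisor Sf (ι t))) = 0 := by
      rw [← ht]
      change _ = FReal.angularChar (Pi.single φ 1) (supportArch Sf (unitDivisor Sf (ι t)))
      rw [FReal.angularChar_apply, Finset.sum_eq_single φ
        (fun ψ _ hψ => by rw [Pi.single_eq_of_ne hψ, zero_smul])
        (fun h => absurd (Finset.mem_univ φ) h), Pi.single_eq_same, one_smul]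
    have h2 : Complex.arg (φ u) = 0 := by
      rw [hu, ← ext_supportArch_unitDivisor]
      exact (argHom_eq_zero_iff _).1 h1
    have h3 : φ u ^ Nat.card T = 1 := by
      have h4 : Nat.card T • ι t = 0 := by rw [← map_nsmul, card_nsmul_eq_zero', map_zero]
      have h5 : u ^ Nat.card T = 1 := congrArg Subtype.val (congrArg Additive.toMul h4)
      rw [← map_pow, ← Units.val_pow_eq_pow_val, h5, Units.val_one, map_one]
    have h6 : φ u = φ 1 := by
      rw [map_one, Complex.ext_norm_arg_iff, h2, norm_one, Complex.arg_one]
      exact ⟨Complex.norm_eq_one_of_pow_eq_one h3 Nat.card_pos.ne', rfl⟩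
    exact hι ((Subtype.ext (Units.ext (φ.injective h6)) : (ι t).toMul = 1).trans (map_zero ι).symm)
  obtain ⟨k, hk⟩ := exists_zsmul_eq_of_injective hχ (QmodZ.toCircle.comp f.toAddMonoidHom)
  refine ⟨k • Pi.single φ 1, (torsionRestrict_eq_iff ι _ f).2 fun t => ?_⟩
  rw [map_zsmul]
  exact (DFunLike.congr_fun hk t).symm

end Torsion

end WindingMaps

noncomputable section GaloisEquivariance

open IsDedekindDomain FractionalIdeal

variable {K F G : Type} [Field K] [Field F] [Algebra K F] [Group G]
  {Sf : Set (HeightOneSpectrum (𝓞 F))}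

section Embeddings

variable (iso : G ≃* (F ≃ₐ[K] F))

theorem embeddingComp_inv_comp (φ : F →+* ℂ) (g : G) :
    embeddingComp iso (embeddingComp iso φ g⁻¹) g = φ := by
  rw [← embeddingComp_mul, inv_mul_cancel, embeddingComp_one]

theorem embeddingComp_comp_inv (φ : F →+* ℂ) (g : G) :
    embeddingComp iso (embeddingComp iso φ g) g⁻¹ = φ := by
  rw [← embeddingComp_mul, mul_inv_cancel, embeddingComp_one]

theorem mk_embeddingComp (φ : F →+* ℂ) (g : G) :
    InfinitePlace.mk (embeddingComp iso φ g) = iso g⁻¹ • InfinitePlace.mk φ := by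
  rw [InfinitePlace.smul_mk, map_inv]
  rfl

theorem isReal_embeddingComp_iff (φ : F →+* ℂ) (g : G) :
    ComplexEmbedding.IsReal (embeddingComp iso φ g) ↔ ComplexEmbedding.IsReal φ := by
  have h : ∀ (ψ : F →+* ℂ) (k : G), ComplexEmbedding.IsReal ψ →
      ComplexEmbedding.IsReal (embeddingComp iso ψ k) := fun ψ k hψ => by
    rw [ComplexEmbedding.isReal_iff] at hψ ⊢
    ext x
    exact RingHom.congr_fun hψ (iso k x)
  exact ⟨fun h1 => embeddingComp_comp_inv iso φ g ▸ h _ g⁻¹ h1, h φ g⟩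

theorem embeddingAction_trivialWinding (f : InfinitePlace F → ℤ) (g : G) :
    embeddingAction iso g (trivialWinding f) = trivialWinding fun w => f (iso g⁻¹ • w) := by
  classical
  funext φ
  rw [embeddingAction_apply, trivialWinding, trivialWinding, mk_embeddingComp]
  exact congrArg _ (if_congr (isReal_embeddingComp_iff iso φ g) rfl rfl)

variable [NumberField F]

theorem FReal.angularChar_of_ext_eq {x y : Additive (FReal F)ˣ} {g : G}
    (h : ∀ φ, FReal.ext φ (y.toMul : FReal F) =
      FReal.ext (embeddingComp iso φ g⁻¹) (x.toMul : FReal F)) (m : (F →+* ℂ) → ℤ) :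
    FReal.angularChar m y = FReal.angularChar (embeddingAction iso g m) x := by
  rw [FReal.angularChar_apply, FReal.angularChar_apply]
  refine Fintype.sum_equiv ⟨fun φ => embeddingComp iso φ g⁻¹, fun φ => embeddingComp iso φ g,
    fun φ => embeddingComp_inv_comp iso φ g, fun φ => embeddingComp_comp_inv iso φ g⟩ _ _ fun φ => ?_
  change _ = embeddingAction iso g m (embeddingComp iso φ g⁻¹) • _
  rw [embeddingAction_apply, embeddingComp_inv_comp]
  congr 1
  obtain ⟨x, rfl⟩ := Additive.ofMul.surjective x
  obtain ⟨y, rfl⟩ := Additive.ofMul.surjective y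
  refine (FReal.argAt_apply φ y).trans ?_
  refine Eq.trans ?_ (FReal.argAt_apply (embeddingComp iso φ g⁻¹) x).symm
  exact congrArg (fun u => argHom (Additive.ofMul u)) (Units.ext (h φ))

theorem FReal.radialChar_of_ext_eq {x y : Additive (FReal F)ˣ} {g : G}
    (h : ∀ φ, FReal.ext φ (y.toMul : FReal F) =
      FReal.ext (embeddingComp iso φ g⁻¹) (x.toMul : FReal F)) (a : InfinitePlace F → ℝ) :
    FReal.radialChar a y = FReal.radialChar (fun w => a (iso g⁻¹ • w)) x := by
  rw [FReal.radialChar_apply, FReal.radialChar_apply]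
  refine Fintype.sum_equiv (MulAction.toPerm (iso g)) _ _ fun w => ?_
  rw [MulAction.toPerm_apply, map_inv, inv_smul_smul]
  congr 1
  obtain ⟨x, rfl⟩ := Additive.ofMul.surjective x
  obtain ⟨y, rfl⟩ := Additive.ofMul.surjective y
  rw [FReal.logHom_apply, FReal.logHom_apply]
  have h1 : InfinitePlace.mk (embeddingComp iso w.embedding g⁻¹) = iso g • w := by
    rw [mk_embeddingComp, inv_inv, InfinitePlace.mk_embedding]
  rw [show FReal.ext w.embedding (y : FReal F) = _ from h w.embedding, ← h1, FReal.norm_ext_mk]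
  rfl

end Embeddings

section Places


/-- The action on primes is the one induced by the Galois action. -/
def IsPrimeAction (iso : G ≃* (F ≃ₐ[K] F)) (act : G → Sf → Sf) : Prop :=
  ∀ g p, ((act g p : Sf) : HeightOneSpectrum (𝓞 F)) = conjPrime (iso g).toRingEquiv p.1

variable {iso : G ≃* (F ≃ₐ[K] F)} {act : G → Sf → Sf} (hact : IsPrimeAction iso act)

theorem conjPrime_inv_conjPrime (iso : G ≃* (F ≃ₐ[K] F)) (g : G) (v : HeightOneSpectrum (𝓞 F)) :
    conjPrime (iso g⁻¹).toRingEquiv (conjPrime (iso g).toRingEquiv v) = v := by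
  symm
  rw [conjPrime_eq_iff, (conjPrime_eq_iff _ _ _).1 rfl, Set.image_image]
  have : (fun x => (iso g⁻¹).toRingEquiv ((iso g).toRingEquiv x)) = id := by
    funext x
    change iso g⁻¹ (iso g x) = x
    rw [map_inv]
    exact (iso g).symm_apply_apply x
  rw [this, Set.image_id]

include hact

theorem IsPrimeAction.inv_act (g : G) (p : Sf) : act g⁻¹ (act g p) = p :=
  Subtype.ext (by rw [hact, hact, conjPrime_inv_conjPrime])

theorem IsPrimeAction.act_inv (g : G) (p : Sf) : act g (act g⁻¹ p) = p := by
  have := hact.inv_act g⁻¹ p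
  rwa [inv_inv] at this

theorem IsPrimeAction.conjPrime_mem_iff (g : G) (v : HeightOneSpectrum (𝓞 F)) :
    conjPrime (iso g).toRingEquiv v ∈ Sf ↔ v ∈ Sf := by
  refine ⟨fun h => ?_, fun h => hact g ⟨v, h⟩ ▸ (act g ⟨v, h⟩).2⟩
  rw [← conjPrime_inv_conjPrime iso g v]
  exact hact g⁻¹ ⟨_, h⟩ ▸ (act g⁻¹ ⟨_, h⟩).2

variable [NumberField F]

omit hact in
/-- The supported divisor `y` is the image of `z` under the action of `g`. -/
structure IsSupportedConj (iso : G ≃* (F ≃ₐ[K] F)) (act : G → Sf → Sf) (g : G)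
    (z y : supportedDom Sf) : Prop where
  arch : ∀ φ, FReal.ext φ ((supportArch Sf y).toMul : FReal F) =
    FReal.ext (embeddingComp iso φ g) ((supportArch Sf z).toMul : FReal F)
  vec : ∀ p, supportVec Sf y (act g p) = supportVec Sf z p

omit hact in
theorem IsSupportedConj.angularChar {g : G} {z y : supportedDom Sf}
    (h : IsSupportedConj iso act g⁻¹ z y) (m : (F →+* ℂ) → ℤ) :
    FReal.angularChar m (supportArch Sf y) =
      FReal.angularChar (embeddingAction iso g m) (supportArch Sf z) :=
  FReal.angularChar_of_ext_eq iso h.arch m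

theorem IsPrimeAction.sum_supportVec [Fintype Sf] {g : G} {z y : supportedDom Sf}
    (h : IsSupportedConj iso act g⁻¹ z y) (b : Sf → ℝ) :
    ∑ p, b p * (supportVec Sf y p : ℝ) = ∑ p, b (act g⁻¹ p) * (supportVec Sf z p : ℝ) := by
  refine Fintype.sum_equiv ⟨act g, act g⁻¹, hact.inv_act g, hact.act_inv g⟩ _ _ fun p => ?_
  change _ = b (act g⁻¹ (act g p)) * (supportVec Sf z (act g p) : ℝ)
  rw [hact.inv_act, ← h.vec, hact.inv_act]

theorem IsPrimeAction.realChar_eq [Fintype Sf] {g : G} {z y : supportedDom Sf}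
    (h : IsSupportedConj iso act g⁻¹ z y) (a : InfinitePlace F → ℝ) (b : Sf → ℝ) :
    realChar a b y = realChar (fun w => a (iso g⁻¹ • w)) (fun p => b (act g⁻¹ p)) z := by
  rw [realChar_apply, realChar_apply, hact.sum_supportVec h b,
    FReal.radialChar_of_ext_eq iso h.arch a]

end Places

end GaloisEquivariance

noncomputable section DualAction

variable {G : Type} [Group G]

/-- The contragredient action on the homomorphisms from a `ℤ[G]`-module to an abelian group. -/
def dualAction (M A : Type) [AddCommGroup M] [Module (MonoidAlgebra ℤ G) M] [AddCommGroup A]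
    [Module ℤ A] : G →* AddMonoid.End (M →ₗ[ℤ] A) where
  toFun g := AddMonoidHom.mk' (fun φ => φ.comp (Module.toAddMonoidEnd (MonoidAlgebra ℤ G) M
    (MonoidAlgebra.single g⁻¹ (1 : ℤ))).toIntLinearMap) fun _ _ => rfl
  map_one' := by
    refine AddMonoidHom.ext fun φ => LinearMap.ext fun x => congrArg φ ?_
    change (MonoidAlgebra.single (1 : G)⁻¹ (1 : ℤ) : MonoidAlgebra ℤ G) • x = x
    rw [inv_one, ← MonoidAlgebra.one_def, one_smul]
  map_mul' g h := by
    refine AddMonoidHom.ext fun φ => LinearMap.ext fun x => congrArg φ ?_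
    change (MonoidAlgebra.single (g * h)⁻¹ (1 : ℤ) : MonoidAlgebra ℤ G) • x =
      (MonoidAlgebra.single h⁻¹ (1 : ℤ) : MonoidAlgebra ℤ G) •
        (MonoidAlgebra.single g⁻¹ (1 : ℤ) : MonoidAlgebra ℤ G) • x
    rw [smul_smul, MonoidAlgebra.single_mul_single, mul_inv_rev, one_mul]

theorem dualAction_apply {M A : Type} [AddCommGroup M] [Module (MonoidAlgebra ℤ G) M]
    [AddCommGroup A] [Module ℤ A] (g : G) (φ : M →ₗ[ℤ] A) (x : M) :
    dualAction M A g φ x = φ ((MonoidAlgebra.single g⁻¹ (1 : ℤ) : MonoidAlgebra ℤ G) • x) := rfl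

end DualAction

noncomputable section UnitAction

open IsDedekindDomain FractionalIdeal

variable {K F G : Type} [Field K] [Field F] [NumberField F] [Algebra K F] [Group G]
  {Sf : Set (HeightOneSpectrum (𝓞 F))} (iso : G ≃* (F ≃ₐ[K] F))
  [Module (MonoidAlgebra ℤ G) (Additive (Sf.unit F))]

/-- The group ring acts on `S`-units through the Galois action. -/
def IsUnitAction : Prop :=
  ∀ (g : G) (u v : Sf.unit F), ((v : Fˣ) : F) = iso g ((u : Fˣ) : F) →
    (MonoidAlgebra.single g (1 : ℤ) : MonoidAlgebra ℤ G) • Additive.ofMul u = Additive.ofMul v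

variable {iso} {act : G → Sf → Sf} (hact : IsPrimeAction iso act) (hU : IsUnitAction (Sf := Sf) iso)

include hact hU

theorem IsPrimeAction.coe_single_smul (g : G) (u : Additive (Sf.unit F)) :
    ((((MonoidAlgebra.single g (1 : ℤ) : MonoidAlgebra ℤ G) • u).toMul : Fˣ) : F) =
      iso g ((u.toMul : Fˣ) : F) := by
  have hmem : Units.map ((iso g : F →+* F) : F →* F) (u.toMul : Fˣ) ∈ Sf.unit F := fun v hv => by
    have h1 : conjPrime (iso g⁻¹).toRingEquiv v ∉ Sf := fun h => hv ((hact.conjPrime_mem_iff _ _).1 h)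
    have h2 := conjPrime_inv_conjPrime iso g⁻¹ v
    rw [inv_inv] at h2
    rw [← h2]
    exact (valuation_conjPrime (iso g).toRingEquiv _ _).trans (u.toMul.2 _ h1)
  exact congrArg (fun w : Additive (Sf.unit F) => ((w.toMul : Fˣ) : F)) (hU g u.toMul ⟨_, hmem⟩ rfl)

theorem IsPrimeAction.isSupportedConj_unitDivisor (g : G) (u : Additive (Sf.unit F)) :
    IsSupportedConj iso act g (unitDivisor Sf u)
      (unitDivisor Sf ((MonoidAlgebra.single g (1 : ℤ) : MonoidAlgebra ℤ G) • u)) where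
  arch φ := by
    rw [ext_supportArch_unitDivisor, ext_supportArch_unitDivisor, hact.coe_single_smul hU]
    rfl
  vec p := by
    have h1 := valuation_eq_supportVec (act g p)
      ((MonoidAlgebra.single g (1 : ℤ) : MonoidAlgebra ℤ G) • u)
    rw [hact.coe_single_smul hU, hact] at h1
    have h2 := h1.symm.trans ((valuation_conjPrime (iso g).toRingEquiv p.1 _).trans
      (valuation_eq_supportVec p u))
    exact neg_injective (WithZero.exp_inj.1 h2)

theorem IsPrimeAction.unitAngularChar_embeddingAction (g : G) (m : (F →+* ℂ) → ℤ) (u : Additive (Sf.unit F)) :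
    unitAngularChar Sf (embeddingAction iso g m) u = unitAngularChar Sf m
      ((MonoidAlgebra.single g⁻¹ (1 : ℤ) : MonoidAlgebra ℤ G) • u) :=
  ((hact.isSupportedConj_unitDivisor hU g⁻¹ u).angularChar m).symm

/-- The action of the Galois group on compatible pairs. -/
def IsPrimeAction.pairAction : G →* AddMonoid.End (charPairs Sf) where
  toFun g := AddMonoidHom.mk' (fun e => ⟨(embeddingAction iso g e.1.1,
      e.1.2.comp (Module.toAddMonoidEnd (MonoidAlgebra ℤ G) _ (MonoidAlgebra.single g⁻¹ (1 : ℤ)))),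
    mem_charPairs_iff.2 fun u => by
      rw [hact.unitAngularChar_embeddingAction hU]
      exact mem_charPairs_iff.1 e.2 _⟩) fun _ _ => rfl
  map_one' := by
    refine AddMonoidHom.ext fun e => Subtype.ext (Prod.ext ?_ (AddMonoidHom.ext fun u => ?_))
    · exact DFunLike.congr_fun (map_one (embeddingAction iso)) e.1.1
    · change e.1.2 ((MonoidAlgebra.single (1 : G)⁻¹ (1 : ℤ) : MonoidAlgebra ℤ G) • u) = e.1.2 u
      rw [inv_one, ← MonoidAlgebra.one_def, one_smul]
  map_mul' g h := by
    refine AddMonoidHom.ext fun e => Subtype.ext (Prod.ext ?_ (AddMonoidHom.ext fun u => ?_))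
    · exact DFunLike.congr_fun (map_mul (embeddingAction iso) g h) e.1.1
    · change e.1.2 ((MonoidAlgebra.single (g * h)⁻¹ (1 : ℤ) : MonoidAlgebra ℤ G) • u) =
        e.1.2 ((MonoidAlgebra.single h⁻¹ (1 : ℤ) : MonoidAlgebra ℤ G) •
          (MonoidAlgebra.single g⁻¹ (1 : ℤ) : MonoidAlgebra ℤ G) • u)
      rw [smul_smul, MonoidAlgebra.single_mul_single, mul_inv_rev, one_mul]

theorem IsPrimeAction.pairAction_snd_apply (g : G) (e : charPairs Sf) (u : Additive (Sf.unit F)) :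
    (hact.pairAction hU g e).1.2 u =
      e.1.2 ((MonoidAlgebra.single g⁻¹ (1 : ℤ) : MonoidAlgebra ℤ G) • u) := rfl

theorem IsPrimeAction.latticePair_dualAction {L : Type} [AddCommGroup L]
    [Module (MonoidAlgebra ℤ G) L] (π : Additive (Sf.unit F) →ₗ[MonoidAlgebra ℤ G] L) (g : G)
    (k : L →ₗ[ℤ] ℤ) : latticePair π.toAddMonoidHom (dualAction L ℤ g k) =
      hact.pairAction hU g (latticePair π.toAddMonoidHom k) := by
  refine Subtype.ext (Prod.ext rfl (AddMonoidHom.ext fun u => ?_))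
  rw [hact.pairAction_snd_apply, latticePair_snd_apply, latticePair_snd_apply, dualAction_apply]
  exact congrArg (fun x => ((k x : ℤ) : ℝ)) (map_smul π _ u).symm

theorem IsPrimeAction.torsionRestrict_embeddingAction {T : Type} [AddCommGroup T] [Finite T]
    [Module (MonoidAlgebra ℤ G) T] (ι : T →ₗ[MonoidAlgebra ℤ G] Additive (Sf.unit F)) (g : G)
    (m : (F →+* ℂ) → ℤ) : torsionRestrict ι.toAddMonoidHom (embeddingAction iso g m) =
      dualAction T QmodZ g (torsionRestrict ι.toAddMonoidHom m) := by
  refine LinearMap.ext fun t => QmodZ.toCircle_injective ?_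
  rw [dualAction_apply, toCircle_torsionRestrict, toCircle_torsionRestrict]
  refine (hact.unitAngularChar_embeddingAction hU g m _).trans (congrArg _ ?_)
  exact (map_smul ι _ t).symm

theorem IsPrimeAction.placePair_comp [Fintype Sf] (g : G) (f : InfinitePlace F ⊕ Sf → ℤ) :
    placePair (f ∘ Sum.map (fun w => iso g⁻¹ • w) (act g⁻¹)) =
      hact.pairAction hU g (placePair f) := by
  refine Subtype.ext (Prod.ext ?_ (AddMonoidHom.ext fun u => ?_))
  · exact (embeddingAction_trivialWinding iso (fun w => f (Sum.inl w)) g).symm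
  · rw [hact.pairAction_snd_apply, placePair_snd_apply, placePair_snd_apply]
    exact (hact.sum_supportVec (hact.isSupportedConj_unitDivisor hU g⁻¹ u)
      fun p => (f (Sum.inr p) : ℝ)).symm

end UnitAction

noncomputable section ClassAction

open IsDedekindDomain FractionalIdeal

variable {K F G : Type} [Field K] [CharZero K] [Field F] [NumberField F] [Algebra K F] [Group G]
  {Sf : Set (HeightOneSpectrum (𝓞 F))}

/-- The maps `ρT g` describe the Galois action on oriented Arakelov divisor classes. -/
def IsClassAction (iso : G ≃* (F ≃ₐ[K] F)) (ρT : G → PicTilde F → PicTilde F) : Prop :=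
  ∀ (g : G) (x : picDom F), ∃ y : picDom F,
    IsConjDivisor (iso g) (Additive.ofMul x) (Additive.ofMul y) ∧
      ρT g (PicTilde.mk F x) = PicTilde.mk F y

variable {iso : G ≃* (F ≃ₐ[K] F)} {act : G → Sf → Sf} (hact : IsPrimeAction iso act)
  {ρT : G → PicTilde F → PicTilde F} (hρT : IsClassAction iso ρT)

include hact hρT

theorem IsPrimeAction.exists_isSupportedConj (g : G) (z : supportedDom Sf) :
    ∃ y, IsSupportedConj iso act g z y ∧
      Additive.ofMul (ρT g (supportClass Sf z).toMul) = supportClass Sf y := by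
  obtain ⟨y, hy, hρ⟩ := hρT g z.1.toMul
  have hmem : Additive.ofMul y ∈ supportedDom Sf := mem_supportedDom_iff.2 fun v hv => by
    have h1 : conjPrime (iso g⁻¹).toRingEquiv v ∉ Sf := fun h => hv ((hact.conjPrime_mem_iff _ _).1 h)
    have h2 := conjPrime_inv_conjPrime iso g⁻¹ v
    rw [inv_inv] at h2
    rw [← h2]
    exact (hy.count _).trans (mem_supportedDom_iff.1 z.2 _ h1)
  refine ⟨⟨_, hmem⟩, ⟨hy.ext_arch, fun p => ?_⟩, congrArg Additive.ofMul hρ⟩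
  change countHom (act g p).1 _ = countHom p.1 _
  rw [hact]
  exact hy.count p.1

theorem IsPrimeAction.pairChar_pairAction [Fintype Sf]
    [Module (MonoidAlgebra ℤ G) (Additive (Sf.unit F))] (hU : IsUnitAction (Sf := Sf) iso)
    [Module (MonoidAlgebra ℤ G) (ArTilde F)]
    (hA : ∀ (g : G) (χ : ArTilde F) (c : PicTilde F),
      ((MonoidAlgebra.single g (1 : ℤ) : MonoidAlgebra ℤ G) • χ) (Additive.ofMul c) =
        χ (Additive.ofMul (ρT g⁻¹ c)))
    (hsurj : Function.Surjective (supportClass Sf)) (g : G) (e : charPairs Sf) :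
    pairChar hsurj (hact.pairAction hU g e) =
      (MonoidAlgebra.single g (1 : ℤ) : MonoidAlgebra ℤ G) • pairChar hsurj e := by
  obtain ⟨a, b, h⟩ := exists_realChar_unitDivisor_eq e.1.2
  refine ArTilde.ext_supportClass hsurj fun z => ?_
  obtain ⟨y, hy, hρ⟩ := hact.exists_isSupportedConj hρT g⁻¹ z
  refine Eq.trans ?_ ((hA g _ (supportClass Sf z).toMul).trans (by rw [hρ])).symm
  refine (pairChar_apply hsurj _ (a := fun w => a (iso g⁻¹ • w)) (b := fun p => b (act g⁻¹ p))
    (fun u => ?_) z).trans (Eq.trans ?_ (pairChar_apply hsurj e h y).symm)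
  · rw [hact.pairAction_snd_apply, ← h]
    exact (hact.realChar_eq (hact.isSupportedConj_unitDivisor hU g⁻¹ u) a b).symm
  · rw [fullChar_apply, fullChar_apply, hact.realChar_eq hy a b, hy.angularChar]
    rfl

end ClassAction

section TorsionPart

variable (R U : Type) [Ring R] [AddCommGroup U] [Module R U]

/-- The submodule of elements of finite additive order. -/
def torsionPart : Submodule R U where
  carrier := {x | IsOfFinAddOrder x}
  zero_mem' := IsOfFinAddOrder.zero
  add_mem' hx hy := hx.add hy
  smul_mem' r _ hx := (Module.toAddMonoidEnd R U r).isOfFinAddOrder hx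

theorem mem_torsionPart {x : U} : x ∈ torsionPart R U ↔ IsOfFinAddOrder x := Iff.rfl

variable [Module.Finite ℤ U]

theorem finite_torsionPart : Finite (torsionPart R U) := by
  have h1 : Module.Finite ℤ (torsionPart R U) :=
    Module.Finite.of_injective (torsionPart R U).subtype.toAddMonoidHom.toIntLinearMap
      Subtype.val_injective
  refine Module.finite_of_fg_torsion _ fun x => ?_
  obtain ⟨n, hn, hx⟩ := isOfFinAddOrder_iff_nsmul_eq_zero.1 x.2
  refine ⟨⟨n, mem_nonZeroDivisors_of_ne_zero (by exact_mod_cast hn.ne')⟩, Subtype.ext ?_⟩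
  change (n : ℤ) • x.1 = 0
  rw [natCast_zsmul, hx]

theorem finite_quotient_torsionPart : Module.Finite ℤ (U ⧸ torsionPart R U) :=
  Module.Finite.of_surjective (torsionPart R U).mkQ.toAddMonoidHom.toIntLinearMap
    (torsionPart R U).mkQ_surjective

theorem free_quotient_torsionPart : Module.Free ℤ (U ⧸ torsionPart R U) := by
  have := finite_quotient_torsionPart R U
  have : IsAddTorsionFree (U ⧸ torsionPart R U) := by
    refine ⟨fun n hn x y h => ?_⟩
    obtain ⟨z, hz⟩ := (torsionPart R U).mkQ_surjective (x - y)
    have h1 : (torsionPart R U).mkQ (n • z) = 0 := by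
      rw [map_nsmul, hz, nsmul_sub, sub_eq_zero]
      exact h
    rw [Submodule.mkQ_apply, Submodule.Quotient.mk_eq_zero, mem_torsionPart] at h1
    rw [← sub_eq_zero, ← hz, Submodule.mkQ_apply, Submodule.Quotient.mk_eq_zero, mem_torsionPart]
    exact h1.of_nsmul hn
  infer_instance

end TorsionPart

noncomputable section MainComputation

open IsDedekindDomain FractionalIdeal

section Coordinates

variable {M X : Type} [AddCommGroup M] (e : M ≃+ (X →₀ ℤ))

/-- The values of an integral functional at the elements of a basis. -/
def basisValues : (M →ₗ[ℤ] ℤ) →+ (X → ℤ) :=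
  AddMonoidHom.mk' (fun φ s => φ (e.symm (Finsupp.single s 1))) fun _ _ => rfl

theorem basisValues_injective : Function.Injective (basisValues e) := fun φ ψ h => by
  have h1 : (φ.toAddMonoidHom.comp e.symm.toAddMonoidHom) =
      ψ.toAddMonoidHom.comp e.symm.toAddMonoidHom :=
    Finsupp.addHom_ext' fun s => AddMonoidHom.ext_int (congrFun h s)
  refine LinearMap.ext fun x => ?_
  have := DFunLike.congr_fun h1 (e x)
  simpa using this

theorem basisValues_surjective : Function.Surjective (basisValues e) := fun f => by
  refine ⟨((Finsupp.liftAddHom fun s => AddMonoidHom.mulLeft (f s)).comp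
    e.toAddMonoidHom).toIntLinearMap, funext fun s => ?_⟩
  change (Finsupp.liftAddHom fun s => AddMonoidHom.mulLeft (f s)) (e (e.symm _)) = f s
  rw [AddEquiv.apply_symm_apply, Finsupp.liftAddHom_apply_single, AddMonoidHom.coe_mulLeft, mul_one]

theorem basisValues_dualAction {G : Type} [Group G] [Module (MonoidAlgebra ℤ G) M] {g : G}
    {t : X → X} (h : ∀ x : M, e ((MonoidAlgebra.single g⁻¹ (1 : ℤ) : MonoidAlgebra ℤ G) • x) =
      Finsupp.mapDomain t (e x)) (φ : M →ₗ[ℤ] ℤ) :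
    basisValues e (dualAction M ℤ g φ) = basisValues e φ ∘ t := funext fun s => by
  change φ _ = φ (e.symm (Finsupp.single (t s) 1))
  refine congrArg φ (e.injective ((h _).trans ?_))
  rw [e.apply_symm_apply, e.apply_symm_apply, Finsupp.mapDomain_single]

include e

theorem finite_of_addEquiv_finsupp [Finite X] : Module.Finite ℤ M :=
  Module.Finite.of_surjective e.symm.toAddMonoidHom.toIntLinearMap e.symm.surjective

theorem projective_of_addEquiv_finsupp : Module.Projective ℤ M :=
  Module.Projective.of_equiv e.symm.toIntLinearEquiv

end Coordinates

section Duality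

variable {G : Type} [Group G] (σ : G0 (MonoidAlgebra ℤ G) →+ G0 (MonoidAlgebra ℤ G))

/-- On lattices, `σ` is induced by `M ↦ Hom_ℤ(M, ℤ)`. -/
def IsLatticeDuality : Prop :=
  ∀ (M : Type) [AddCommGroup M] [Module (MonoidAlgebra ℤ G) M]
    [Module.Finite (MonoidAlgebra ℤ G) M] [Module.Projective ℤ M]
    [Module (MonoidAlgebra ℤ G) (M →ₗ[ℤ] ℤ)],
    (∀ (g : G) (φ : M →ₗ[ℤ] ℤ) (x : M),
      ((MonoidAlgebra.single g (1 : ℤ) : MonoidAlgebra ℤ G) • φ) x =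
        φ ((MonoidAlgebra.single g⁻¹ (1 : ℤ) : MonoidAlgebra ℤ G) • x)) →
    σ (G0.cls (MonoidAlgebra ℤ G) M) = G0.cls (MonoidAlgebra ℤ G) (M →ₗ[ℤ] ℤ)

/-- On finite modules, `σ` is induced by `N ↦ Hom_ℤ(N, ℚ/ℤ)` up to sign. -/
def IsTorsionDuality : Prop :=
  ∀ (N : Type) [AddCommGroup N] [Module (MonoidAlgebra ℤ G) N]
    [Module (MonoidAlgebra ℤ G) (N →ₗ[ℤ] QmodZ)], Finite N →
    (∀ (g : G) (φ : N →ₗ[ℤ] QmodZ) (x : N),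
      ((MonoidAlgebra.single g (1 : ℤ) : MonoidAlgebra ℤ G) • φ) x =
        φ ((MonoidAlgebra.single g⁻¹ (1 : ℤ) : MonoidAlgebra ℤ G) • x)) →
    σ (G0.cls (MonoidAlgebra ℤ G) N) = - G0.cls (MonoidAlgebra ℤ G) (N →ₗ[ℤ] QmodZ)

end Duality

variable {K F G : Type} [Field K] [NumberField K] [Field F] [NumberField F] [Algebra K F]
  [IsGalois K F] [Group G] {Sf : Set (HeightOneSpectrum (𝓞 F))} [Fintype Sf]
  {iso : G ≃* (F ≃ₐ[K] F)} {act : G → Sf → Sf} (hact : IsPrimeAction iso act)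
  {ρT : G → PicTilde F → PicTilde F} (hρT : IsClassAction iso ρT)
  [Module (MonoidAlgebra ℤ G) (Additive (Sf.unit F))] (hU : IsUnitAction (Sf := Sf) iso)
  [Module (MonoidAlgebra ℤ G) (ArTilde F)]
  (hA : ∀ (g : G) (χ : ArTilde F) (c : PicTilde F),
    ((MonoidAlgebra.single g (1 : ℤ) : MonoidAlgebra ℤ G) • χ) (Additive.ofMul c) =
      χ (Additive.ofMul (ρT g⁻¹ c)))
  (hsurj : Function.Surjective (supportClass Sf))
  {M : Type} [AddCommGroup M] [Module (MonoidAlgebra ℤ G) M]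
  (e : M ≃+ (InfinitePlace F ⊕ Sf →₀ ℤ))
  (hM : ∀ (g : G) (x : M), e ((MonoidAlgebra.single g (1 : ℤ) : MonoidAlgebra ℤ G) • x) =
    Finsupp.mapDomain (Sum.map (fun w => iso g • w) (act g)) (e x))
  {σ : G0 (MonoidAlgebra ℤ G) →+ G0 (MonoidAlgebra ℤ G)}
  (hlat : IsLatticeDuality σ) (htor : IsTorsionDuality σ)

include hact hρT hU hA hsurj hM hlat htor

theorem cls_arTilde_of_exact {T L : Type} [AddCommGroup T] [AddCommGroup L] [Finite T]
    [Module (MonoidAlgebra ℤ G) T] [Module (MonoidAlgebra ℤ G) L] [Module.Free ℤ L]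
    (ι : T →ₗ[MonoidAlgebra ℤ G] Additive (Sf.unit F))
    (π : Additive (Sf.unit F) →ₗ[MonoidAlgebra ℤ G] L)
    (hι : Function.Injective ι) (hιπ : Function.Exact ι π) (hπ : Function.Surjective π) :
    G0.cls (MonoidAlgebra ℤ G) (ArTilde F) =
      Module.finrank ℚ K • G0.cls (MonoidAlgebra ℤ G) (MonoidAlgebra ℤ G) -
        σ (G0.cls (MonoidAlgebra ℤ G) M - G0.cls (MonoidAlgebra ℤ G) (Additive (Sf.unit F))) := by
  have : Finite G := Finite.of_equiv _ iso.symm.toEquiv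
  have hMfin : Module.Finite ℤ M := finite_of_addEquiv_finsupp e
  have hMproj : Module.Projective ℤ M := projective_of_addEquiv_finsupp e
  have hLfin : Module.Finite ℤ L :=
    Module.Finite.of_surjective π.toAddMonoidHom.toIntLinearMap hπ
  have : Module.Finite (MonoidAlgebra ℤ G) M := Module.Finite.of_restrictScalars_finite ℤ _ _
  have : Module.Finite (MonoidAlgebra ℤ G) L := Module.Finite.of_restrictScalars_finite ℤ _ _
  let _ := moduleOfAction (embeddingAction iso)
  let _ := moduleOfAction (hact.pairAction hU)
  let _ := moduleOfAction (dualAction (G := G) M ℤ)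
  let _ := moduleOfAction (dualAction (G := G) L ℤ)
  let _ := moduleOfAction (dualAction (G := G) T QmodZ)
  have hM' := hlat M fun g φ x => by rw [moduleOfAction_single_smul, dualAction_apply]
  have hL' := hlat L fun g φ x => by rw [moduleOfAction_single_smul, dualAction_apply]
  have hT' := htor T ‹_› fun g φ x => by rw [moduleOfAction_single_smul, dualAction_apply]
  let j := (placePair.comp (basisValues e)).toGroupRingLinearMap (G := G) fun g φ => by
    rw [moduleOfAction_single_smul, moduleOfAction_single_smul, AddMonoidHom.comp_apply,
      basisValues_dualAction e (hM g⁻¹)]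
    exact hact.placePair_comp hU g _
  let q := (pairChar hsurj).toGroupRingLinearMap (G := G) fun g c => by
    rw [moduleOfAction_single_smul]
    exact hact.pairChar_pairAction hρT hU hA hsurj g c
  let i := (latticePair π.toAddMonoidHom).toGroupRingLinearMap (G := G) fun g k => by
    rw [moduleOfAction_single_smul, moduleOfAction_single_smul]
    exact hact.latticePair_dualAction hU π g k
  let p := (pairWinding Sf).toGroupRingLinearMap (G := G) fun g c => by
    rw [moduleOfAction_single_smul, moduleOfAction_single_smul]
    rfl
  let r := (torsionRestrict ι.toAddMonoidHom).toGroupRingLinearMap (G := G) fun g m => by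
    rw [moduleOfAction_single_smul, moduleOfAction_single_smul]
    exact hact.torsionRestrict_embeddingAction hU ι g m
  have hjq : Function.Exact j q := fun c => by
    refine (exact_placePair_pairChar hsurj c).trans ⟨?_, ?_⟩
    · rintro ⟨f, rfl⟩
      obtain ⟨φ, rfl⟩ := basisValues_surjective e f
      exact ⟨φ, rfl⟩
    · rintro ⟨φ, rfl⟩
      exact ⟨_, rfl⟩
  obtain ⟨h1, h2⟩ := G0.cls_eq_of_two_extensions (G := G) (inferInstance : Module.Finite ℤ _)
    (inferInstance : Module.Finite ℤ _) finite_sUnit j q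
    (placePair_injective.comp (basisValues_injective e)) hjq (pairChar_surjective hsurj) i p r
    (latticePair_injective hπ) (exact_latticePair_pairWinding (ι := ι.toAddMonoidHom) hπ hιπ)
    (exact_pairWinding_torsionRestrict ι.toAddMonoidHom (π := π.toAddMonoidHom) hπ hιπ) (torsionRestrict_surjective hι)
    ι π hι hιπ hπ
  rw [h1, h2, cls_embeddings iso, map_sub, map_add, hM', hL', hT']
  abel

theorem cls_arTilde :
    G0.cls (MonoidAlgebra ℤ G) (ArTilde F) =
      Module.finrank ℚ K • G0.cls (MonoidAlgebra ℤ G) (MonoidAlgebra ℤ G) -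
        σ (G0.cls (MonoidAlgebra ℤ G) M - G0.cls (MonoidAlgebra ℤ G) (Additive (Sf.unit F))) := by
  let T := torsionPart (MonoidAlgebra ℤ G) (Additive (Sf.unit F))
  have : Finite T := finite_torsionPart _ _
  have : Module.Free ℤ (Additive (Sf.unit F) ⧸ T) := free_quotient_torsionPart _ _
  exact cls_arTilde_of_exact hact hρT hU hA hsurj e hM hlat htor (T := T) T.subtype T.mkQ
    T.injective_subtype (LinearMap.exact_subtype_mkQ T) T.mkQ_surjective

end MainComputation

/-!
STATEMENT 9: Let F/K be a finite Galois extension of number fields with Galois group G,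
let d be the degree of K over ℚ, and let S be a finite G-stable set of places of F
containing all archimedean places and large enough that Cl_{F,S} is trivial.  Then
[Ãr_F] = d·[ℤ[G]] − σ([ℤ[S]] − [O×_{F,S}]) in G₀(ℤ[G]).
-/
theorem stmt9
    (K F : Type) [Field K] [NumberField K] [Field F] [NumberField F] [Algebra K F]
    [IsGalois K F] (G : Type) [Group G] (iso : G ≃* (F ≃ₐ[K] F))
    -- the Galois action of G on the oriented Arakelov class group, characterized on classes
    -- of oriented Arakelov divisors (I, b) via the action on the underlying ideals and on F_ℝ
    (ρT : G → PicTilde F → PicTilde F)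
    (hρT : ∀ (g : G) (x : picDom F), ∃ y : picDom F,
      ((((((y : IdealGroup F × (FReal F)ˣ).1 : FractionalIdeal (𝓞 F)⁰ F) :
          Submodule (𝓞 F) F) : Set F)) =
        (iso g) '' (((((x : IdealGroup F × (FReal F)ˣ).1 : FractionalIdeal (𝓞 F)⁰ F) :
          Submodule (𝓞 F) F) : Set F))) ∧
      (((y : IdealGroup F × (FReal F)ˣ).2 : FReal F) =
        galFReal K (iso g) ((x : IdealGroup F × (FReal F)ˣ).2 : FReal F)) ∧
      ρT g (PicTilde.mk F x) = PicTilde.mk F y)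
    -- the ℤ[G]-module structure on the Pontryagin dual (G acting via g ↦ g⁻¹)
    [mAT : Module (MonoidAlgebra ℤ G) (ArTilde F)]
    (hmAT : ∀ (g : G) (φ : ArTilde F) (z : PicTilde F),
      ((MonoidAlgebra.single g (1 : ℤ) : MonoidAlgebra ℤ G) • φ) (Additive.ofMul z) =
        φ (Additive.ofMul (ρT g⁻¹ z)))
    -- a finite G-stable set S of places of F containing all archimedean places,
    -- given by its set Sf of non-archimedean places (the archimedean ones are always included)
    (Sf : Set (IsDedekindDomain.HeightOneSpectrum (𝓞 F))) (hSffin : Sf.Finite)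
    [IsDedekindDomain (Sf.integer F)]
    -- the G-action on the finite places in S (G-stability of S)
    (act : G → {v // v ∈ Sf} → {v // v ∈ Sf})
    (hact : ∀ (g : G) (v : {v // v ∈ Sf}),
      algebraMap (𝓞 F) F ''
          (((act g v : IsDedekindDomain.HeightOneSpectrum (𝓞 F))).asIdeal : Set (𝓞 F)) =
        iso g '' (algebraMap (𝓞 F) F ''
          ((v : IsDedekindDomain.HeightOneSpectrum (𝓞 F)).asIdeal : Set (𝓞 F))))
    -- the permutation module ℤ[S]
    [mS : Module (MonoidAlgebra ℤ G)
      ((NumberField.InfinitePlace F ⊕ {v // v ∈ Sf}) →₀ ℤ)]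
    (hmS : ∀ (g : G) (x : (NumberField.InfinitePlace F ⊕ {v // v ∈ Sf}) →₀ ℤ),
      (MonoidAlgebra.single g (1 : ℤ) : MonoidAlgebra ℤ G) • x =
        Finsupp.mapDomain (Sum.map (fun w => iso g • w) (act g)) x)
    -- the ℤ[G]-module of S-units O_{F,S}^×
    [mU : Module (MonoidAlgebra ℤ G) (Additive (Sf.unit F))]
    (hmU : ∀ (g : G) (u v : Sf.unit F), ((v : Fˣ) : F) = iso g ((u : Fˣ) : F) →
      (MonoidAlgebra.single g (1 : ℤ) : MonoidAlgebra ℤ G) • Additive.ofMul u =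
        Additive.ofMul v)
    -- the ℤ[G]-module Cl_{F,S}, the class group of the ring of S-integers
    [mCl : Module (MonoidAlgebra ℤ G) (Additive (ClassGroup (Sf.integer F)))]
    (hmCl : ∀ (g : G) (I J : (Ideal (Sf.integer F))⁰),
      ((fun x : Sf.integer F => (x : F)) ''
          ((J : Ideal (Sf.integer F)) : Set (Sf.integer F)) =
        iso g '' ((fun x : Sf.integer F => (x : F)) ''
          ((I : Ideal (Sf.integer F)) : Set (Sf.integer F)))) →
      (MonoidAlgebra.single g (1 : ℤ) : MonoidAlgebra ℤ G) •
          Additive.ofMul (ClassGroup.mk0 I) = Additive.ofMul (ClassGroup.mk0 J))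
    -- σ : the duality endomorphism of G₀(ℤ[G]) induced by M ↦ Hom_ℤ(M,ℤ) on lattices
    -- (with G acting via the involution g ↦ g⁻¹); on a finite module N it satisfies
    -- σ[N] = −[Hom_ℤ(N, ℚ/ℤ)]
    (σ : G0 (MonoidAlgebra ℤ G) →+ G0 (MonoidAlgebra ℤ G))
    (hσlat : ∀ (M : Type) [AddCommGroup M] [Module (MonoidAlgebra ℤ G) M]
        [Module.Finite (MonoidAlgebra ℤ G) M] [Module.Projective ℤ M]
        [Module (MonoidAlgebra ℤ G) (M →ₗ[ℤ] ℤ)],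
      (∀ (g : G) (φ : M →ₗ[ℤ] ℤ) (x : M),
        ((MonoidAlgebra.single g (1 : ℤ) : MonoidAlgebra ℤ G) • φ) x =
          φ ((MonoidAlgebra.single g⁻¹ (1 : ℤ) : MonoidAlgebra ℤ G) • x)) →
      σ (G0.cls (MonoidAlgebra ℤ G) M) = G0.cls (MonoidAlgebra ℤ G) (M →ₗ[ℤ] ℤ))
    (hσtor : ∀ (N : Type) [AddCommGroup N] [Module (MonoidAlgebra ℤ G) N]
        [Module (MonoidAlgebra ℤ G) (N →ₗ[ℤ] QmodZ)], Finite N →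
      (∀ (g : G) (φ : N →ₗ[ℤ] QmodZ) (x : N),
        ((MonoidAlgebra.single g (1 : ℤ) : MonoidAlgebra ℤ G) • φ) x =
          φ ((MonoidAlgebra.single g⁻¹ (1 : ℤ) : MonoidAlgebra ℤ G) • x)) →
      σ (G0.cls (MonoidAlgebra ℤ G) N) = - G0.cls (MonoidAlgebra ℤ G) (N →ₗ[ℤ] QmodZ))
    (htriv : Subsingleton (ClassGroup (Sf.integer F))) :
    G0.cls (MonoidAlgebra ℤ G) (ArTilde F) =
      (Module.finrank ℚ K) • G0.cls (MonoidAlgebra ℤ G) (MonoidAlgebra ℤ G) -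
        σ (G0.cls (MonoidAlgebra ℤ G) ((NumberField.InfinitePlace F ⊕ {v // v ∈ Sf}) →₀ ℤ) - G0.cls (MonoidAlgebra ℤ G) (Additive (Sf.unit F))) := by
  have := hSffin.fintype
  exact cls_arTilde (fun g p => (conjPrime_eq_iff _ _ _).2 (hact g p))
    (fun g x => let ⟨y, h1, h2, h3⟩ := hρT g x; ⟨y, ⟨h1, h2⟩, h3⟩) hmU hmAT
    (supportClass_surjective htriv) (AddEquiv.refl _) hmS hσlat hσtor
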